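/- Let q be a power of 2, n ≥ 1, and let SO^+_{2n}(𝐅_q) = {g ∈ O^+_{2n}(𝐅_q) : rank(g + 1) is even} (the kernel of the Dickson invariant, an index-2 subgroup of O^+_{2n}(𝐅_q)). The number of orbits of SO^+_{2n}(𝐅_q) acting by conjugation on the set of nilpotent elements of 𝔬^+_{2n}(𝐅_q) equals (1/2)p₂(n) if n is odd, and equals (1/2)p₂(n) + (3/2)p(n/2) if n is even. -/

import Mathlib

open Module Finset

/-- The radical `V^⊥ = {v | ⟨v,w⟩ = 0 for all w}` of the polar form of `Q`. -/
def QuadraticForm.polarRadical {F V : Type*} [Field F] [AddCommGroup V] [Module F V]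
    (Q : QuadraticForm F V) : Submodule F V :=
  LinearMap.ker (QuadraticMap.polarBilin Q)

/-- A quadratic space `(V, Q)` (in characteristic 2) is non-degenerate if `V ≠ 0`,
`dim V^⊥ ≤ 1` and `Q(v) ≠ 0` for every nonzero `v ∈ V^⊥`. -/
def QuadraticForm.IsNondegenerateFormSpace {F V : Type*} [Field F] [AddCommGroup V] [Module F V]
    (Q : QuadraticForm F V) : Prop :=
  Nontrivial V ∧ Module.finrank F Q.polarRadical ≤ 1 ∧
    ∀ v ∈ Q.polarRadical, v ≠ 0 → Q v ≠ 0

/-- Membership in the orthogonal Lie algebra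
`𝔬(V) = {x ∈ End(V) | ⟨xv, v⟩ = 0 ∀ v, tr x = 0}`. -/
def QuadraticForm.mem_oLie {F V : Type*} [Field F] [AddCommGroup V] [Module F V]
    (Q : QuadraticForm F V) (x : Module.End F V) : Prop :=
  (∀ v : V, QuadraticMap.polar Q (x v) v = 0) ∧ LinearMap.trace F V x = 0

/-- Two endomorphisms of `V` are conjugate under the orthogonal group
`O(V) = {g ∈ GL(V) | Q(gv) = Q(v) ∀ v}`. -/
def QuadraticForm.OConj {F V : Type*} [Field F] [AddCommGroup V] [Module F V]
    (Q : QuadraticForm F V) (x y : Module.End F V) : Prop :=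
  ∃ g : V ≃ₗ[F] V, (∀ v : V, Q (g v) = Q v) ∧
    y = g.toLinearMap ∘ₗ x ∘ₗ g.symm.toLinearMap

/-- The number of orbits of `O(V)` acting by conjugation on the set of nilpotent
elements of `𝔬(V)`. -/
noncomputable def QuadraticForm.numNilpotentOOrbits {F V : Type*} [Field F] [AddCommGroup V]
    [Module F V] (Q : QuadraticForm F V) : ℕ :=
  Nat.card (Quot fun x y : {x : Module.End F V // Q.mem_oLie x ∧ IsNilpotent x} =>
    Q.OConj x.1 y.1)

/-- `p(k)`, the number of partitions of `k`. -/
def numPartitions (k : ℕ) : ℕ := Fintype.card (Nat.Partition k)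

/-- `p₂(n)`, the number of ordered pairs `(α, β)` of partitions with `|α| + |β| = n`. -/
def numPartitionPairs (n : ℕ) : ℕ :=
  ∑ k ∈ Finset.range (n + 1), numPartitions k * numPartitions (n - k)

/-- `(V, Q)` contains a totally singular subspace of dimension `d`
(so the Witt index of `Q` is at least `d`). -/
def QuadraticForm.HasTotallySingularSubspace {F V : Type*} [Field F] [AddCommGroup V]
    [Module F V] (Q : QuadraticForm F V) (d : ℕ) : Prop :=
  ∃ W : Submodule F V, Module.finrank F W = d ∧ ∀ w ∈ W, Q w = 0

/-- Two endomorphisms of `V` are conjugate under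
`SO(V) = {g ∈ O(V) | rank(g + 1) is even}`, the kernel of the Dickson invariant
(recall that the characteristic is 2, so `g + 1 = g - 1`). -/
def QuadraticForm.SOConj {F V : Type*} [Field F] [AddCommGroup V] [Module F V]
    (Q : QuadraticForm F V) (x y : Module.End F V) : Prop :=
  ∃ g : V ≃ₗ[F] V, (∀ v : V, Q (g v) = Q v) ∧
    Even (Module.finrank F (LinearMap.range (g.toLinearMap + LinearMap.id))) ∧
    y = g.toLinearMap ∘ₗ x ∘ₗ g.symm.toLinearMap

/-- The number of orbits of `SO(V)` acting by conjugation on the set of nilpotent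
elements of `𝔬(V)`. -/
noncomputable def QuadraticForm.numNilpotentSOOrbits {F V : Type*} [Field F] [AddCommGroup V]
    [Module F V] (Q : QuadraticForm F V) : ℕ :=
  Nat.card (Quot fun x y : {x : Module.End F V // Q.mem_oLie x ∧ IsNilpotent x} =>
    Q.SOConj x.1 y.1)

set_option linter.unusedSectionVars false
set_option linter.unusedVariables false

namespace NilOrb
section basics
variable {F V : Type*} [Field F] [AddCommGroup V] [Module F V]

/-- Orthogonal complement of a set. -/
def perp (b : V →ₗ[F] V →ₗ[F] F) (S : Set V) : Submodule F V where
  carrier := {z | ∀ y ∈ S, b z y = 0}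
  add_mem' := by
    intro a c ha hc y hy
    simp [ha y hy, hc y hy]
  zero_mem' := by intro y _; simp
  smul_mem' := by
    intro c a ha y hy
    simp [ha y hy]

theorem mem_perp {b : V →ₗ[F] V →ₗ[F] F} {S : Set V} {z : V} :
    z ∈ perp b S ↔ ∀ y ∈ S, b z y = 0 := Iff.rfl

/-- Alternating and nondegenerate form. -/
structure Symp (b : V →ₗ[F] V →ₗ[F] F) : Prop where
  alt : ∀ v, b v v = 0
  nd : ∀ v, (∀ w, b v w = 0) → v = 0

/-- Nilpotent `x` with `b (x v) v = 0`. -/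
structure IsNil (b : V →ₗ[F] V →ₗ[F] F) (x : End F V) : Prop where
  alt : ∀ v, b (x v) v = 0
  nil : IsNilpotent x

theorem Symp.neg {b : V →ₗ[F] V →ₗ[F] F} (hb : Symp b) (v w : V) : b v w = - b w v := by
  have h := hb.alt (v + w)
  simp only [map_add, LinearMap.add_apply, hb.alt, zero_add, add_zero] at h
  exact eq_neg_of_add_eq_zero_right h

theorem Symp.symm [CharP F 2] {b : V →ₗ[F] V →ₗ[F] F} (hb : Symp b) (v w : V) :
    b v w = b w v := by
  rw [hb.neg v w, CharTwo.neg_eq]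

theorem IsNil.swap {b : V →ₗ[F] V →ₗ[F] F} {x : End F V} (hb : Symp b) (hx : IsNil b x)
    (v w : V) : b (x v) w = b v (x w) := by
  have h := hx.alt (v + w)
  simp only [map_add, LinearMap.add_apply, hx.alt, zero_add, add_zero] at h
  rw [hb.neg v (x w)]
  exact eq_neg_of_add_eq_zero_right h

theorem IsNil.swap_pow {b : V →ₗ[F] V →ₗ[F] F} {x : End F V} (hb : Symp b) (hx : IsNil b x)
    (s : ℕ) (v w : V) : b ((x ^ s) v) w = b v ((x ^ s) w) := by
  induction s generalizing v w with
  | zero => simp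
  | succ s ih =>
    rw [pow_succ, Module.End.mul_apply, ih, hx.swap hb]
    rw [← Module.End.mul_apply, ← pow_succ']; rw [← pow_succ]

theorem IsNil.alt_pow {b : V →ₗ[F] V →ₗ[F] F} {x : End F V} (hb : Symp b) (hx : IsNil b x)
    (s : ℕ) (v : V) : b ((x ^ s) v) v = 0 := by
  rcases Nat.even_or_odd' s with ⟨k, rfl | rfl⟩
  · rw [two_mul, pow_add, Module.End.mul_apply, hx.swap_pow hb, hb.alt]
  · have : x ^ (2 * k + 1) = x ^ k * x * x ^ k := by
      rw [← pow_succ, ← pow_add]; congr 1; ring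
    rw [this, Module.End.mul_apply, Module.End.mul_apply, hx.swap_pow hb, hx.alt]

theorem pow_app (x : End F V) (s t : ℕ) (v : V) : (x ^ s) ((x ^ t) v) = (x ^ (s + t)) v := by
  rw [pow_add, Module.End.mul_apply]

theorem pow_zero_of_le {x : End F V} {m s : ℕ} {v : V} (h : (x ^ m) v = 0) (hs : m ≤ s) :
    (x ^ s) v = 0 := by
  obtain ⟨k, rfl⟩ := Nat.exists_eq_add_of_le hs
  rw [add_comm, ← pow_app, h, map_zero]

end basics

section sys
variable {F V : Type*} [Field F] [AddCommGroup V] [Module F V]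

/-- A hyperbolic system of Jordan blocks. -/
structure Sys (b : V →ₗ[F] V →ₗ[F] F) (x : End F V) {ι : Type*} (l : ι → ℕ) (e f : ι → V) :
    Prop where
  he : ∀ i, (x ^ l i) (e i) = 0
  hf : ∀ i, (x ^ l i) (f i) = 0
  ee : ∀ i j s, b ((x ^ s) (e i)) (e j) = 0
  ff : ∀ i j s, b ((x ^ s) (f i)) (f j) = 0
  ef0 : ∀ i j s, i ≠ j → b ((x ^ s) (e i)) (f j) = 0
  ef1 : ∀ i s, s + 1 ≠ l i → b ((x ^ s) (e i)) (f i) = 0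
  ef : ∀ i s, s + 1 = l i → b ((x ^ s) (e i)) (f i) = 1

/-- generating set of a system -/
def gens (x : End F V) {ι : Type*} (e f : ι → V) : Set V :=
  {y | ∃ i s, y = (x ^ s) (e i) ∨ y = (x ^ s) (f i)}

theorem mem_perp_gens {b : V →ₗ[F] V →ₗ[F] F} {x : End F V} {ι : Type*} {e f : ι → V} {z : V} :
    z ∈ perp b (gens x e f) ↔
      ∀ i s, b z ((x ^ s) (e i)) = 0 ∧ b z ((x ^ s) (f i)) = 0 := by
  constructor
  · intro h i s
    exact ⟨h _ ⟨i, s, Or.inl rfl⟩, h _ ⟨i, s, Or.inr rfl⟩⟩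
  · rintro h y ⟨i, s, rfl | rfl⟩
    · exact (h i s).1
    · exact (h i s).2

theorem perp_gens_stable {b : V →ₗ[F] V →ₗ[F] F} {x : End F V} {ι : Type*} {e f : ι → V} {z : V}
    (hb : Symp b) (hx : IsNil b x) (hz : z ∈ perp b (gens x e f)) (t : ℕ) :
    (x ^ t) z ∈ perp b (gens x e f) := by
  rw [mem_perp_gens] at hz ⊢
  intro i s
  rw [hx.swap_pow hb, hx.swap_pow hb, pow_app, pow_app]
  exact hz i _

/-- projection on a system -/
def pr (b : V →ₗ[F] V →ₗ[F] F) (x : End F V) {ι : Type*} [Fintype ι] (l : ι → ℕ) (e f : ι → V)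
    (w : V) : V :=
  ∑ i, ∑ s ∈ range (l i), (b w ((x ^ (l i - 1 - s)) (f i)) • (x ^ s) (e i) +
    b w ((x ^ (l i - 1 - s)) (e i)) • (x ^ s) (f i))

variable [CharP F 2] {b : V →ₗ[F] V →ₗ[F] F} {x : End F V} {ι : Type*} [Fintype ι]
  {l : ι → ℕ} {e f : ι → V}

theorem Sys.fe0 {ι : Type*} {l : ι → ℕ} {e f : ι → V} (h : Sys b x l e f)
    (hb : Symp b) (hx : IsNil b x) (i j : ι) (s : ℕ) (hij : i ≠ j) :
    b ((x ^ s) (f i)) (e j) = 0 := by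
  rw [hx.swap_pow hb, hb.symm]; exact h.ef0 j i s hij.symm

theorem Sys.flip {ι : Type*} {l : ι → ℕ} {e f : ι → V} (h : Sys b x l e f)
    (hb : Symp b) (hx : IsNil b x) : Sys b x l f e where
  he := h.hf
  hf := h.he
  ee := h.ff
  ff := h.ee
  ef0 := fun i j s hij => h.fe0 hb hx i j s hij
  ef1 := fun i s hs => by rw [hx.swap_pow hb, hb.symm]; exact h.ef1 i s hs
  ef := fun i s hs => by rw [hx.swap_pow hb, hb.symm]; exact h.ef i s hs

theorem pr_flip (w : V) : pr b x l e f w = pr b x l f e w := by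
  unfold pr
  refine Finset.sum_congr rfl fun i _ => Finset.sum_congr rfl fun s _ => add_comm _ _

theorem Sys.pr_e (h : Sys b x l e f) (hb : Symp b) (hx : IsNil b x) (w : V) (j : ι) (t : ℕ) :
    b (pr b x l e f w) ((x ^ t) (e j)) = b w ((x ^ t) (e j)) := by
  classical
  unfold pr
  simp only [map_sum, LinearMap.sum_apply, map_add, map_smul, LinearMap.add_apply,
    LinearMap.smul_apply, smul_eq_mul]
  rw [Finset.sum_eq_single j]
  · by_cases ht : t < l j
    · rw [Finset.sum_eq_single (l j - 1 - t)]
      · rw [← hx.swap_pow hb _ ((x ^ (l j - 1 - t)) (e j)),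
          ← hx.swap_pow hb _ ((x ^ (l j - 1 - t)) (f j)), pow_app, pow_app, h.ee,
          (h.flip hb hx).ef j _ (by omega)]
        have : l j - 1 - (l j - 1 - t) = t := by omega
        rw [this]; simp
      · intro s hs hne
        rw [← hx.swap_pow hb _ ((x ^ s) (e j)), ← hx.swap_pow hb _ ((x ^ s) (f j)), pow_app,
          pow_app, h.ee, (h.flip hb hx).ef1 j _ (by have := Finset.mem_range.1 hs; omega)]
        simp
      · intro hs; exact absurd (Finset.mem_range.2 (by omega)) hs
    · rw [pow_zero_of_le (h.he j) (not_lt.1 ht)]; simp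
  · intro i _ hij
    refine Finset.sum_eq_zero fun s _ => ?_
    rw [← hx.swap_pow hb _ ((x ^ s) (e i)), ← hx.swap_pow hb _ ((x ^ s) (f i)), pow_app,
          pow_app, h.ee, (h.flip hb hx).ef0 i j _ hij]
    simp
  · intro hj; exact absurd (Finset.mem_univ _) hj

theorem Sys.pr_f (h : Sys b x l e f) (hb : Symp b) (hx : IsNil b x) (w : V) (j : ι) (t : ℕ) :
    b (pr b x l e f w) ((x ^ t) (f j)) = b w ((x ^ t) (f j)) := by
  rw [pr_flip]; exact (h.flip hb hx).pr_e hb hx w j t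

theorem Sys.res_mem (h : Sys b x l e f) (hb : Symp b) (hx : IsNil b x) (w : V) :
    w - pr b x l e f w ∈ perp b (gens x e f) := by
  rw [mem_perp_gens]
  intro i s
  simp [h.pr_e hb hx, h.pr_f hb hx]

theorem pr_orth {y : V} (hy : y ∈ perp b (gens x e f)) (hb : Symp b) (w : V) :
    b y (pr b x l e f w) = 0 := by
  rw [mem_perp_gens] at hy
  unfold pr
  simp only [map_sum, map_add, map_smul, (hy _ _).1, (hy _ _).2]
  simp

/-- nondegeneracy of the complement -/
theorem Sys.perp_nd (h : Sys b x l e f) (hb : Symp b) (hx : IsNil b x) {y : V}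
    (hy : y ∈ perp b (gens x e f)) (h0 : ∀ w ∈ perp b (gens x e f), b y w = 0) : y = 0 := by
  refine hb.nd y fun w => ?_
  have := h0 _ (h.res_mem hb hx w)
  rwa [map_sub, pr_orth hy hb, sub_zero] at this

/-- completeness -/
def Complete (b : V →ₗ[F] V →ₗ[F] F) (x : End F V) {ι : Type*} (e f : ι → V) : Prop :=
  ∀ z ∈ perp b (gens x e f), z = 0

theorem Sys.expand (h : Sys b x l e f) (hb : Symp b) (hx : IsNil b x) (hc : Complete b x e f)
    (w : V) : w = pr b x l e f w :=
  sub_eq_zero.1 (hc _ (h.res_mem hb hx w))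

/-- The basis family. -/
def fam (x : End F V) (l : ι → ℕ) (e f : ι → V) :
    ((Σ i, Fin (l i)) ⊕ (Σ i, Fin (l i))) → V
  | Sum.inl p => (x ^ (p.2 : ℕ)) (e p.1)
  | Sum.inr p => (x ^ (p.2 : ℕ)) (f p.1)

theorem Sys.fam_li (h : Sys b x l e f) (hb : Symp b) (hx : IsNil b x) :
    LinearIndependent F (fam x l e f) := by
  refine LinearIndependent.of_pairwise_dual_eq_zero_one _
    (fun k => match k with
      | Sum.inl p => b ((x ^ (l p.1 - 1 - (p.2 : ℕ))) (f p.1))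
      | Sum.inr p => b ((x ^ (l p.1 - 1 - (p.2 : ℕ))) (e p.1))) ?_ ?_
  · have key : ∀ {e f : ι → V}, Sys b x l e f → ∀ p q : (Σ i, Fin (l i)), p ≠ q →
        b ((x ^ (l p.1 - 1 - (p.2 : ℕ))) (f p.1)) ((x ^ (q.2 : ℕ)) (e q.1)) = 0 := by
      rintro e f h ⟨i, s⟩ ⟨j, t⟩ hne
      rw [← hx.swap_pow hb, pow_app]
      by_cases hij : i = j
      · subst hij
        refine (h.flip hb hx).ef1 i _ ?_
        intro hh
        apply hne
        have := s.2
        have := t.2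
        congr 1
        ext
        simp only at hh
        omega
      · exact (h.flip hb hx).ef0 i j _ hij
    rintro (p | p) (q | q) hne
    · exact key h p q (fun h => hne (by rw [h]))
    · simp only [fam]
      rw [← hx.swap_pow hb, pow_app, h.ff]
    · simp only [fam]
      rw [← hx.swap_pow hb, pow_app, h.ee]
    · exact key (h.flip hb hx) p q (fun h => hne (by rw [h]))
  · rintro (⟨i, s⟩ | ⟨i, s⟩)
    · simp only [fam]
      rw [← hx.swap_pow hb, pow_app]
      exact (h.flip hb hx).ef i _ (by have := s.2; omega)
    · simp only [fam]
      rw [← hx.swap_pow hb, pow_app]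
      exact h.ef i _ (by have := s.2; omega)

theorem Sys.fam_span (h : Sys b x l e f) (hb : Symp b) (hx : IsNil b x) (hc : Complete b x e f) :
    ⊤ ≤ Submodule.span F (Set.range (fam x l e f)) := by
  intro w _
  rw [h.expand hb hx hc w]
  unfold pr
  refine Submodule.sum_mem _ fun i _ => Submodule.sum_mem _ fun s hs => ?_
  rw [Finset.mem_range] at hs
  refine Submodule.add_mem _ (Submodule.smul_mem _ _ (Submodule.subset_span ?_))
    (Submodule.smul_mem _ _ (Submodule.subset_span ?_))
  · exact ⟨Sum.inl ⟨i, ⟨s, hs⟩⟩, rfl⟩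
  · exact ⟨Sum.inr ⟨i, ⟨s, hs⟩⟩, rfl⟩

theorem card_fam : Fintype.card ((Σ i, Fin (l i)) ⊕ (Σ i, Fin (l i))) = 2 * ∑ i, l i := by
  simp [Fintype.card_sum, Fintype.card_sigma, two_mul]

theorem Sys.card_le [FiniteDimensional F V] (h : Sys b x l e f) (hb : Symp b) (hx : IsNil b x) :
    2 * ∑ i, l i ≤ finrank F V := by
  rw [← card_fam]; exact (h.fam_li hb hx).fintype_card_le_finrank

theorem Sys.card_eq (h : Sys b x l e f) (hb : Symp b) (hx : IsNil b x)
    (hc : Complete b x e f) :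
    finrank F V = 2 * ∑ i, l i := by
  rw [← card_fam]
  exact finrank_eq_card_basis (Basis.mk (h.fam_li hb hx) (h.fam_span hb hx hc))

theorem Sys.complete_of_card [FiniteDimensional F V] (h : Sys b x l e f) (hb : Symp b)
    (hx : IsNil b x) (hc : finrank F V = 2 * ∑ i, l i) : Complete b x e f := by
  have hs := (h.fam_li hb hx).span_eq_top_of_card_eq_finrank' (by rw [card_fam, hc])
  intro z hz
  refine hb.nd z fun w => ?_
  have hw : w ∈ Submodule.span F (Set.range (fam x l e f)) := by rw [hs]; trivial
  rw [mem_perp_gens] at hz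
  refine Submodule.span_induction (p := fun w _ => b z w = 0) ?_ ?_ ?_ ?_ hw
  · rintro _ ⟨(⟨i, s⟩ | ⟨i, s⟩), rfl⟩
    · exact (hz i s).1
    · exact (hz i s).2
  · simp
  · intro a c _ _ ha hc; simp [ha, hc]
  · intro a c _ hc; simp [hc]

end sys
end NilOrb

namespace NilOrb
section ext
variable {F V : Type*} [Field F] [AddCommGroup V] [Module F V]
variable [CharP F 2] {b : V →ₗ[F] V →ₗ[F] F} {x : End F V}

theorem dualvec (hb : Symp b) (hx : IsNil b x) (U : Submodule F V)
    (hnd : ∀ y ∈ U, (∀ w ∈ U, b y w = 0) → y = 0)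
    (hst : ∀ y ∈ U, ∀ t : ℕ, (x ^ t) y ∈ U) {u : V} (hu : u ∈ U) {m : ℕ}
    (hm : 1 ≤ m) (h0 : (x ^ m) u = 0) (h1 : (x ^ (m - 1)) u ≠ 0) :
    ∃ w ∈ U, ∀ s, b ((x ^ s) u) w = if s + 1 = m then 1 else 0 := by
  have key : ∀ k, ∃ w ∈ U, b ((x ^ (m - 1)) u) w = 1 ∧
      ∀ s, m ≤ s + 1 + k → s + 1 ≠ m → b ((x ^ s) u) w = 0 := by
    intro k
    induction k with
    | zero =>
      have : ∃ w ∈ U, b ((x ^ (m - 1)) u) w ≠ 0 := by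
        by_contra hcon
        push Not at hcon
        exact h1 (hnd _ (hst u hu _) hcon)
      obtain ⟨w, hw, hw1⟩ := this
      refine ⟨(b ((x ^ (m - 1)) u) w)⁻¹ • w, U.smul_mem _ hw, ?_, ?_⟩
      · simp [hw1]
      · intro s hs hs'
        rw [pow_zero_of_le h0 (by omega)]; simp
    | succ k ih =>
      obtain ⟨w, hw, hw1, hw2⟩ := ih
      by_cases hk : m ≤ k + 1
      · exact ⟨w, hw, hw1, fun s hs hs' => hw2 s (by omega) hs'⟩
      · refine ⟨w - b ((x ^ (m - 2 - k)) u) w • (x ^ (k + 1)) w,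
          U.sub_mem hw (U.smul_mem _ (hst w hw _)), ?_, ?_⟩
        · rw [map_sub, map_smul, ← hx.swap_pow hb (k + 1) _ w, pow_app,
            pow_zero_of_le (s := k + 1 + (m - 1)) h0 (by omega), hw1]
          simp
        · intro s hs hs'
          rw [map_sub, map_smul, ← hx.swap_pow hb _ _ w, pow_app]
          by_cases h : s = m - 2 - k
          · subst h
            have : k + 1 + (m - 2 - k) = m - 1 := by omega
            rw [this, hw1]; simp
          · rw [hw2 s (by omega) hs', pow_zero_of_le (s := k + 1 + s) h0 (by omega)]; simp
  obtain ⟨w, hw, hw1, hw2⟩ := key m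
  refine ⟨w, hw, fun s => ?_⟩
  split_ifs with hs
  · have : s = m - 1 := by omega
    rw [this, hw1]
  · exact hw2 s (by omega) hs

theorem perp_mono_perp {S : Set V} {z y : V} (hb : Symp b) (hz : z ∈ perp b S)
    (hy : y ∈ perp b (perp b S : Set V)) : b z y = 0 := by
  rw [hb.symm]; exact hy z hz

/-- the double perp of the generators of one block is contained in any perp containing them -/
theorem block_exists {ι : Type*} [Fintype ι] {l : ι → ℕ} {e f : ι → V} (h : Sys b x l e f)
    (hb : Symp b) (hx : IsNil b x)
    (hne : ∃ z ∈ perp b (gens x e f), z ≠ 0) (v : V) (hv : v ∈ perp b (gens x e f)) :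
    ∃ (m a : ℕ) (u w : V), 1 ≤ m ∧ a ≤ m ∧ u ∈ perp b (gens x e f) ∧ w ∈ perp b (gens x e f) ∧
      (x ^ m) u = 0 ∧ (x ^ m) w = 0 ∧ (∀ s, b ((x ^ s) u) w = if s + 1 = m then 1 else 0) ∧
      (∀ s, b (v - (x ^ a) u) ((x ^ s) u) = 0 ∧ b (v - (x ^ a) u) ((x ^ s) w) = 0) := by
  classical
  set U := perp b (gens x e f) with hU
  have hnd : ∀ y ∈ U, (∀ w ∈ U, b y w = 0) → y = 0 := fun y hy h0 => h.perp_nd hb hx hy h0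
  have hst : ∀ y ∈ U, ∀ t : ℕ, (x ^ t) y ∈ U := fun y hy t => perp_gens_stable hb hx hy t
  have hex : ∃ m : ℕ, ∀ u ∈ U, (x ^ m) u = 0 := by
    obtain ⟨m, hm⟩ := hx.nil
    exact ⟨m, fun u _ => by rw [hm]; rfl⟩
  set m := Nat.find hex with hmdef
  have hm0 : ∀ u ∈ U, (x ^ m) u = 0 := Nat.find_spec hex
  have hm1 : 1 ≤ m := by
    by_contra hcon
    obtain ⟨z, hz, hz0⟩ := hne
    have : m = 0 := by omega
    have h2 := hm0 z hz
    rw [this] at h2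
    exact hz0 (by simpa using h2)
  obtain ⟨u0, hu0, hu1⟩ : ∃ u ∈ U, (x ^ (m - 1)) u ≠ 0 := by
    have := Nat.find_min hex (m := m - 1) (by omega)
    push Not at this
    exact this
  obtain ⟨w0, hw0, hd⟩ := dualvec hb hx U hnd hst hu0 hm1 (hm0 _ hu0) hu1
  -- one block system
  have hS : Sys b x (fun _ : Unit => m) (fun _ => u0) (fun _ => w0) := by
    refine ⟨fun _ => hm0 _ hu0, fun _ => hm0 _ hw0, fun _ _ s => hx.alt_pow hb s _,
      fun _ _ s => hx.alt_pow hb s _, fun i j s hij => absurd (Subsingleton.elim i j) hij, ?_, ?_⟩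
    · intro _ s hs; rw [hd, if_neg hs]
    · intro _ s hs; rw [hd, if_pos hs]
  set c : ℕ → F := fun s => b v ((x ^ (m - 1 - s)) w0) with hc
  set d : ℕ → F := fun s => b v ((x ^ (m - 1 - s)) u0) with hdd
  set P := pr b x (fun _ : Unit => m) (fun _ => u0) (fun _ => w0) with hP
  have hPv : ∀ z, P z = ∑ s ∈ range m, (b z ((x ^ (m - 1 - s)) w0) • (x ^ s) u0 +
      b z ((x ^ (m - 1 - s)) u0) • (x ^ s) w0) := by
    intro z
    simp [hP, pr]
  have hres : ∀ z s, b (z - P z) ((x ^ s) u0) = 0 ∧ b (z - P z) ((x ^ s) w0) = 0 := by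
    intro z s
    exact (mem_perp_gens.1 (hS.res_mem hb hx z)) () s
  by_cases hall : ∀ s < m, c s = 0 ∧ d s = 0
  · refine ⟨m, m, u0, w0, hm1, le_rfl, hu0, hw0, hm0 _ hu0, hm0 _ hw0, hd, ?_⟩
    have hP0 : P v = 0 := by
      rw [hPv]
      refine Finset.sum_eq_zero fun s hs => ?_
      have := hall s (Finset.mem_range.1 hs)
      simp only [hc, hdd] at this
      rw [this.1, this.2]; simp
    intro s
    have := hres v s
    rw [hP0] at this
    rw [hm0 _ hu0]
    exact this
  · push Not at hall
    have hex2 : ∃ s, s < m ∧ ¬ (c s = 0 ∧ d s = 0) := by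
      obtain ⟨s, hs, hs2⟩ := hall
      exact ⟨s, hs, fun hh => hs2 hh.1 hh.2⟩
    set a := Nat.find hex2 with hadef
    obtain ⟨ham, hac⟩ := Nat.find_spec hex2
    have hlt : ∀ s < a, c s = 0 ∧ d s = 0 := by
      intro s hs
      have := Nat.find_min hex2 hs
      by_contra hcon
      exact this ⟨by omega, hcon⟩
    set y := ∑ s ∈ range m, if a ≤ s then (c s • (x ^ (s - a)) u0 + d s • (x ^ (s - a)) w0)
      else 0 with hy
    have hxy : (x ^ a) y = P v := by
      rw [hy, hPv, map_sum]
      refine Finset.sum_congr rfl fun s hs => ?_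
      split_ifs with has
      · rw [map_add, map_smul, map_smul, pow_app, pow_app]
        have : a + (s - a) = s := by omega
        rw [this]
      · have := hlt s (by omega)
        simp only [hc, hdd] at this
        rw [this.1, this.2]; simp
    -- H
    set H := perp b (perp b (gens x (fun _ : Unit => u0) (fun _ => w0)) : Set V) with hH
    have hu0H : ∀ s, (x ^ s) u0 ∈ H := by
      intro s z hz
      rw [hb.symm]
      exact (mem_perp_gens.1 hz () s).1
    have hw0H : ∀ s, (x ^ s) w0 ∈ H := by
      intro s z hz
      rw [hb.symm]
      exact (mem_perp_gens.1 hz () s).2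
    have hyH : ∀ t, (x ^ t) y ∈ H := by
      intro t
      rw [hy, map_sum]
      refine H.sum_mem fun s _ => ?_
      split_ifs
      · rw [map_add, map_smul, map_smul, pow_app, pow_app]
        exact H.add_mem (H.smul_mem _ (hu0H _)) (H.smul_mem _ (hw0H _))
      · simp
    have hyU : y ∈ U := by
      rw [hy]
      refine U.sum_mem fun s _ => ?_
      split_ifs
      · exact U.add_mem (U.smul_mem _ (hst _ hu0 _)) (U.smul_mem _ (hst _ hw0 _))
      · exact U.zero_mem
    have hPH : ∀ z t, (x ^ t) (P z) ∈ H := by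
      intro z t
      rw [hPv, map_sum]
      refine H.sum_mem fun s _ => ?_
      rw [map_add, map_smul, map_smul, pow_app, pow_app]
      exact H.add_mem (H.smul_mem _ (hu0H _)) (H.smul_mem _ (hw0H _))
    have hPU : ∀ z, P z ∈ U := by
      intro z
      rw [hPv]
      refine U.sum_mem fun s _ => ?_
      exact U.add_mem (U.smul_mem _ (hst _ hu0 _)) (U.smul_mem _ (hst _ hw0 _))
    have horth : ∀ z y, y ∈ H → b (z - P z) y = 0 := by
      intro z y hy
      exact perp_mono_perp hb (hS.res_mem hb hx z) hy
    have hyne : (x ^ (m - 1)) y ≠ 0 := by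
      intro h0
      have hcomp : (x ^ (m - 1)) y = c a • (x ^ (m - 1)) u0 + d a • (x ^ (m - 1)) w0 := by
        rw [hy, map_sum, Finset.sum_eq_single a]
        · simp
        · intro s hs hsa
          split_ifs with has
          · rw [map_add, map_smul, map_smul, pow_app, pow_app,
              pow_zero_of_le (hm0 _ hu0) (by omega), pow_zero_of_le (hm0 _ hw0) (by omega)]
            simp
          · simp
        · intro hh; exact absurd (Finset.mem_range.2 ham) hh
      rw [h0] at hcomp
      have hac' : ¬ (c a = 0 ∧ d a = 0) := hac
      apply hac'
      constructor
      · have := congrArg (fun z => b z w0) hcomp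
        simp only [map_zero, LinearMap.zero_apply, map_add, map_smul, LinearMap.add_apply,
          LinearMap.smul_apply, hd, hx.alt_pow hb] at this
        rw [if_pos (by omega)] at this
        simpa using this.symm
      · have := congrArg (fun z => b z u0) hcomp
        simp only [map_zero, LinearMap.zero_apply, map_add, map_smul, LinearMap.add_apply,
          LinearMap.smul_apply, hx.alt_pow hb] at this
        rw [hx.swap_pow hb, hb.symm, hd, if_pos (by omega)] at this
        simpa using this.symm
    obtain ⟨w, hw, hwd⟩ := dualvec hb hx U hnd hst hyU hm1 (hm0 _ hyU) hyne
    refine ⟨m, a, y, P w, hm1, by omega, hyU, hPU w, hm0 _ hyU, hm0 _ (hPU w), ?_, ?_⟩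
    · intro s
      rw [← hwd s]
      have := horth w _ (hyH s)
      rw [hb.symm, map_sub, sub_eq_zero] at this
      exact this.symm
    · intro s
      rw [hxy]
      exact ⟨horth _ _ (hyH s), horth _ _ (hPH w s)⟩

/-- raw normal form -/
structure Raw (b : V →ₗ[F] V →ₗ[F] F) (x : End F V) (v : V) {ι : Type*} [Fintype ι]
    (l a : ι → ℕ) (e f : ι → V) : Prop where
  sys : Sys b x l e f
  le : ∀ i, a i ≤ l i
  mem : v - ∑ i, (x ^ a i) (e i) ∈ perp b (gens x e f)

theorem Raw.extend {N : ℕ} {l a : Fin N → ℕ} {e f : Fin N → V} {v : V}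
    (hb : Symp b) (hx : IsNil b x) (h : Raw b x v l a e f) (k : Fin N) (hk : l k = 0)
    (hne : ∃ z ∈ perp b (gens x e f), z ≠ 0) :
    ∃ (l' a' : Fin N → ℕ) (e' f' : Fin N → V), Raw b x v l' a' e' f' ∧
      ∑ i, l i < ∑ i, l' i := by
  obtain ⟨m, c, u, w, hm, hcm, hu, hw, hxu, hxw, hd, horth⟩ :=
    block_exists h.sys hb hx hne _ h.mem
  have hek : e k = 0 := by have := h.sys.he k; rw [hk] at this; simpa using this
  have hfk : f k = 0 := by have := h.sys.hf k; rw [hk] at this; simpa using this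
  have hu' := mem_perp_gens.1 hu
  have hw' := mem_perp_gens.1 hw
  have sw : ∀ y z s, b ((x ^ s) y) z = b z ((x ^ s) y) := fun y z s => hb.symm _ _
  refine ⟨Function.update l k m, Function.update a k c, Function.update e k u,
    Function.update f k w, ⟨⟨?_, ?_, ?_, ?_, ?_, ?_, ?_⟩, ?_, ?_⟩, ?_⟩
  · intro i
    by_cases hi : i = k
    · subst hi; simpa using hxu
    · simpa [hi] using h.sys.he i
  · intro i
    by_cases hi : i = k
    · subst hi; simpa using hxw
    · simpa [hi] using h.sys.hf i
  · intro i j s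
    by_cases hi : i = k <;> by_cases hj : j = k
    · simp [hi, hj, hx.alt_pow hb]
    · subst hi; simp only [Function.update_self, ne_eq, hj, not_false_eq_true,
        Function.update_of_ne]
      rw [hx.swap_pow hb]; exact (hu' j s).1
    · subst hj; simp only [Function.update_self, ne_eq, hi, not_false_eq_true,
        Function.update_of_ne]
      rw [sw]; exact (hu' i s).1
    · simpa [hi, hj] using h.sys.ee i j s
  · intro i j s
    by_cases hi : i = k <;> by_cases hj : j = k
    · simp [hi, hj, hx.alt_pow hb]
    · subst hi; simp only [Function.update_self, ne_eq, hj, not_false_eq_true,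
        Function.update_of_ne]
      rw [hx.swap_pow hb]; exact (hw' j s).2
    · subst hj; simp only [Function.update_self, ne_eq, hi, not_false_eq_true,
        Function.update_of_ne]
      rw [sw]; exact (hw' i s).2
    · simpa [hi, hj] using h.sys.ff i j s
  · intro i j s hij
    by_cases hi : i = k <;> by_cases hj : j = k
    · exact absurd (hi.trans hj.symm) hij
    · subst hi; simp only [Function.update_self, ne_eq, hj, not_false_eq_true,
        Function.update_of_ne]
      rw [hx.swap_pow hb]; exact (hu' j s).2
    · subst hj; simp only [Function.update_self, ne_eq, hi, not_false_eq_true,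
        Function.update_of_ne]
      rw [sw]; exact (hw' i s).1
    · simpa [hi, hj] using h.sys.ef0 i j s hij
  · intro i s
    by_cases hi : i = k
    · subst hi; intro hs
      simp only [Function.update_self] at hs ⊢
      rw [hd, if_neg hs]
    · simpa [hi] using h.sys.ef1 i s
  · intro i s
    by_cases hi : i = k
    · subst hi; intro hs
      simp only [Function.update_self] at hs ⊢
      rw [hd, if_pos hs]
    · simpa [hi] using h.sys.ef i s
  · intro i
    by_cases hi : i = k
    · subst hi; simpa using hcm
    · simpa [hi] using h.le i
  · have hsum : ∑ i, (x ^ (Function.update a k c) i) ((Function.update e k u) i) =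
        ∑ i, (x ^ a i) (e i) + (x ^ c) u := by
      rw [← Finset.add_sum_erase _ _ (Finset.mem_univ k),
        ← Finset.add_sum_erase _ (fun i => (x ^ a i) (e i)) (Finset.mem_univ k)]
      simp only [Function.update_self, hek, map_zero, zero_add]
      rw [add_comm]
      congr 1
      refine Finset.sum_congr rfl fun i hi => ?_
      rw [Function.update_of_ne (Finset.ne_of_mem_erase hi),
        Function.update_of_ne (Finset.ne_of_mem_erase hi)]
    rw [hsum, ← sub_sub]
    rw [mem_perp_gens]
    intro i s
    by_cases hi : i = k
    · subst hi
      simp only [Function.update_self]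
      exact horth s
    · simp only [ne_eq, hi, not_false_eq_true, Function.update_of_ne]
      exact mem_perp_gens.1 ((perp b (gens x e f)).sub_mem h.mem
        (perp_gens_stable hb hx hu c)) i s
  · rw [← Finset.add_sum_erase _ _ (Finset.mem_univ k),
        ← Finset.add_sum_erase _ (fun i => Function.update l k m i) (Finset.mem_univ k)]
    simp only [Function.update_self, hk]
    have hh : ∑ i ∈ univ.erase k, Function.update l k m i = ∑ i ∈ univ.erase k, l i :=
      Finset.sum_congr rfl fun i hi => by
        rw [Function.update_of_ne (Finset.ne_of_mem_erase hi)]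
    rw [hh]
    omega

theorem raw_exists [FiniteDimensional F V] (hb : Symp b) (hx : IsNil b x) (N : ℕ)
    (hN : finrank F V ≤ 2 * N) (v : V) :
    ∃ (l a : Fin N → ℕ) (e f : Fin N → V), Raw b x v l a e f ∧ Complete b x e f := by
  classical
  have key : ∀ k, ∃ (l a : Fin N → ℕ) (e f : Fin N → V), Raw b x v l a e f ∧
      (Complete b x e f ∨ k ≤ ∑ i, l i) := by
    intro k
    induction k with
    | zero =>
      refine ⟨fun _ => 0, fun _ => 0, fun _ => 0, fun _ => 0, ⟨⟨?_, ?_, ?_, ?_, ?_, ?_, ?_⟩, ?_, ?_⟩,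
        Or.inr (Nat.zero_le _)⟩
      all_goals simp [mem_perp_gens]
    | succ k ih =>
      obtain ⟨l, a, e, f, h, hc | hk⟩ := ih
      · exact ⟨l, a, e, f, h, Or.inl hc⟩
      · by_cases hc : Complete b x e f
        · exact ⟨l, a, e, f, h, Or.inl hc⟩
        · have hc' : ∃ z ∈ perp b (gens x e f), z ≠ 0 := by
            unfold Complete at hc
            push Not at hc
            exact hc
          have hlt : 2 * ∑ i, l i < finrank F V := by
            refine lt_of_le_of_ne (h.sys.card_le hb hx) fun heq => ?_
            exact hc (h.sys.complete_of_card hb hx heq.symm)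
          have : ∃ i, l i = 0 := by
            by_contra hcon
            push Not at hcon
            have h1 : ∑ i : Fin N, 1 ≤ ∑ i, l i :=
              Finset.sum_le_sum fun i _ => Nat.one_le_iff_ne_zero.2 (hcon i)
            simp at h1
            omega
          obtain ⟨i, hi⟩ := this
          obtain ⟨l', a', e', f', h', hl⟩ := h.extend hb hx i hi hc'
          exact ⟨l', a', e', f', h', Or.inr (by omega)⟩
  obtain ⟨l, a, e, f, h, hc | hk⟩ := key (finrank F V + 1)
  · exact ⟨l, a, e, f, h, hc⟩
  · have := h.sys.card_le hb hx
    omega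

end ext
end NilOrb

namespace NilOrb
section canon
variable {F V : Type*} [Field F] [AddCommGroup V] [Module F V]
variable [CharP F 2] {b : V →ₗ[F] V →ₗ[F] F} {x : End F V}

theorem Sys.mk' {ι : Type*} [DecidableEq ι] {l : ι → ℕ} {e f : ι → V}
    (he : ∀ i, (x ^ l i) (e i) = 0) (hf : ∀ i, (x ^ l i) (f i) = 0)
    (ee : ∀ i j s, b ((x ^ s) (e i)) (e j) = 0) (ff : ∀ i j s, b ((x ^ s) (f i)) (f j) = 0)
    (ef : ∀ i j s, b ((x ^ s) (e i)) (f j) = if i = j ∧ s + 1 = l i then 1 else 0) :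
    Sys b x l e f where
  he := he
  hf := hf
  ee := ee
  ff := ff
  ef0 := fun i j s hij => by rw [ef, if_neg (fun h => hij h.1)]
  ef1 := fun i s hs => by rw [ef, if_neg (fun h => hs h.2)]
  ef := fun i s hs => by rw [ef, if_pos ⟨rfl, hs⟩]

theorem Sys.pair {ι : Type*} [DecidableEq ι] {l : ι → ℕ} {e f : ι → V} (h : Sys b x l e f)
    (hb : Symp b) (hx : IsNil b x) (i j : ι) (s t : ℕ) :
    b ((x ^ s) (e i)) ((x ^ t) (f j)) = if i = j ∧ s + t + 1 = l i then 1 else 0 := by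
  rw [← hx.swap_pow hb, pow_app, add_comm t s]
  split_ifs with hh
  · obtain ⟨rfl, hh⟩ := hh
    exact h.ef i _ hh
  · by_cases hij : i = j
    · subst hij; exact h.ef1 i _ (fun h => hh ⟨rfl, h⟩)
    · exact h.ef0 i j _ hij

theorem Sys.pair_ee {ι : Type*} {l : ι → ℕ} {e f : ι → V} (h : Sys b x l e f)
    (hb : Symp b) (hx : IsNil b x) (i j : ι) (s t : ℕ) :
    b ((x ^ s) (e i)) ((x ^ t) (e j)) = 0 := by
  rw [← hx.swap_pow hb, pow_app, h.ee]

theorem Sys.pair_ff {ι : Type*} {l : ι → ℕ} {e f : ι → V} (h : Sys b x l e f)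
    (hb : Symp b) (hx : IsNil b x) (i j : ι) (s t : ℕ) :
    b ((x ^ s) (f i)) ((x ^ t) (f j)) = 0 := by
  rw [← hx.swap_pow hb, pow_app, h.ff]

theorem Sys.pair_fe {ι : Type*} [DecidableEq ι] {l : ι → ℕ} {e f : ι → V} (h : Sys b x l e f)
    (hb : Symp b) (hx : IsNil b x) (i j : ι) (s t : ℕ) :
    b ((x ^ s) (f i)) ((x ^ t) (e j)) = if i = j ∧ s + t + 1 = l i then 1 else 0 :=
  (h.flip hb hx).pair hb hx i j s t

theorem Sys.reindex {ι κ : Type*} {l : ι → ℕ} {e f : ι → V} (h : Sys b x l e f) (σ : κ ≃ ι) :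
    Sys b x (l ∘ σ) (e ∘ σ) (f ∘ σ) where
  he := fun i => h.he (σ i)
  hf := fun i => h.hf (σ i)
  ee := fun i j s => h.ee _ _ s
  ff := fun i j s => h.ff _ _ s
  ef0 := fun i j s hij => h.ef0 _ _ s (fun hh => hij (σ.injective hh))
  ef1 := fun i s hs => h.ef1 _ s hs
  ef := fun i s hs => h.ef _ s hs

theorem Sys.move {ι : Type*} [DecidableEq ι] {l : ι → ℕ} {e f : ι → V} (h : Sys b x l e f)
    (hb : Symp b) (hx : IsNil b x) {i j : ι} (hij : i ≠ j) {r r' : ℕ}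
    (hr : r' + l j = r + l i) :
    Sys b x l (Function.update e i (e i + (x ^ r) (e j)))
      (Function.update f j (f j + (x ^ r') (f i))) := by
  refine Sys.mk' ?_ ?_ ?_ ?_ ?_
  · intro k
    by_cases hk : k = i
    · subst hk
      simp only [Function.update_self, map_add, h.he, pow_app, zero_add]
      exact pow_zero_of_le (h.he j) (by omega)
    · simpa [hk] using h.he k
  · intro k
    by_cases hk : k = j
    · subst hk
      simp only [Function.update_self, map_add, h.hf, pow_app, zero_add]
      exact pow_zero_of_le (h.hf i) (by omega)
    · simpa [hk] using h.hf k
  · intro k m s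
    by_cases hk : k = i <;> by_cases hm : m = i
    · subst hk; subst hm
      simp [h.pair_ee hb hx, pow_app, h.ee]
    · subst hk; simp [hm, pow_app, h.ee]
    · subst hm
      simp [hk, h.ee, h.pair_ee hb hx]
    · simp [hk, hm, h.ee]
  · intro k m s
    by_cases hk : k = j <;> by_cases hm : m = j
    · subst hk; subst hm
      simp [pow_app, h.ff]
      rw [← hx.swap_pow hb, pow_app, h.ff, ← hx.swap_pow hb, pow_app, h.ff, zero_add]
    · subst hk; simp [hm, pow_app, h.ff]
    · subst hm
      simp [hk, h.ff, h.pair_ff hb hx]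
    · simp [hk, hm, h.ff]
  · intro k m s
    have p0 : ∀ k m s, b ((x ^ s) (e k)) (f m) = if k = m ∧ s + 1 = l k then 1 else 0 := by
      intro k m s
      simpa using h.pair hb hx k m s 0
    by_cases hk : k = i <;> by_cases hm : m = j
    · subst hk; subst hm
      simp only [Function.update_self, map_add, LinearMap.add_apply, pow_app, p0, h.pair hb hx]
      simp only [hij, hij.symm, false_and, if_false, true_and, zero_add, add_zero]
      by_cases hh : s + r' + 1 = l k
      · rw [if_pos hh, if_pos (by omega), CharTwo.add_self_eq_zero]
      · rw [if_neg hh, if_neg (by omega), add_zero]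
    · subst hk
      simp only [Function.update_self, map_add, LinearMap.add_apply, pow_app, ne_eq, hm,
        not_false_eq_true, Function.update_of_ne, p0]
      rw [if_neg (c := j = m ∧ _) (fun hh => hm hh.1.symm), add_zero]
    · subst hm
      simp only [Function.update_self, map_add, ne_eq, hk,
        not_false_eq_true, Function.update_of_ne, p0, h.pair hb hx]
      simp
    · simp only [ne_eq, hk, hm, not_false_eq_true, Function.update_of_ne, p0]

/-- complete raw form with prescribed exponents -/
def RC (b : V →ₗ[F] V →ₗ[F] F) (x : End F V) (v : V) {ι : Type*} [Fintype ι]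
    (l a : ι → ℕ) (e f : ι → V) : Prop :=
  Sys b x l e f ∧ Complete b x e f ∧ (∀ i, a i ≤ l i) ∧ v = ∑ i, (x ^ a i) (e i)

theorem sum_update_two {ι : Type*} [Fintype ι] [DecidableEq ι] {M : Type*} [AddCommMonoid M]
    (g g' : ι → M) {i j : ι} (hij : i ≠ j) (h : ∀ k, k ≠ i → k ≠ j → g k = g' k)
    (h2 : g i + g j = g' i + g' j) : ∑ k, g k = ∑ k, g' k := by
  have e1 : ∀ g : ι → M, ∑ k, g k = (g i + g j) + ∑ k ∈ (univ.erase i).erase j, g k := by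
    intro g
    rw [← Finset.add_sum_erase _ _ (Finset.mem_univ i),
      ← Finset.add_sum_erase (univ.erase i) _ (Finset.mem_erase.2 ⟨hij.symm, mem_univ _⟩), add_assoc]
  rw [e1 g, e1 g', h2]
  congr 1
  refine Finset.sum_congr rfl fun k hk => ?_
  simp only [Finset.mem_erase] at hk
  exact h k hk.2.1 hk.1

theorem RC.move [FiniteDimensional F V] {ι : Type*} [Fintype ι] [DecidableEq ι] {l a : ι → ℕ}
    {e f : ι → V} {v : V}
    (h : RC b x v l a e f) (hb : Symp b) (hx : IsNil b x) {i j : ι} (hij : i ≠ j) {c : ℕ}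
    (hc : c = a i + (l j - l i)) (hlt : c < a j) :
    ∃ e' f', RC b x v l (Function.update a j c) e' f' := by
  obtain ⟨hs, hcp, hle, hv⟩ := h
  have h1 := hs.move hb hx hij (r := a j - a i) (r' := a j - a i + l i - l j) (by omega)
  have h2 := h1.move hb hx hij (r := c - a i) (r' := c - a i + l i - l j) (by omega)
  refine ⟨_, _, h2, h2.complete_of_card hb hx (hs.card_eq hb hx hcp), ?_, ?_⟩
  · intro k
    by_cases hk : k = j
    · subst hk; simp; have := hle k; omega
    · simpa [hk] using hle k
  · rw [hv]
    refine sum_update_two _ _ hij ?_ ?_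
    · intro k hki hkj
      simp [hki, hkj]
    · simp only [Function.update_self, ne_eq, hij, hij.symm, not_false_eq_true,
        Function.update_of_ne, map_add, pow_app]
      have e1 : a i + (a j - a i) = a j := by omega
      have e2 : a i + (c - a i) = c := by omega
      rw [e1, e2, add_assoc _ ((x ^ c) (e j))]
      have : (x ^ c) (e j) + (x ^ c) (e j) = 0 := by
        rw [← two_smul F, CharTwo.two_eq_zero, zero_smul]
      rw [this, add_zero]

/-- a complete system with type -/
def HasType (b : V →ₗ[F] V →ₗ[F] F) (x : End F V) (v : V) {n : ℕ} (α β : Fin n → ℕ) : Prop :=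
  Antitone α ∧ Antitone β ∧ ∃ e f, Sys b x (α + β) e f ∧ Complete b x e f ∧
    v = ∑ i, (x ^ α i) (e i)

theorem type_exists [FiniteDimensional F V] (hb : Symp b) (hx : IsNil b x) {n : ℕ}
    (hn : finrank F V = 2 * n) (v : V) : ∃ α β : Fin n → ℕ, HasType b x v α β := by
  classical
  obtain ⟨l0, a0, e0, f0, h0, hc0⟩ := raw_exists hb hx n hn.le v
  set σ := Tuple.sort (OrderDual.toDual ∘ l0) with hσ
  have hanti : Antitone (l0 ∘ σ) := by
    have := Tuple.monotone_sort (OrderDual.toDual ∘ l0)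
    intro i j hij
    exact this hij
  set l := l0 ∘ σ with hl
  have hsys := h0.sys.reindex σ
  have hRC : RC b x v l (a0 ∘ σ) (e0 ∘ σ) (f0 ∘ σ) := by
    refine ⟨hsys, ?_, fun i => h0.le _, ?_⟩
    · refine hsys.complete_of_card hb hx ?_
      rw [h0.sys.card_eq hb hx hc0]
      congr 1
      exact (Equiv.sum_comp σ l0).symm
    · have := hc0 _ h0.mem
      rw [sub_eq_zero] at this
      rw [this]
      exact (Equiv.sum_comp σ (fun i => (x ^ a0 i) (e0 i))).symm
  have hex : ∃ k, ∃ a : Fin n → ℕ, (∃ e f, RC b x v l a e f) ∧ ∑ i, a i = k :=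
    ⟨_, _, ⟨_, _, hRC⟩, rfl⟩
  obtain ⟨a, ⟨e, f, h⟩, hk⟩ := Nat.find_spec hex
  have hmin : ∀ i j, i ≠ j → a j ≤ a i + (l j - l i) := by
    intro i j hij
    by_contra hcon
    push Not at hcon
    obtain ⟨e', f', h'⟩ := h.move hb hx hij rfl hcon
    have hlt : ∑ k, Function.update a j (a i + (l j - l i)) k < ∑ k, a k := by
      refine Finset.sum_lt_sum (fun k _ => ?_) ⟨j, mem_univ _, by simpa using hcon⟩
      by_cases hk : k = j
      · subst hk; simpa using hcon.le
      · simp [hk]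
    rw [hk] at hlt
    exact Nat.find_min hex hlt ⟨_, ⟨_, _, h'⟩, rfl⟩
  obtain ⟨hs, hcp, hle, hv⟩ := h
  refine ⟨a, fun i => l i - a i, ?_, ?_, e, f, ?_, hcp, hv⟩
  · intro i j hij
    rcases eq_or_lt_of_le hij with rfl | hlt
    · exact le_rfl
    · have := hmin i j hlt.ne
      have := hanti hij
      omega
  · intro i j hij
    rcases eq_or_lt_of_le hij with rfl | hlt
    · exact le_rfl
    · have h1 := hmin j i hlt.ne'
      have h2 := hanti hij
      have h3 := hle i
      have h4 := hle j
      simp only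
      omega
  · have : (a + fun i => l i - a i) = l := by
      ext i; simp only [Pi.add_apply]; have := hle i; omega
    rw [this]; exact hs

end canon
end NilOrb

namespace NilOrb
section conj
variable {F V : Type*} [Field F] [AddCommGroup V] [Module F V]
variable [CharP F 2] {b : V →ₗ[F] V →ₗ[F] F} {x : End F V}

/-- symplectic isometry -/
def Spg (b : V →ₗ[F] V →ₗ[F] F) (g : V ≃ₗ[F] V) : Prop := ∀ v w, b (g v) (g w) = b v w

theorem Spg.inv {g : V ≃ₗ[F] V} (h : Spg b g) : Spg b g.symm := by
  intro v w
  rw [← h]; simp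

theorem Spg.trans {g g' : V ≃ₗ[F] V} (h : Spg b g) (h' : Spg b g') : Spg b (g.trans g') := by
  intro v w
  simp only [LinearEquiv.trans_apply]
  rw [h', h]

theorem comm_pow {x x' : End F V} {g : V ≃ₗ[F] V} (h : ∀ v, g (x v) = x' (g v)) (s : ℕ) (v : V) :
    g ((x ^ s) v) = (x' ^ s) (g v) := by
  induction s generalizing v with
  | zero => simp
  | succ s ih => rw [pow_succ, pow_succ, Module.End.mul_apply, Module.End.mul_apply, ih, h]

theorem Sys.conj {ι : Type*} [Fintype ι] {l : ι → ℕ} {e f e' f' : ι → V} {x' : End F V}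
    (hb : Symp b) (hx : IsNil b x) (hx' : IsNil b x') (h : Sys b x l e f) (hc : Complete b x e f)
    (h' : Sys b x' l e' f') (hc' : Complete b x' e' f') :
    ∃ g : V ≃ₗ[F] V, Spg b g ∧ (∀ v, g (x v) = x' (g v)) ∧ (∀ i, g (e i) = e' i) ∧
      (∀ i, g (f i) = f' i) := by
  classical
  set B1 := Basis.mk (h.fam_li hb hx) (h.fam_span hb hx hc) with hB1
  set B2 := Basis.mk (h'.fam_li hb hx') (h'.fam_span hb hx' hc') with hB2
  set g := B1.equiv B2 (Equiv.refl _) with hg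
  have hB : ∀ k, g (fam x l e f k) = fam x' l e' f' k := by
    intro k
    have : B1 k = fam x l e f k := by rw [hB1, Basis.mk_apply]
    rw [← this, hg, Basis.equiv_apply, hB2, Basis.mk_apply]; rfl
  have he : ∀ i s, g ((x ^ s) (e i)) = (x' ^ s) (e' i) := by
    intro i s
    by_cases hs : s < l i
    · exact hB (Sum.inl ⟨i, ⟨s, hs⟩⟩)
    · rw [pow_zero_of_le (h.he i) (by omega), pow_zero_of_le (h'.he i) (by omega), map_zero]
  have hf : ∀ i s, g ((x ^ s) (f i)) = (x' ^ s) (f' i) := by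
    intro i s
    by_cases hs : s < l i
    · exact hB (Sum.inr ⟨i, ⟨s, hs⟩⟩)
    · rw [pow_zero_of_le (h.hf i) (by omega), pow_zero_of_le (h'.hf i) (by omega), map_zero]
  refine ⟨g, ?_, ?_, fun i => by simpa using he i 0, fun i => by simpa using hf i 0⟩
  · have : b.compl₁₂ g.toLinearMap g.toLinearMap = b := by
      refine LinearMap.ext_basis B1 B1 ?_
      intro i j
      rw [hB1, Basis.mk_apply, Basis.mk_apply, LinearMap.compl₁₂_apply]
      rcases i with ⟨i, s⟩ | ⟨i, s⟩ <;> rcases j with ⟨j, t⟩ | ⟨j, t⟩ <;>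
        simp only [fam, LinearEquiv.coe_coe, he, hf]
      · rw [h.pair_ee hb hx, h'.pair_ee hb hx']
      · rw [h.pair hb hx, h'.pair hb hx']
      · rw [h.pair_fe hb hx, h'.pair_fe hb hx']
      · rw [h.pair_ff hb hx, h'.pair_ff hb hx']
    intro v w
    exact congrArg (fun c => c v w) this
  · have : g.toLinearMap ∘ₗ x = x' ∘ₗ g.toLinearMap := by
      refine B1.ext ?_
      intro i
      rw [hB1, Basis.mk_apply]
      rcases i with ⟨i, s⟩ | ⟨i, s⟩ <;>
        simp only [fam, LinearMap.comp_apply, LinearEquiv.coe_coe, he, hf]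
      · rw [← Module.End.mul_apply, ← pow_succ', he, pow_succ', Module.End.mul_apply]
      · rw [← Module.End.mul_apply, ← pow_succ', hf, pow_succ', Module.End.mul_apply]
    intro v
    exact congrArg (fun c => c v) this

theorem IsNil.conj {x' : End F V} {g : V ≃ₗ[F] V} (hg : Spg b g) (h : ∀ v, g (x v) = x' (g v))
    (hx : IsNil b x) : IsNil b x' := by
  constructor
  · intro v
    have := hx.alt (g.symm v)
    rw [← hg, h] at this
    simpa using this
  · obtain ⟨m, hm⟩ := hx.nil
    refine ⟨m, ?_⟩
    ext v
    have := comm_pow h m (g.symm v)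
    rw [hm] at this
    simpa using this.symm

theorem Sys.map {ι : Type*} {l : ι → ℕ} {e f : ι → V} {x' : End F V} {g : V ≃ₗ[F] V}
    (hg : Spg b g) (hgx : ∀ v, g (x v) = x' (g v)) (h : Sys b x l e f) :
    Sys b x' l (g ∘ e) (g ∘ f) where
  he := fun i => by rw [Function.comp_apply, ← comm_pow hgx, h.he, map_zero]
  hf := fun i => by rw [Function.comp_apply, ← comm_pow hgx, h.hf, map_zero]
  ee := fun i j s => by rw [Function.comp_apply, ← comm_pow hgx, Function.comp_apply, hg, h.ee]
  ff := fun i j s => by rw [Function.comp_apply, ← comm_pow hgx, Function.comp_apply, hg, h.ff]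
  ef0 := fun i j s hij => by
    rw [Function.comp_apply, ← comm_pow hgx, Function.comp_apply, hg, h.ef0 _ _ _ hij]
  ef1 := fun i s hs => by
    rw [Function.comp_apply, ← comm_pow hgx, Function.comp_apply, hg, h.ef1 _ _ hs]
  ef := fun i s hs => by
    rw [Function.comp_apply, ← comm_pow hgx, Function.comp_apply, hg, h.ef _ _ hs]

theorem Complete.map {ι : Type*} {e f : ι → V} {x' : End F V} {g : V ≃ₗ[F] V}
    (hg : Spg b g) (hgx : ∀ v, g (x v) = x' (g v)) (h : Complete b x e f) :
    Complete b x' (g ∘ e) (g ∘ f) := by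
  intro z hz
  rw [mem_perp_gens] at hz
  have : g.symm z = 0 := by
    apply h
    rw [mem_perp_gens]
    intro i s
    rw [← hg, ← hg (g.symm z) ((x ^ s) (f i)), comm_pow hgx, comm_pow hgx]
    simpa using hz i s
  simpa using this

theorem HasType.map {n : ℕ} {α β : Fin n → ℕ} {v : V} {x' : End F V} {g : V ≃ₗ[F] V}
    (hg : Spg b g) (hgx : ∀ v, g (x v) = x' (g v)) (h : HasType b x v α β) :
    HasType b x' (g v) α β := by
  obtain ⟨h1, h2, e, f, hs, hc, hv⟩ := h
  refine ⟨h1, h2, g ∘ e, g ∘ f, hs.map hg hgx, hc.map hg hgx, ?_⟩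
  rw [hv, map_sum]
  refine Finset.sum_congr rfl fun i _ => ?_
  rw [comm_pow hgx]; rfl

theorem HasType.conj {n : ℕ} {α β : Fin n → ℕ} {v v' : V} {x' : End F V}
    (hb : Symp b) (hx : IsNil b x) (hx' : IsNil b x')
    (h : HasType b x v α β) (h' : HasType b x' v' α β) :
    ∃ g : V ≃ₗ[F] V, Spg b g ∧ (∀ v, g (x v) = x' (g v)) ∧ g v = v' := by
  obtain ⟨h1, h2, e, f, hs, hc, hv⟩ := h
  obtain ⟨h1', h2', e', f', hs', hc', hv'⟩ := h'
  obtain ⟨g, hg, hgx, hge, hgf⟩ := hs.conj hb hx hx' hc hs' hc'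
  refine ⟨g, hg, hgx, ?_⟩
  rw [hv, hv', map_sum]
  refine Finset.sum_congr rfl fun i _ => ?_
  rw [comm_pow hgx, hge]

theorem Sys.finrank_range {ι : Type*} [Fintype ι] {l : ι → ℕ} {e f : ι → V}
    (hb : Symp b) (hx : IsNil b x) (h : Sys b x l e f) (hc : Complete b x e f) (j : ℕ) :
    finrank F (LinearMap.range (x ^ j)) = 2 * ∑ i, (l i - j) := by
  classical
  set F' := fam x (fun i => l i - j) (fun i => (x ^ j) (e i)) (fun i => (x ^ j) (f i)) with hF'
  have hli : LinearIndependent F F' := by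
    set sh : (Σ i, Fin (l i - j)) → (Σ i, Fin (l i)) :=
      fun p => ⟨p.1, ⟨(p.2 : ℕ) + j, by have := p.2.2; omega⟩⟩ with hsh
    have hinj : Function.Injective sh := by
      rintro ⟨i, s⟩ ⟨k, t⟩ hh
      simp only [hsh, Sigma.mk.injEq] at hh
      obtain ⟨rfl, hh⟩ := hh
      have hh := eq_of_heq hh
      simp only [Fin.mk.injEq] at hh
      congr 1
      ext; omega
    have := (h.fam_li hb hx).comp (Sum.map sh sh) (Sum.map_injective.2 ⟨hinj, hinj⟩)
    convert this using 1
    ext (p | p) <;> simp [hF', fam, sh, pow_app]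
  rw [← card_fam, ← finrank_span_eq_card hli]
  suffices hsp : LinearMap.range (x ^ j) = Submodule.span F (Set.range F') by rw [hsp]
  apply le_antisymm
  · rintro _ ⟨w, rfl⟩
    rw [h.expand hb hx hc w]
    unfold pr
    rw [map_sum]
    refine Submodule.sum_mem _ fun i _ => ?_
    rw [map_sum]
    refine Submodule.sum_mem _ fun s hs => ?_
    rw [map_add, map_smul, map_smul, pow_app, pow_app, add_comm j s]
    by_cases hsj : s < l i - j
    · refine Submodule.add_mem _ (Submodule.smul_mem _ _ (Submodule.subset_span ?_))
        (Submodule.smul_mem _ _ (Submodule.subset_span ?_))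
      · exact ⟨Sum.inl ⟨i, ⟨s, hsj⟩⟩, by simp [hF', fam, pow_app]⟩
      · exact ⟨Sum.inr ⟨i, ⟨s, hsj⟩⟩, by simp [hF', fam, pow_app]⟩
    · rw [pow_zero_of_le (s := s + j) (h.he i) (by omega),
        pow_zero_of_le (s := s + j) (h.hf i) (by omega)]
      simp
  · rw [Submodule.span_le]
    rintro _ ⟨(p | p), rfl⟩
    · exact ⟨(x ^ (p.2 : ℕ)) (e p.1), by simp [hF', fam, pow_app, add_comm]⟩
    · exact ⟨(x ^ (p.2 : ℕ)) (f p.1), by simp [hF', fam, pow_app, add_comm]⟩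

theorem antitone_unique {n : ℕ} {l l' : Fin n → ℕ} (h : Antitone l) (h' : Antitone l')
    (hs : ∀ j, ∑ i, (l i - j) = ∑ i, (l' i - j)) : l = l' := by
  have hcard : ∀ j, #{i | j < l i} = #{i | j < l' i} := by
    intro j
    have key : ∀ l : Fin n → ℕ, ∑ i, (l i - j) = ∑ i, (l i - (j + 1)) + #{i | j < l i} := by
      intro l
      rw [Finset.card_filter, ← Finset.sum_add_distrib]
      refine Finset.sum_congr rfl fun i _ => ?_
      split_ifs <;> omega
    have h1 := key l
    have h2 := key l'
    have h3 := hs j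
    have h4 := hs (j + 1)
    omega
  have key : ∀ {l : Fin n → ℕ}, Antitone l → ∀ j i, j < l i ↔ (i : ℕ) < #{i | j < l i} := by
    intro l h j i
    constructor
    · intro hj
      have : Finset.Iic i ⊆ ({i | j < l i} : Finset (Fin n)) := by
        intro k hk
        simp only [Finset.mem_Iic] at hk
        simp only [Finset.mem_filter, mem_univ, true_and]
        exact lt_of_lt_of_le hj (h hk)
      have := Finset.card_le_card this
      simp at this
      omega
    · intro hj
      by_contra hcon
      have : ({i | j < l i} : Finset (Fin n)) ⊆ Finset.Iio i := by
        intro k hk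
        simp only [Finset.mem_filter, mem_univ, true_and] at hk
        simp only [Finset.mem_Iio]
        by_contra hh
        exact hcon (lt_of_lt_of_le hk (h (not_lt.1 hh)))
      have := Finset.card_le_card this
      simp at this
      omega
  ext i
  have : ∀ j, j < l i ↔ j < l' i := by
    intro j
    rw [key h, key h', hcard]
  have h1 := this (l i)
  have h2 := this (l' i)
  omega

theorem lam_unique {n : ℕ} {l l' : Fin n → ℕ} {e f e' f' : Fin n → V}
    (hb : Symp b) (hx : IsNil b x) (h : Sys b x l e f) (hc : Complete b x e f)
    (h' : Sys b x l' e' f') (hc' : Complete b x e' f') (hl : Antitone l) (hl' : Antitone l') :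
    l = l' := by
  refine antitone_unique hl hl' fun j => ?_
  have h1 := h.finrank_range hb hx hc j
  have h2 := h'.finrank_range hb hx hc' j
  omega

/-- The canonical submodules. -/
def Msub (b : V →ₗ[F] V →ₗ[F] F) (x : End F V) {n : ℕ} (α β : Fin n → ℕ) : Submodule F V :=
  perp b {z | ∃ i y, (x ^ (α i + β i)) y = 0 ∧ z = (x ^ β i) y}

theorem mem_Msub {n : ℕ} {α β : Fin n → ℕ} {v : V} :
    v ∈ Msub b x α β ↔ ∀ i y, (x ^ (α i + β i)) y = 0 → b v ((x ^ β i) y) = 0 := by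
  constructor
  · intro h i y hy
    exact h _ ⟨i, y, hy, rfl⟩
  · rintro h _ ⟨i, y, hy, rfl⟩
    exact h i y hy

theorem Msub_gen {n : ℕ} {α β : Fin n → ℕ} (hb : Symp b) (hx : IsNil b x)
    (hα : Antitone α) (hβ : Antitone β) {i : Fin n} {u : V} {t : ℕ}
    (hu : (x ^ (α i + β i)) u = 0) (ht : α i ≤ t) : (x ^ t) u ∈ Msub b x α β := by
  rw [mem_Msub]
  intro j y hy
  rcases le_total j i with h | h
  · rw [← hx.swap_pow hb, pow_app, pow_zero_of_le hu (by have := hβ h; omega)]; simp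
  · rw [hx.swap_pow hb, pow_app, pow_zero_of_le hy (by have := hα h; omega)]; simp

theorem mem_of_coeff {ι : Type*} [Fintype ι] {l γ : ι → ℕ} {e f : ι → V}
    (hb : Symp b) (hx : IsNil b x) (h : Sys b x l e f) (hc : Complete b x e f) (M : Submodule F V)
    (he : ∀ i s, γ i ≤ s → (x ^ s) (e i) ∈ M) (hf : ∀ i s, γ i ≤ s → (x ^ s) (f i) ∈ M) {v : V}
    (hve : ∀ i s, s < γ i → s < l i → b v ((x ^ (l i - 1 - s)) (e i)) = 0)
    (hvf : ∀ i s, s < γ i → s < l i → b v ((x ^ (l i - 1 - s)) (f i)) = 0) : v ∈ M := by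
  rw [h.expand hb hx hc v]
  unfold pr
  refine Submodule.sum_mem _ fun i _ => Submodule.sum_mem _ fun s hs => ?_
  rw [Finset.mem_range] at hs
  by_cases hsi : s < γ i
  · rw [hve i s hsi hs, hvf i s hsi hs]; simp
  · exact M.add_mem (M.smul_mem _ (he i s (by omega))) (M.smul_mem _ (hf i s (by omega)))

/-- `M(α,β)` is contained in any submodule containing the obvious vectors -/
theorem Msub_le {n : ℕ} {α β : Fin n → ℕ} {e f : Fin n → V}
    (hb : Symp b) (hx : IsNil b x) (h : Sys b x (α + β) e f) (hc : Complete b x e f)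
    (M : Submodule F V)
    (he : ∀ i s, α i ≤ s → (x ^ s) (e i) ∈ M) (hf : ∀ i s, α i ≤ s → (x ^ s) (f i) ∈ M) :
    Msub b x α β ≤ M := by
  intro v hv
  rw [mem_Msub] at hv
  have e1 : ∀ i, ∀ s < α i, (α + β) i - 1 - s = β i + (α i - 1 - s) := by
    intro i s hs; simp only [Pi.add_apply]; omega
  refine mem_of_coeff hb hx h hc M he hf ?_ ?_
  · intro i s hs _
    rw [e1 i s hs, ← pow_app]
    apply hv
    rw [pow_app]
    exact pow_zero_of_le (h.he i) (by simp)
  · intro i s hs _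
    rw [e1 i s hs, ← pow_app]
    apply hv
    rw [pow_app]
    exact pow_zero_of_le (h.hf i) (by simp)

theorem Msub_perp {n : ℕ} {α β : Fin n → ℕ} {e f : Fin n → V} (hα : Antitone α) (hβ : Antitone β)
    (hb : Symp b) (hx : IsNil b x) (h : Sys b x (α + β) e f) (hc : Complete b x e f) :
    perp b (Msub b x α β) = Msub b x β α := by
  apply le_antisymm
  · intro v hv
    have h1 : ∀ i, ∀ s < β i, α i ≤ (α + β) i - 1 - s := by
      intro i s hs; simp only [Pi.add_apply]; omega
    refine mem_of_coeff (γ := β) hb hx h hc _ ?_ ?_ ?_ ?_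
    · intro i s hs
      exact Msub_gen hb hx hβ hα (by rw [add_comm]; exact h.he i) hs
    · intro i s hs
      exact Msub_gen hb hx hβ hα (by rw [add_comm]; exact h.hf i) hs
    · intro i s hs _
      exact hv _ (Msub_gen hb hx hα hβ (h.he i) (h1 i s hs))
    · intro i s hs _
      exact hv _ (Msub_gen hb hx hα hβ (h.hf i) (h1 i s hs))
  · intro v hv w hw
    have : Msub b x α β ≤ perp b (Msub b x β α) := by
      refine Msub_le hb hx h hc _ ?_ ?_
      · intro i s hs u hu
        rw [hb.symm]
        have e1 : s = α i + (s - α i) := by omega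
        rw [e1, ← pow_app]
        refine mem_Msub.1 hu i _ ?_
        rw [pow_app, add_comm (β i)]
        exact pow_zero_of_le (h.he i) (by simp)
      · intro i s hs u hu
        rw [hb.symm]
        have e1 : s = α i + (s - α i) := by omega
        rw [e1, ← pow_app]
        refine mem_Msub.1 hu i _ ?_
        rw [pow_app, add_comm (β i)]
        exact pow_zero_of_le (h.hf i) (by simp)
    rw [hb.symm]
    exact this hw v hv

theorem HasType.mem_Msub_iff {n : ℕ} {α β α' β' : Fin n → ℕ} {v : V}
    (hb : Symp b) (hx : IsNil b x) (h : HasType b x v α β) (hα' : Antitone α')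
    (hβ' : Antitone β') (hl : α' + β' = α + β) : v ∈ Msub b x α' β' ↔ α' ≤ α := by
  classical
  obtain ⟨h1, h2, e, f, hs, hc, hv⟩ := h
  have hl' : ∀ i, α' i + β' i = α i + β i := fun i => congrFun hl i
  constructor
  · intro hm i
    by_contra hcon
    have hcon : α i < α' i := not_le.1 hcon
    have hl2 := hl' i
    have hex : α i + (β' i + (α' i - α i - 1)) + 1 = (α + β) i := by
      simp only [Pi.add_apply]; omega
    rw [mem_Msub] at hm
    have := hm i ((x ^ (α' i - α i - 1)) (f i)) (by
      rw [pow_app, hl']; exact pow_zero_of_le (hs.hf i) (by simp))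
    rw [hv, map_sum, LinearMap.sum_apply, Finset.sum_eq_single i] at this
    · rw [pow_app, hs.pair hb hx, if_pos ⟨rfl, hex⟩] at this
      exact one_ne_zero this
    · intro j _ hj
      rw [pow_app, hs.pair hb hx, if_neg (fun hh => hj hh.1)]
    · intro hh; exact absurd (mem_univ _) hh
  · intro hle
    rw [hv]
    refine Submodule.sum_mem _ fun i _ => ?_
    exact Msub_gen hb hx hα' hβ' (by rw [hl']; exact hs.he i) (hle i)

theorem HasType.lam_eq {n : ℕ} {α β α' β' : Fin n → ℕ} {v w : V}
    (hb : Symp b) (hx : IsNil b x) (h : HasType b x v α β) (h' : HasType b x w α' β') :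
    α + β = α' + β' := by
  obtain ⟨h1, h2, e, f, hs, hc, hv⟩ := h
  obtain ⟨h1', h2', e', f', hs', hc', hv'⟩ := h'
  exact lam_unique hb hx hs hc hs' hc' (h1.add h2) (h1'.add h2')

theorem HasType.unique {n : ℕ} {α β α' β' : Fin n → ℕ} {v : V}
    (hb : Symp b) (hx : IsNil b x) (h : HasType b x v α β) (h' : HasType b x v α' β') :
    α = α' ∧ β = β' := by
  have hl := h.lam_eq hb hx h'
  have e1 : α = α' := by
    apply le_antisymm
    · exact (h'.mem_Msub_iff hb hx h.1 h.2.1 hl).1 ((h.mem_Msub_iff hb hx h.1 h.2.1 rfl).2 le_rfl)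
    · exact (h.mem_Msub_iff hb hx h'.1 h'.2.1 hl.symm).1
        ((h'.mem_Msub_iff hb hx h'.1 h'.2.1 rfl).2 le_rfl)
  refine ⟨e1, ?_⟩
  subst e1
  exact add_left_cancel hl

theorem finrank_perp [FiniteDimensional F V] (hb : Symp b) (W : Submodule F V) :
    finrank F (perp b (W : Set V)) + finrank F W = finrank F V := by
  have hnd : LinearMap.BilinForm.Nondegenerate b := by
    constructor
    · intro v hv; exact hb.nd v hv
    · intro v hv
      refine hb.nd v fun w => ?_
      rw [hb.symm]; exact hv w
  have href : LinearMap.BilinForm.IsRefl b := by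
    intro v w h
    rw [hb.symm]; exact h
  have h1 := LinearMap.BilinForm.finrank_orthogonal hnd W
  have h2 : LinearMap.BilinForm.orthogonal b W = perp b (W : Set V) := by
    ext z
    rw [LinearMap.BilinForm.mem_orthogonal_iff, mem_perp]
    refine forall₂_congr fun y hy => ?_
    rw [hb.symm z y]
  rw [h2] at h1
  have := Submodule.finrank_le W
  omega

end conj
end NilOrb

namespace NilOrb
section chi

/-- additive character with values ±1, Frobenius invariant -/
structure Chi {F : Type*} [Field F] (χ : F → ℚ) : Prop where
  add : ∀ a c, χ (a + c) = χ a * χ c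
  zero : χ 0 = 1
  sq : ∀ a, χ (a ^ 2) = χ a
  pm : ∀ a, χ a = 1 ∨ χ a = -1
  nt : ∃ a, χ a = -1

theorem zmod2 : ∀ z : ZMod 2, z = 0 ∨ z = 1 := by decide

theorem zmod2' : (1 : ZMod 2) + 1 = 0 := by decide

theorem chi_exists (F : Type*) [Field F] [Finite F] [CharP F 2] : ∃ χ : F → ℚ, Chi χ := by
  classical
  let _ : Algebra (ZMod 2) F := ZMod.algebra F 2
  have _ : Fact (Nat.Prime 2) := ⟨Nat.prime_two⟩
  have hnt0 : Algebra.trace (ZMod 2) F ≠ 0 := Algebra.trace_ne_zero (ZMod 2) F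
  set T := Algebra.trace (ZMod 2) F with hT
  have hnt : ∃ a, T a ≠ 0 := by
    by_contra hcon
    push Not at hcon
    exact hnt0 (LinearMap.ext hcon)
  have hfr : ∀ a, T (a ^ 2) = T a := by
    intro a
    have := Algebra.trace_eq_of_algEquiv (FiniteField.frobeniusAlgEquiv (ZMod 2) F 2) a
    simpa [hT] using this
  refine ⟨fun a => if T a = 0 then 1 else -1, ⟨?_, ?_, ?_, ?_, ?_⟩⟩
  · intro a c
    simp only [map_add]
    rcases zmod2 (T a) with h | h <;> rcases zmod2 (T c) with h' | h' <;> simp [h, h']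
    intro h2
    exact absurd zmod2' h2
  · simp
  · intro a; simp only [hfr]
  · intro a; split_ifs <;> simp
  · obtain ⟨a, ha⟩ := hnt
    exact ⟨a, by simp [ha]⟩

theorem Chi.mul_self {F : Type*} [Field F] {χ : F → ℚ} (h : Chi χ) (a : F) : χ a * χ a = 1 := by
  rcases h.pm a with h | h <;> rw [h] <;> norm_num

theorem Chi.sum_eq_zero {F A : Type*} [Field F] [AddCommGroup A] [Fintype A] {χ : F → ℚ}
    (h : Chi χ) (L : A → F) (hL : ∀ a c, L (a + c) = L a + L c) (hne : ∃ a, χ (L a) = -1) :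
    ∑ a, χ (L a) = 0 := by
  obtain ⟨a, ha⟩ := hne
  have : ∑ c, χ (L c) = ∑ c, χ (L (a + c)) :=
    (Equiv.sum_comp (Equiv.addLeft a) (fun c => χ (L c))).symm
  simp only [hL, h.add, ha, ← Finset.mul_sum] at this
  linarith

/-- Gauss sum over an additive functional which is linear -/
theorem Chi.sum_linear {F A : Type*} [Field F] [AddCommGroup A] [Module F A] [Fintype A]
    {χ : F → ℚ} (h : Chi χ) (L : A →ₗ[F] F) (hne : L ≠ 0) : ∑ a, χ (L a) = 0 := by
  refine h.sum_eq_zero L (fun a c => map_add L a c) ?_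
  obtain ⟨t, ht⟩ := h.nt
  obtain ⟨a, ha⟩ : ∃ a, L a ≠ 0 := by
    by_contra hcon
    push Not at hcon
    exact hne (LinearMap.ext hcon)
  refine ⟨(t * (L a)⁻¹) • a, ?_⟩
  rw [map_smul, smul_eq_mul, mul_assoc, inv_mul_cancel₀ ha, mul_one, ht]

end chi

section quad
variable {F V : Type*} [Field F] [AddCommGroup V] [Module F V]
variable [CharP F 2] {b : V →ₗ[F] V →ₗ[F] F} {x : End F V}

/-- quadratic forms with polarization b -/
structure IsQ (b : V →ₗ[F] V →ₗ[F] F) (φ : V → F) : Prop where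
  add : ∀ v w, φ (v + w) = φ v + φ w + b v w
  smul : ∀ (a : F) v, φ (a • v) = a ^ 2 * φ v

theorem IsQ.zero {φ : V → F} (h : IsQ b φ) : φ 0 = 0 := by
  have := h.smul 0 0
  simpa using this

theorem IsQ.twist {φ : V → F} (h : IsQ b φ) (u : V) : IsQ b (fun v => φ v + (b u v) ^ 2) := by
  constructor
  · intro v w
    rw [h.add, map_add, CharTwo.add_sq]; ring
  · intro a v
    rw [h.smul, map_smul, smul_eq_mul]; ring

theorem IsQ.map {φ : V → F} (h : IsQ b φ) {g : V ≃ₗ[F] V} (hg : Spg b g) :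
    IsQ b (fun v => φ (g v)) := by
  constructor
  · intro v w
    rw [map_add, h.add, hg]
  · intro a v
    rw [map_smul, h.smul]

theorem riesz [FiniteDimensional F V] (hb : Symp b) (L : V →ₗ[F] F) : ∃ u, b u = L := by
  have hinj : Function.Injective b := by
    rw [← LinearMap.ker_eq_bot, LinearMap.ker_eq_bot']
    intro v hv
    refine hb.nd v fun w => ?_
    rw [hv]; rfl
  have : finrank F V = finrank F (V →ₗ[F] F) := (Subspace.dual_finrank_eq (K := F) (V := V)).symm
  exact (LinearMap.injective_iff_surjective_of_finrank_eq_finrank this).1 hinj L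

theorem sq_inj {a c : F} (h : a ^ 2 = c ^ 2) : a = c := by
  have : (a + c) ^ 2 = 0 := by rw [CharTwo.add_sq, h, CharTwo.add_self_eq_zero]
  have := pow_eq_zero_iff (two_ne_zero) |>.1 this
  exact CharTwo.add_eq_zero.1 this

theorem IsQ.torsor [Finite F] [FiniteDimensional F V] (hb : Symp b) {φ φ' : V → F} (h : IsQ b φ)
    (h' : IsQ b φ') : ∃ u, ∀ v, φ' v = φ v + (b u v) ^ 2 := by
  have hsq : ∀ a : F, ∃ c, c ^ 2 = a := by
    intro a
    have hi : Function.Injective (fun c : F => c ^ 2) := fun a c h => sq_inj h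
    exact Finite.surjective_of_injective hi a
  choose r hr using hsq
  have hadd : ∀ v w, φ' (v + w) + φ (v + w) = (φ' v + φ v) + (φ' w + φ w) := by
    intro v w
    rw [h.add, h'.add]
    linear_combination (b v w) * (CharTwo.two_eq_zero (R := F))
  let L : V →ₗ[F] F :=
    { toFun := fun v => r (φ' v + φ v)
      map_add' := by
        intro v w
        apply sq_inj
        rw [CharTwo.add_sq, hr, hr, hr, hadd]
      map_smul' := by
        intro a v
        apply sq_inj
        simp only [RingHom.id_apply, smul_eq_mul]
        rw [mul_pow, hr, hr, h.smul, h'.smul]; ring }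
  obtain ⟨u, hu⟩ := riesz hb L
  refine ⟨u, fun v => ?_⟩
  rw [hu]
  show φ' v = φ v + r (φ' v + φ v) ^ 2
  rw [hr]
  linear_combination -(φ v) * (CharTwo.two_eq_zero (R := F))

theorem twist_inj (hb : Symp b) {u u' : V} (h : ∀ v, (b u v) ^ 2 = (b u' v) ^ 2) : u = u' := by
  rw [← sub_eq_zero]
  refine hb.nd _ fun v => ?_
  rw [map_sub, LinearMap.sub_apply, sub_eq_zero]
  exact sq_inj (h v)

/-- quadratic forms -/
abbrev Qs (b : V →ₗ[F] V →ₗ[F] F) := {φ : V → F // IsQ b φ}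

/-- torsor equivalence -/
noncomputable def qsEquiv [Finite F] [FiniteDimensional F V] (hb : Symp b) (φ : Qs b) : V ≃ Qs b :=
  Equiv.ofBijective (fun u => (⟨_, φ.2.twist u⟩ : Qs b)) (by
    constructor
    · intro u u' h
      refine twist_inj hb fun v => ?_
      have := congrFun (congrArg Subtype.val h) v
      exact add_left_cancel this
    · intro φ'
      obtain ⟨u, hu⟩ := φ.2.torsor hb φ'.2
      exact ⟨u, Subtype.ext (funext fun v => (hu v).symm)⟩)

theorem qsEquiv_apply [Finite F] [FiniteDimensional F V] (hb : Symp b) (φ : Qs b) (u v : V) :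
    (qsEquiv hb φ u).1 v = φ.1 v + (b u v) ^ 2 := rfl

variable {χ : F → ℚ}

theorem Chi.sum_sub [Fintype V] (h : Chi χ) (hb : Symp b) (M : Submodule F V) [Fintype M] (v : V) :
    ∑ w : M, χ (b v w) = open Classical in if v ∈ perp b (M : Set V) then (Fintype.card M : ℚ) else 0 := by
  classical
  split_ifs with hv
  · have : ∀ w : M, χ (b v w) = 1 := by
      intro w
      rw [hv w w.2, h.zero]
    simp [this]
  · refine h.sum_linear ((b v).comp M.subtype) ?_
    intro h0
    apply hv
    intro w hw
    exact congrArg (fun L => L ⟨w, hw⟩) h0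

theorem Chi.sum_all [Fintype V] [DecidableEq V] (h : Chi χ) (hb : Symp b) (v : V) :
    ∑ w, χ (b v w) = if v = 0 then (Fintype.card V : ℚ) else 0 := by
  split_ifs with hv
  · subst hv; simp [h.zero]
  · refine h.sum_linear (b v) ?_
    intro h0
    exact hv (hb.nd v (fun w => by rw [h0]; rfl))

/-- Gauss sum -/
def gs [Fintype V] (χ : F → ℚ) (φ : V → F) : ℚ := ∑ v, χ (φ v)

theorem gs_sq [Fintype V] (h : Chi χ) (hb : Symp b) {φ : V → F} (hφ : IsQ b φ) :
    gs χ φ ^ 2 = Fintype.card V := by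
  classical
  unfold gs
  rw [sq, Finset.sum_mul_sum]
  have h1 : ∀ v, ∑ w, χ (φ v) * χ (φ w) = ∑ t, χ (φ t) * χ (b t v) := by
    intro v
    rw [← Equiv.sum_comp (Equiv.addLeft v) (fun w => χ (φ v) * χ (φ w))]
    refine Finset.sum_congr rfl fun t _ => ?_
    simp only [Equiv.coe_addLeft]
    rw [hφ.add, h.add, h.add, hb.symm v t]
    linear_combination (χ (φ t) * χ (b t v)) * h.mul_self (φ v)
  simp only [h1]
  rw [Finset.sum_comm]
  simp only [← Finset.mul_sum, h.sum_all hb]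
  simp [hφ.zero, h.zero]

theorem gs_pm [Fintype V] [Fintype F] (h : Chi χ) (hb : Symp b) {φ : V → F} (hφ : IsQ b φ) {n : ℕ}
    (hn : finrank F V = 2 * n) :
    gs χ φ = (Fintype.card F : ℚ) ^ n ∨ gs χ φ = - (Fintype.card F : ℚ) ^ n := by
  have := gs_sq h hb hφ
  rw [Module.card_eq_pow_finrank (K := F), hn, Nat.cast_pow, pow_mul', sq_eq_sq_iff_eq_or_eq_neg] at this
  exact this

end quad
end NilOrb

namespace NilOrb
section plus
variable {F V : Type*} [Field F] [AddCommGroup V] [Module F V]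
variable [CharP F 2] {b : V →ₗ[F] V →ₗ[F] F} {x : End F V} {χ : F → ℚ}

theorem IsQ.lin {φ : V → F} (h : IsQ b φ) {U : Submodule F V} (hU : ∀ u ∈ U, φ u = 0) {u w : V}
    (hu : u ∈ U) (hw : w ∈ U) : b u w = 0 := by
  have := h.add u w
  rw [hU u hu, hU w hw, hU _ (U.add_mem hu hw)] at this
  simpa using this.symm

theorem gs_perp [Fintype V] (h : Chi χ) (hb : Symp b) {φ : V → F} (hφ : IsQ b φ)
    (U : Submodule F V) (hU : ∀ u ∈ U, φ u = 0) [Fintype (perp b (U : Set V))] :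
    gs χ φ = ∑ v : perp b (U : Set V), χ (φ v) := by
  classical
  have hc : (Fintype.card U : ℚ) ≠ 0 := by
    have : 0 < Fintype.card U := Fintype.card_pos
    positivity
  apply mul_left_cancel₀ hc
  have h1 : ∀ u : U, gs χ φ = ∑ v, χ (φ v) * χ (b v u) := by
    intro u
    unfold gs
    rw [← Equiv.sum_comp (Equiv.addRight (u : V)) (fun v => χ (φ v))]
    refine Finset.sum_congr rfl fun v _ => ?_
    simp only [Equiv.coe_addRight]
    rw [hφ.add, hU u u.2, add_zero, h.add]
  have h2 : (Fintype.card U : ℚ) * gs χ φ = ∑ u : U, gs χ φ := by simp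
  rw [h2, Finset.sum_congr rfl (fun u _ => h1 u), Finset.sum_comm]
  simp only [← Finset.mul_sum, h.sum_sub hb]
  simp only [mul_ite, mul_zero]
  rw [← Finset.sum_filter, Finset.mul_sum]
  have h3 : ∑ v : perp b (U : Set V), (Fintype.card U : ℚ) * χ (φ v) =
      ∑ v ∈ univ.filter (fun v => v ∈ perp b (U : Set V)), (Fintype.card U : ℚ) * χ (φ v) := by
    rw [Finset.sum_subtype (p := fun v => v ∈ perp b (U : Set V))]
    intro v; simp
  rw [h3]
  refine Finset.sum_congr rfl fun v _ => mul_comm _ _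

theorem le_perp {φ : V → F} (hφ : IsQ b φ) {U : Submodule F V} (hU : ∀ u ∈ U, φ u = 0) :
    U ≤ perp b (U : Set V) := fun u hu w hw => hφ.lin hU hu hw

theorem perp_eq [FiniteDimensional F V] (hb : Symp b) {U : Submodule F V} {n : ℕ}
    (hU : U ≤ perp b (U : Set V))
    (hn : finrank F V = 2 * n) (hd : finrank F U = n) : perp b (U : Set V) = U := by
  have := finrank_perp hb U
  exact (Submodule.eq_of_le_of_finrank_eq hU (by omega)).symm

theorem gs_of_ts [Fintype V] [Fintype F] (h : Chi χ) (hb : Symp b) {φ : V → F} (hφ : IsQ b φ)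
    {n : ℕ} (hn : finrank F V = 2 * n)
    (U : Submodule F V) (hU : ∀ u ∈ U, φ u = 0) (hd : finrank F U = n) :
    gs χ φ = (Fintype.card F : ℚ) ^ n := by
  classical
  have := Module.Finite.of_finite (R := F) (M := V)
  rw [gs_perp h hb hφ U hU]
  have hp := perp_eq hb (le_perp hφ hU) hn hd
  have h1 : ∀ v : perp b (U : Set V), χ (φ v) = 1 := by
    intro v
    rw [hU v (hp.le v.2), h.zero]
  simp only [h1]
  have : Fintype.card (perp b (U : Set V)) = Fintype.card F ^ n := by
    rw [Module.card_eq_pow_finrank (K := F), hp, hd]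
  simp [this]

theorem ts_of_gs [Fintype V] [Fintype F] (h : Chi χ) (hb : Symp b) {φ : V → F} (hφ : IsQ b φ)
    {n : ℕ} (hn : finrank F V = 2 * n) (hg : gs χ φ = (Fintype.card F : ℚ) ^ n) :
    ∃ U : Submodule F V, (∀ u ∈ U, φ u = 0) ∧ finrank F U = n := by
  classical
  have := Module.Finite.of_finite (R := F) (M := V)
  have hle : ∀ U : Submodule F V, (∀ u ∈ U, φ u = 0) → finrank F U ≤ n := by
    intro U hU
    have h1 := finrank_perp hb U
    have h2 := Submodule.finrank_mono (le_perp hφ hU)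
    omega
  set P : ℕ → Prop := fun d => ∃ U : Submodule F V, (∀ u ∈ U, φ u = 0) ∧ finrank F U = d with hP
  have hP0 : P 0 := ⟨⊥, by simp [hφ.zero], by simp⟩
  set d := Nat.findGreatest P n with hd
  obtain ⟨U, hU, hUd⟩ : P d := Nat.findGreatest_spec (Nat.zero_le n) hP0
  have hdn : d ≤ n := Nat.findGreatest_le n
  by_cases hdn' : d = n
  · exact ⟨U, hU, hUd.trans hdn'⟩
  exfalso
  set W := perp b (U : Set V) with hW
  have hWd : finrank F W = 2 * n - d := by
    have := finrank_perp hb U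
    rw [← hW, hUd] at this
    omega
  have hmax : ∀ v ∈ W, φ v = 0 → v ∈ U := by
    intro v hv hv0
    by_contra hvU
    have hU' : ∀ u ∈ U ⊔ F ∙ v, φ u = 0 := by
      intro u hu
      rw [Submodule.mem_sup] at hu
      obtain ⟨y, hy, z, hz, rfl⟩ := hu
      rw [Submodule.mem_span_singleton] at hz
      obtain ⟨a, rfl⟩ := hz
      rw [hφ.add, hU y hy, hφ.smul, hv0, map_smul, hb.symm, hv y hy]; simp
    have hlt : U < U ⊔ F ∙ v := by
      refine lt_of_le_of_ne le_sup_left fun heq => hvU ?_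
      rw [heq]
      exact le_sup_right (a := U) (Submodule.mem_span_singleton_self v)
    have h1 := Submodule.finrank_lt_finrank_of_lt hlt
    have h2 : finrank F (U ⊔ F ∙ v : Submodule F V) ≤ d :=
      Nat.le_findGreatest (hle _ hU') ⟨_, hU', rfl⟩
    omega
  -- count
  have hsc : ∀ c : F, c ≠ 0 → ∑ v : W, χ (c * φ v) = (Fintype.card F : ℚ) ^ n := by
    intro c hc
    obtain ⟨r, hr⟩ : ∃ r : F, r ^ 2 = c :=
      Finite.surjective_of_injective (f := fun c : F => c ^ 2) (fun a c h => sq_inj h) c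
    have hr0 : r ≠ 0 := by rintro rfl; apply hc; rw [← hr]; simp
    rw [← hg, gs_perp h hb hφ U hU,
      ← Equiv.sum_comp (LinearEquiv.smulOfNeZero F W r hr0).toEquiv (fun v : W => χ (φ v))]
    refine Finset.sum_congr rfl fun v _ => ?_
    simp only [LinearEquiv.coe_toEquiv, LinearEquiv.smulOfNeZero_apply, Submodule.coe_smul]
    rw [hφ.smul, hr]
  have hsum : ∑ c : F, ∑ v : W, χ (c * φ v) = (Fintype.card F : ℚ) * (Fintype.card F : ℚ) ^ d := by
    rw [Finset.sum_comm]
    have h1 : ∀ v : W, ∑ c : F, χ (c * φ v) = if (v : V) ∈ U then (Fintype.card F : ℚ) else 0 := by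
      intro v
      split_ifs with hv
      · simp [hU v hv, h.zero]
      · have hv0 : φ v ≠ 0 := fun h0 => hv (hmax v v.2 h0)
        refine h.sum_linear (LinearMap.mulRight F (φ v)) ?_
        intro h0
        have := congrArg (fun L => L 1) h0
        simp at this
        exact hv0 this
    simp only [h1]
    rw [← Finset.sum_filter, Finset.sum_const, nsmul_eq_mul, mul_comm]
    congr 1
    have e1 : Fintype.card U = Fintype.card F ^ d := by
      rw [Module.card_eq_pow_finrank (K := F), hUd]
    rw [← Nat.cast_pow, ← e1]
    congr 1
    rw [← Fintype.card_subtype]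
    refine Fintype.card_congr ⟨fun v => ⟨v.1.1, v.2⟩, fun u => ⟨⟨u.1, le_perp hφ hU u.2⟩, u.2⟩, ?_, ?_⟩
    · intro v; rfl
    · intro v; rfl
  have hW' : (Fintype.card W : ℚ) = (Fintype.card F : ℚ) ^ (2 * n - d) := by
    rw [Module.card_eq_pow_finrank (K := F), hWd]; simp
  have hsplit : ∑ c : F, ∑ v : W, χ (c * φ v) ≥ (Fintype.card W : ℚ) := by
    rw [← Finset.add_sum_erase _ _ (Finset.mem_univ (0 : F))]
    have h1 : ∑ v : W, χ (0 * φ v) = (Fintype.card W : ℚ) := by simp [h.zero]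
    rw [h1]
    have : 0 ≤ ∑ c ∈ univ.erase (0 : F), ∑ v : W, χ (c * φ v) := by
      refine Finset.sum_nonneg fun c hc => ?_
      rw [hsc c (Finset.ne_of_mem_erase hc)]
      positivity
    linarith
  rw [hsum, hW', ← pow_succ'] at hsplit
  have hq : (1 : ℚ) < Fintype.card F := by exact_mod_cast Fintype.one_lt_card
  have := (pow_le_pow_iff_right₀ hq).1 hsplit
  omega

/-- hyperbolic basis -/
theorem hyper_exists [FiniteDimensional F V] (hb : Symp b) {φ : V → F} (hφ : IsQ b φ)
    {n : ℕ} (hn : finrank F V = 2 * n)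
    (U : Submodule F V) (hU : ∀ u ∈ U, φ u = 0) (hd : finrank F U = n) :
    ∃ e f : Fin n → V, Sys b (0 : End F V) (fun _ => 1) e f ∧ (∀ i, φ (e i) = 0) ∧
      (∀ i, φ (f i) = 0) := by
  classical
  let B : Basis (Fin n) F U := finBasisOfFinrankEq F U hd
  have hex : ∀ i, ∃ y : V, ∀ j, b y (B j) = if i = j then 1 else 0 := by
    intro i
    obtain ⟨L, hL⟩ := LinearMap.exists_extend (B.coord i)
    obtain ⟨y, hy⟩ := riesz hb L
    refine ⟨y, fun j => ?_⟩
    rw [hy]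
    have : L (B j) = (L.comp U.subtype) (B j) := rfl
    rw [this, hL, Basis.coord_apply, Basis.repr_self, Finsupp.single_apply]
    simp [eq_comm]
  choose y hy using hex
  have hee : ∀ i j, b (B i : V) (B j) = 0 := fun i j => hφ.lin hU (B i).2 (B j).2
  set c : Fin n → Fin n → F := fun i j => if i = j then φ (y i) else if j < i then b (y i) (y j) else 0
    with hc
  set z : Fin n → V := fun i => ∑ j, c i j • (B j : V) with hz
  have hzU : ∀ i, z i ∈ U := fun i => U.sum_mem fun j _ => U.smul_mem _ (B j).2
  have hyz : ∀ i k, b (y i) (z k) = c k i := by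
    intro i k
    simp [hz, hy]
  have hez : ∀ i k, b (B i : V) (z k) = 0 := fun i k => hφ.lin hU (B i).2 (hzU k)
  have hzz : ∀ i k, b (z i) (z k) = 0 := fun i k => hφ.lin hU (hzU i) (hzU k)
  have hp : ∀ s : ℕ, s ≠ 0 → ((0 : End F V) ^ s) = 0 := fun s hs => zero_pow hs
  have hff : ∀ i j, b (y i + z i) (y j + z j) = 0 := by
    intro i j
    rw [map_add, map_add, LinearMap.add_apply, LinearMap.add_apply, hyz, hzz, hb.symm (z i), hyz,
      add_zero]
    rcases lt_trichotomy i j with h | h | h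
    · simp only [hc]
      rw [if_neg h.ne, if_neg (not_lt.2 h.le), if_neg h.ne', if_pos h, add_zero, hb.symm (y j),
        CharTwo.add_self_eq_zero]
    · subst h
      rw [hb.alt, zero_add, CharTwo.add_self_eq_zero]
    · simp only [hc]
      rw [if_neg h.ne', if_pos h, if_neg h.ne, if_neg (not_lt.2 h.le), add_zero,
        CharTwo.add_self_eq_zero]
  have hef : ∀ i j, b (B i : V) (y j + z j) = if i = j then 1 else 0 := by
    intro i j
    rw [map_add, hez, add_zero, hb.symm, hy]
    simp [eq_comm]
  refine ⟨fun i => B i, fun i => y i + z i, Sys.mk' ?_ ?_ ?_ ?_ ?_, fun i => hU _ (B i).2, ?_⟩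
  · intro i; simp
  · intro i; simp
  · intro i j s
    by_cases hs : s = 0
    · subst hs; simpa using hee i j
    · rw [hp s hs]; simp
  · intro i j s
    by_cases hs : s = 0
    · subst hs; simpa using hff i j
    · rw [hp s hs]; simp
  · intro i j s
    by_cases hs : s = 0
    · subst hs; simpa using hef i j
    · rw [hp s hs, if_neg (by omega)]; simp
  · intro i
    rw [hφ.add, hU _ (hzU i), hyz, add_zero]
    simp only [hc, if_true]
    rw [CharTwo.add_self_eq_zero]

theorem isNil_zero : IsNil b (0 : End F V) := ⟨by simp, IsNilpotent.zero⟩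

/-- the span of a set on which a quadratic form twist vanishes -/
theorem plus_conj [Fintype V] [Fintype F] (h : Chi χ) (hb : Symp b) {φ φ' : V → F}
    (hφ : IsQ b φ) (hφ' : IsQ b φ')
    {n : ℕ} (hn : finrank F V = 2 * n) (hg : gs χ φ = (Fintype.card F : ℚ) ^ n)
    (hg' : gs χ φ' = (Fintype.card F : ℚ) ^ n) :
    ∃ g : V ≃ₗ[F] V, Spg b g ∧ ∀ v, φ' (g v) = φ v := by
  have := Module.Finite.of_finite (R := F) (M := V)
  obtain ⟨U, hU, hUd⟩ := ts_of_gs h hb hφ hn hg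
  obtain ⟨U', hU', hUd'⟩ := ts_of_gs h hb hφ' hn hg'
  obtain ⟨e, f, hs, he, hf⟩ := hyper_exists hb hφ hn U hU hUd
  obtain ⟨e', f', hs', he', hf'⟩ := hyper_exists hb hφ' hn U' hU' hUd'
  have hcd : finrank F V = 2 * ∑ i : Fin n, 1 := by simp [hn]
  have hc := hs.complete_of_card hb isNil_zero hcd
  have hc' := hs'.complete_of_card hb isNil_zero hcd
  obtain ⟨g, hg, -, hge, hgf⟩ := hs.conj hb isNil_zero isNil_zero hc hs' hc'
  refine ⟨g, hg, ?_⟩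
  obtain ⟨u, hu⟩ := hφ.torsor hb (hφ'.map hg)
  have hu0 : u = 0 := by
    apply hc
    rw [mem_perp_gens]
    intro i s
    by_cases hs : s = 0
    · subst hs
      have h1 := hu (e i)
      have h2 := hu (f i)
      simp only [hge, hgf, he, hf, he', hf', zero_add] at h1 h2
      constructor
      · simpa using h1.symm
      · simpa using h2.symm
    · rw [zero_pow hs]; simp
  intro v
  have := hu v
  simp only [hu0] at this
  simpa using this

end plus

section build
variable {F V : Type*} [Field F] [AddCommGroup V] [Module F V]
variable [CharP F 2] {b : V →ₗ[F] V →ₗ[F] F}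

theorem sum_single_two {n : ℕ} (l : Fin n → ℕ) (i : Fin n) (s : ℕ) (g : Fin n → ℕ → V) (c : Fin n → ℕ → F)
    (hc : ∀ j t, c j t = if i = j ∧ s = t then 1 else 0) :
    ∑ j, ∑ t ∈ range (l j), c j t • g j t = if s < l i then g i s else 0 := by
  classical
  rw [Finset.sum_eq_single i]
  · split_ifs with hs
    · rw [Finset.sum_eq_single s]
      · simp [hc]
      · intro t _ ht; simp [hc, ht.symm]
      · intro hh; exact absurd (Finset.mem_range.2 hs) hh
    · refine Finset.sum_eq_zero fun t ht => ?_
      rw [Finset.mem_range] at ht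
      rw [hc, if_neg (by omega), zero_smul]
  · intro j _ hj
    refine Finset.sum_eq_zero fun t ht => ?_
    rw [hc, if_neg (fun h => hj h.1.symm), zero_smul]
  · intro hh; exact absurd (mem_univ _) hh

/-- construction of a nilpotent with given block sizes -/
theorem build [FiniteDimensional F V] (hb : Symp b) {φ : V → F} (hφ0 : φ 0 = 0) {n : ℕ}
    (hn : finrank F V = 2 * n) {e f : Fin n → V}
    (hs : Sys b (0 : End F V) (fun _ => 1) e f) (he : ∀ i, φ (e i) = 0) (hf : ∀ i, φ (f i) = 0)
    (l : Fin n → ℕ) (hl : ∑ i, l i = n) :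
    ∃ (x : End F V) (e' f' : Fin n → V), IsNil b x ∧ Sys b x l e' f' ∧ Complete b x e' f' ∧
      (∀ i s, φ ((x ^ s) (e' i)) = 0) ∧ (∀ i s, φ ((x ^ s) (f' i)) = 0) := by
  classical
  have hcard : Fintype.card (Σ i, Fin (l i)) = n := by simp [Fintype.card_sigma, hl]
  let σ : (Σ i, Fin (l i)) ≃ Fin n := Fintype.equivFinOfCardEq hcard
  let E : Fin n → ℕ → V := fun i s => if h : s < l i then e (σ ⟨i, ⟨s, h⟩⟩) else 0
  let G : Fin n → ℕ → V := fun i s => if h : s < l i then f (σ ⟨i, ⟨s, h⟩⟩) else 0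
  have hE0 : ∀ i s, ¬ s < l i → E i s = 0 := fun i s h => by simp [E, h]
  have hG0 : ∀ i s, ¬ s < l i → G i s = 0 := fun i s h => by simp [G, h]
  have bee : ∀ i j, b (e i) (e j) = 0 := fun i j => by simpa using hs.ee i j 0
  have bff : ∀ i j, b (f i) (f j) = 0 := fun i j => by simpa using hs.ff i j 0
  have bef : ∀ i j, b (e i) (f j) = if i = j then 1 else 0 := fun i j => by
    simpa using hs.pair hb isNil_zero i j 0 0
  have hEE : ∀ i s j t, b (E i s) (E j t) = 0 := by
    intro i s j t
    simp only [E]; split_ifs <;> simp [bee]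
  have hGG : ∀ i s j t, b (G i s) (G j t) = 0 := by
    intro i s j t
    simp only [G]; split_ifs <;> simp [bff]
  have hEG : ∀ i s j t, s < l i → b (E i s) (G j t) = if i = j ∧ s = t then 1 else 0 := by
    intro i s j t hsi
    simp only [E, G]
    rw [dif_pos hsi]
    by_cases htj : t < l j
    · rw [dif_pos htj, bef]
      refine if_congr ?_ rfl rfl
      rw [σ.injective.eq_iff]
      constructor
      · intro h
        simp only [Sigma.mk.injEq] at h
        obtain ⟨rfl, h⟩ := h
        have := eq_of_heq h
        simp only [Fin.mk.injEq] at this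
        exact ⟨rfl, this⟩
      · rintro ⟨rfl, rfl⟩; rfl
    · rw [dif_neg htj, if_neg, map_zero]
      rintro ⟨rfl, rfl⟩; exact htj hsi
  let x : End F V := ∑ i, ∑ s ∈ range (l i - 1), ((b.flip (G i s)).smulRight (E i (s + 1)) +
    (b.flip (E i (s + 1))).smulRight (G i s))
  have hxv : ∀ v, x v = ∑ i, ∑ s ∈ range (l i - 1), b v (G i s) • E i (s + 1) +
      ∑ i, ∑ s ∈ range (l i - 1), b v (E i (s + 1)) • G i s := by
    intro v
    simp only [x, LinearMap.sum_apply, LinearMap.add_apply, LinearMap.smulRight_apply,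
      LinearMap.flip_apply, Finset.sum_add_distrib]
  have hxalt : ∀ v, b (x v) v = 0 := by
    intro v
    rw [hxv]
    simp only [map_add, map_sum, LinearMap.add_apply, LinearMap.sum_apply, map_smul,
      LinearMap.smul_apply, smul_eq_mul]
    have : ∀ i s, b v (G i s) * b (E i (s + 1)) v = b v (E i (s + 1)) * b (G i s) v := by
      intro i s
      rw [hb.symm v (G i s), hb.symm v (E i (s + 1))]; ring
    simp only [this]
    exact CharTwo.add_self_eq_zero _
  have hxE : ∀ i s, x (E i s) = E i (s + 1) := by
    intro i s
    by_cases hsi : s < l i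
    · rw [hxv]
      simp only [hEE, zero_smul, Finset.sum_const_zero, add_zero]
      rw [sum_single_two (fun j => l j - 1) i s (fun j t => E j (t + 1)) _
        (fun j t => hEG i s j t hsi)]
      split_ifs with h
      · rfl
      · rw [hE0]; omega
    · rw [hE0 i s hsi, hE0 i (s + 1) (by omega), map_zero]
  have hxG : ∀ i s, s + 1 < l i → x (G i (s + 1)) = G i s := by
    intro i s hsi
    rw [hxv]
    simp only [hGG, zero_smul, Finset.sum_const_zero, zero_add]
    have hc : ∀ (j : Fin n), ∀ t ∈ range (l j - 1), b (G i (s + 1)) (E j (t + 1)) • G j t =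
        (if i = j ∧ s = t then (1 : F) else 0) • G j t := by
      intro j t ht
      rw [Finset.mem_range] at ht
      rw [hb.symm, hEG j (t + 1) i (s + 1) (by omega)]
      congr 1
      refine if_congr ?_ rfl rfl
      constructor
      · rintro ⟨rfl, h⟩; exact ⟨rfl, by omega⟩
      · rintro ⟨rfl, h⟩; exact ⟨rfl, by omega⟩
    rw [Finset.sum_congr rfl (fun j _ => Finset.sum_congr rfl (hc j))]
    rw [sum_single_two (fun j => l j - 1) i s G _ (fun j t => rfl), if_pos (by omega)]
  have hxG0 : ∀ i, x (G i 0) = 0 := by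
    intro i
    rw [hxv]
    simp only [hGG, zero_smul, Finset.sum_const_zero, zero_add]
    refine Finset.sum_eq_zero fun j _ => Finset.sum_eq_zero fun t ht => ?_
    rw [Finset.mem_range] at ht
    rw [hb.symm, hEG j (t + 1) i 0 (by omega), if_neg (by omega), zero_smul]
  have hxsE : ∀ i s t, (x ^ s) (E i t) = E i (t + s) := by
    intro i s
    induction s with
    | zero => simp
    | succ s ih =>
      intro t
      rw [pow_succ, Module.End.mul_apply, hxE, ih]
      congr 1; omega
  have hxsG : ∀ i s t, t < l i → (x ^ s) (G i t) = if s ≤ t then G i (t - s) else 0 := by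
    intro i s
    induction s with
    | zero => simp
    | succ s ih =>
      intro t ht
      rw [pow_succ, Module.End.mul_apply]
      rcases t with _ | t
      · rw [hxG0, map_zero, if_neg (by omega)]
      · rw [hxG i t ht, ih t (by omega)]
        simp
  have hnil : IsNilpotent x := by
    refine ⟨n + 1, ?_⟩
    have hln : ∀ i, l i ≤ n := fun i => by
      rw [← hl]; exact Finset.single_le_sum (f := l) (fun _ _ => Nat.zero_le _) (mem_univ i)
    have hcd : finrank F V = 2 * ∑ i : Fin n, 1 := by simp [hn]
    have hc := hs.complete_of_card hb isNil_zero hcd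
    have he' : ∀ k, (x ^ (n + 1)) (e k) = 0 := by
      intro k
      obtain ⟨⟨i, s⟩, rfl⟩ := σ.surjective k
      have : e (σ ⟨i, s⟩) = E i s := by simp [E]
      rw [this, hxsE, hE0]
      have := hln i; omega
    have hf' : ∀ k, (x ^ (n + 1)) (f k) = 0 := by
      intro k
      obtain ⟨⟨i, s⟩, rfl⟩ := σ.surjective k
      have : f (σ ⟨i, s⟩) = G i s := by simp [G]
      rw [this, hxsG i _ _ s.2, if_neg]
      have := hln i; have := s.2; omega
    ext v
    rw [hs.expand hb isNil_zero hc v]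
    simp [pr, he', hf']
  have hx : IsNil b x := ⟨hxalt, hnil⟩
  have hxf : ∀ i s, (x ^ s) (G i (l i - 1)) = if s < l i then G i (l i - 1 - s) else 0 := by
    intro i s
    by_cases h0 : l i = 0
    · rw [hG0 i _ (by omega)]; simp [h0]
    · rw [hxsG i s _ (by omega)]
      refine if_congr (by omega) rfl rfl
  have hsys : Sys b x l (fun i => E i 0) (fun i => G i (l i - 1)) := by
    refine Sys.mk' ?_ ?_ ?_ ?_ ?_
    · intro i; rw [hxsE, hE0]; omega
    · intro i; rw [hxf, if_neg (lt_irrefl _)]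
    · intro i j s; rw [hxsE, hEE]
    · intro i j s; rw [hxf]; split_ifs <;> simp [hGG]
    · intro i j s
      rw [hxsE, zero_add]
      by_cases hsi : s < l i
      · rw [hEG i s j _ hsi]
        refine if_congr ?_ rfl rfl
        constructor
        · rintro ⟨rfl, h⟩; exact ⟨rfl, by omega⟩
        · rintro ⟨rfl, h⟩; exact ⟨rfl, by omega⟩
      · rw [hE0 i s hsi, if_neg (by omega)]; simp
  refine ⟨x, _, _, hx, hsys, hsys.complete_of_card hb hx (by rw [hn, hl]), ?_, ?_⟩
  · intro i s
    rw [hxsE]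
    simp only [E]; split_ifs
    · exact he _
    · exact hφ0
  · intro i s
    rw [hxf]
    split_ifs
    · simp only [G]; split_ifs
      · exact hf _
      · exact hφ0
    · exact hφ0

end build
end NilOrb

namespace NilOrb
section fourier
variable {F V : Type*} [Field F] [AddCommGroup V] [Module F V]
variable [CharP F 2] {b : V →ₗ[F] V →ₗ[F] F} {x : End F V} {χ : F → ℚ}

theorem Msub_map {n : ℕ} {α β : Fin n → ℕ} {v : V} {x' : End F V} {g : V ≃ₗ[F] V}
    (hg : Spg b g) (hgx : ∀ v, g (x v) = x' (g v)) :
    g v ∈ Msub b x' α β ↔ v ∈ Msub b x α β := by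
  rw [mem_Msub, mem_Msub]
  constructor
  · intro h i y hy
    have := h i (g y) (by rw [← comm_pow hgx, hy, map_zero])
    rwa [← comm_pow hgx, hg] at this
  · intro h i y hy
    obtain ⟨y, rfl⟩ := g.surjective y
    rw [← comm_pow hgx] at hy ⊢
    rw [hg]
    exact h i y (by simpa using hy)

/-- nilpotent elements -/
abbrev Nn (b : V →ₗ[F] V →ₗ[F] F) := {x : End F V // IsNil b x}

/-- bipartitions -/
abbrev Bp (n : ℕ) := {p : (Fin n → ℕ) × (Fin n → ℕ) //
  Antitone p.1 ∧ Antitone p.2 ∧ ∑ i, (p.1 i + p.2 i) = n}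

instance Bp.finite (n : ℕ) : Finite (Bp n) := by
  refine Set.Finite.subset ((Set.finite_Icc (0 : Fin n → ℕ) (fun _ => n)).prod
    (Set.finite_Icc (0 : Fin n → ℕ) (fun _ => n))) ?_
  rintro ⟨p, r⟩ ⟨-, -, h⟩
  have key : ∀ i, p i + r i ≤ n := by
    intro i
    have := Finset.single_le_sum (f := fun i => p i + r i) (fun _ _ => Nat.zero_le _)
      (Finset.mem_univ i)
    exact this.trans h.le
  exact ⟨⟨fun i => Nat.zero_le _, fun i => (Nat.le_add_right _ _).trans (key i)⟩,
    ⟨fun i => Nat.zero_le _, fun i => (Nat.le_add_left _ _).trans (key i)⟩⟩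

/-- swap -/
def Bp.sw {n : ℕ} (p : Bp n) : Bp n :=
  ⟨(p.1.2, p.1.1), p.2.2.1, p.2.1, 
    (Finset.sum_congr rfl fun i _ => add_comm _ _).trans p.2.2.2⟩

/-- equivalence of pairs -/
def PRel (b : V →ₗ[F] V →ₗ[F] F) (p p' : Nn b × Qs b) : Prop :=
  ∃ g : V ≃ₗ[F] V, Spg b g ∧ (∀ v, g (p.1.1 v) = p'.1.1 (g v)) ∧ ∀ v, p'.2.1 (g v) = p.2.1 v

/-- setoid of pairs -/
def pset (b : V →ₗ[F] V →ₗ[F] F) : Setoid (Nn b × Qs b) where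
  r := PRel b
  iseqv := by
    refine ⟨fun p => ⟨LinearEquiv.refl F V, fun _ _ => rfl, fun _ => rfl, fun _ => rfl⟩, ?_, ?_⟩
    · rintro p p' ⟨g, hg, h1, h2⟩
      refine ⟨g.symm, hg.inv, fun v => ?_, fun v => ?_⟩
      · rw [LinearEquiv.symm_apply_eq, h1, LinearEquiv.apply_symm_apply]
      · rw [← h2, LinearEquiv.apply_symm_apply]
    · rintro p p' p'' ⟨g, hg, h1, h2⟩ ⟨g', hg', h1', h2'⟩
      refine ⟨g.trans g', hg.trans hg', fun v => ?_, fun v => ?_⟩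
      · simp [h1, h1']
      · simp [h2, h2']

/-- orbits of pairs -/
abbrev Ob (b : V →ₗ[F] V →ₗ[F] F) := Quotient (pset b)

/-- class of a pair -/
abbrev cls (x : Nn b) (φ : Qs b) : Ob b := Quotient.mk (pset b) (x, φ)

/-- pulling back a form -/
def Qs.pull (φ : Qs b) {g : V ≃ₗ[F] V} (hg : Spg b g) : Qs b := ⟨_, φ.2.map hg⟩

/-- pulling back as an equivalence -/
def Qs.pullEquiv {g : V ≃ₗ[F] V} (hg : Spg b g) : Qs b ≃ Qs b where
  toFun φ := φ.pull hg
  invFun φ := φ.pull hg.inv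
  left_inv φ := Subtype.ext (funext fun v => by simp [Qs.pull])
  right_inv φ := Subtype.ext (funext fun v => by simp [Qs.pull])

theorem cls_pull {x x' : Nn b} {φ : Qs b} {g : V ≃ₗ[F] V} (hg : Spg b g)
    (hgx : ∀ v, g (x.1 v) = x'.1 (g v)) : cls x (φ.pull hg) = cls x' φ :=
  Quotient.sound (s := pset b) ⟨g, hg, hgx, fun _ => rfl⟩

variable [Fintype F] [Fintype V] {n : ℕ}

noncomputable instance : Fintype (Qs b) := Fintype.ofFinite _

theorem orthQ (h : Chi χ) (hb : Symp b) (φ φ' : Qs b) [Decidable (φ = φ')] :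
    ∑ v, χ (φ.1 v) * χ (φ'.1 v) = if φ = φ' then (Fintype.card V : ℚ) else 0 := by
  classical
  have := Module.Finite.of_finite (R := F) (M := V)
  obtain ⟨u, hu⟩ := φ.2.torsor hb φ'.2
  have h1 : ∀ v, χ (φ.1 v) * χ (φ'.1 v) = χ (b u v) := by
    intro v
    rw [hu, h.add, ← mul_assoc, h.mul_self, one_mul, h.sq]
  simp only [h1, h.sum_all hb]
  have : u = 0 ↔ φ = φ' := by
    constructor
    · rintro rfl
      exact Subtype.ext (funext fun v => by rw [hu]; simp)
    · rintro rfl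
      refine hb.nd u fun v => ?_
      have := hu v
      simpa using this
  simp only [this]

theorem orthV (h : Chi χ) (hb : Symp b) (v w : V) [Decidable (v = w)] :
    ∑ φ : Qs b, χ (φ.1 v) * χ (φ.1 w) =
      if v = w then (Fintype.card (Qs b) : ℚ) else 0 := by
  classical
  have := Module.Finite.of_finite (R := F) (M := V)
  split_ifs with hvw
  · subst hvw; simp [h.mul_self]
  · by_cases hne : Nonempty (Qs b)
    · obtain ⟨φ⟩ := hne
      rw [← Equiv.sum_comp (qsEquiv hb φ)]
      have : ∀ u, χ ((qsEquiv hb φ u).1 v) * χ ((qsEquiv hb φ u).1 w) =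
          (χ (φ.1 v) * χ (φ.1 w)) * χ (b (v - w) u) := by
        intro u
        rw [qsEquiv_apply, qsEquiv_apply, h.add, h.add, h.sq, h.sq, map_sub, LinearMap.sub_apply,
          CharTwo.sub_eq_add, h.add, hb.symm v, hb.symm w]
        ring
      simp only [this, ← Finset.mul_sum, h.sum_all hb, if_neg (sub_ne_zero.2 hvw), mul_zero]
    · have : IsEmpty (Qs b) := not_nonempty_iff.1 hne
      simp

theorem card_Qs (hb : Symp b) (φ : Qs b) : Fintype.card (Qs b) = Fintype.card V := by
  have := Module.Finite.of_finite (R := F) (M := V)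
  exact (Fintype.card_congr (qsEquiv hb φ)).symm

/-- data of types and representatives -/
structure TyData (b : V →ₗ[F] V →ₗ[F] F) (n : ℕ) where
  ty : Nn b → V → Bp n
  hty : ∀ x v, HasType b x.1 v (ty x v).1.1 (ty x v).1.2
  rx : Bp n → Nn b
  rv : Bp n → V
  hr : ∀ p, ty (rx p) (rv p) = p

theorem tyData_exists (h : Chi χ) (hb : Symp b) (hn : finrank F V = 2 * n) {φ : V → F}
    (hφ : IsQ b φ) (hg : gs χ φ = (Fintype.card F : ℚ) ^ n) : Nonempty (TyData b n) := by
  have := Module.Finite.of_finite (R := F) (M := V)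
  have h1 : ∀ (x : Nn b) (v : V), ∃ p : Bp n, HasType b x.1 v p.1.1 p.1.2 := by
    intro x v
    obtain ⟨α, β, h⟩ := type_exists hb x.2 hn v
    have hh := h
    obtain ⟨hα, hβ, e, f, hs, hc, -⟩ := hh
    have := hs.card_eq hb x.2 hc
    exact ⟨⟨(α, β), hα, hβ, by
      simp only [Pi.add_apply] at this ⊢; omega⟩, h⟩
  choose ty hty using h1
  have h2 : ∀ p : Bp n, ∃ (x : Nn b) (v : V), HasType b x.1 v p.1.1 p.1.2 := by
    intro p
    obtain ⟨U, hU, hUd⟩ := ts_of_gs h hb hφ hn hg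
    obtain ⟨e, f, hs, he, hf⟩ := hyper_exists hb hφ hn U hU hUd
    obtain ⟨x, e', f', hx, hs', hc, -, -⟩ := build hb hφ.zero hn hs he hf (p.1.1 + p.1.2) p.2.2.2
    exact ⟨⟨x, hx⟩, _, p.2.1, p.2.2.1, e', f', hs', hc, rfl⟩
  choose rx rv hr using h2
  refine ⟨⟨ty, hty, rx, rv, fun p => ?_⟩⟩
  have := (hty (rx p) (rv p)).unique hb (rx p).2 (hr p)
  exact Subtype.ext (Prod.ext this.1 this.2)

namespace TyData
variable (T : TyData b n)

theorem ty_eq (hb : Symp b) {x : Nn b} {v : V} {p : Bp n} (h : HasType b x.1 v p.1.1 p.1.2) :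
    T.ty x v = p := by
  have := (T.hty x v).unique hb x.2 h
  exact Subtype.ext (Prod.ext this.1 this.2)

theorem ty_map (hb : Symp b) {x x' : Nn b} {v : V} {g : V ≃ₗ[F] V} (hg : Spg b g)
    (hgx : ∀ v, g (x.1 v) = x'.1 (g v)) : T.ty x' (g v) = T.ty x v :=
  T.ty_eq hb ((T.hty x v).map hg hgx)

theorem conj (hb : Symp b) {x x' : Nn b} {v v' : V} (h : T.ty x v = T.ty x' v') :
    ∃ g : V ≃ₗ[F] V, Spg b g ∧ (∀ v, g (x.1 v) = x'.1 (g v)) ∧ g v = v' := by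
  have h1 := T.hty x v
  rw [h] at h1
  exact h1.conj hb x.2 x'.2 (T.hty x' v')

/-- Fourier transform -/
noncomputable def Psi (χ : F → ℚ) : (Ob b → ℚ) →ₗ[ℚ] (Bp n → ℚ) where
  toFun k p := ∑ φ : Qs b, k (cls (T.rx p) φ) * χ (φ.1 (T.rv p))
  map_add' k k' := by
    ext p
    simp [add_mul, Finset.sum_add_distrib]
  map_smul' a k := by
    ext p
    simp [Finset.mul_sum, mul_assoc]

theorem Psi_ty (hb : Symp b) (k : Ob b → ℚ) (x : Nn b) (v : V) :
    T.Psi χ k (T.ty x v) = ∑ φ : Qs b, k (cls x φ) * χ (φ.1 v) := by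
  obtain ⟨g, hg, hgx, hgv⟩ := T.conj hb (T.hr (T.ty x v))
  rw [← Equiv.sum_comp (Qs.pullEquiv hg.inv)]
  show ∑ φ : Qs b, _ = _
  refine Finset.sum_congr rfl fun φ _ => ?_
  have h1 : cls x (Qs.pullEquiv hg.inv φ) = cls (T.rx (T.ty x v)) φ := by
    refine cls_pull hg.inv fun v => ?_
    rw [LinearEquiv.symm_apply_eq, hgx, LinearEquiv.apply_symm_apply]
  have h2 : (Qs.pullEquiv hg.inv φ).1 v = φ.1 (T.rv (T.ty x v)) := by
    show φ.1 (g.symm v) = _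
    rw [(LinearEquiv.symm_apply_eq g).2 hgv.symm]
  rw [h1, h2]

/-- inverse Fourier transform -/
noncomputable def The (hb : Symp b) (χ : F → ℚ) : (Bp n → ℚ) →ₗ[ℚ] (Ob b → ℚ) where
  toFun k := Quotient.lift (fun p : Nn b × Qs b =>
      (Fintype.card V : ℚ)⁻¹ * ∑ v, k (T.ty p.1 v) * χ (p.2.1 v)) (by
    rintro p p' ⟨g, hg, hgx, hgv⟩
    rw [← Equiv.sum_comp g.toEquiv (fun v => k (T.ty p'.1 v) * χ (p'.2.1 v))]
    congr 1
    refine Finset.sum_congr rfl fun v _ => ?_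
    show _ = k (T.ty p'.1 (g v)) * χ (p'.2.1 (g v))
    rw [hgv, T.ty_map hb hg hgx])
  map_add' k k' := by
    ext p
    induction p using Quotient.ind
    simp [add_mul, Finset.sum_add_distrib, mul_add]
  map_smul' a k := by
    ext p
    induction p using Quotient.ind
    simp only [Quotient.lift_mk, Pi.smul_apply, smul_eq_mul, RingHom.id_apply, mul_assoc]
    rw [← Finset.mul_sum]; ring

theorem The_cls (hb : Symp b) (k : Bp n → ℚ) (x : Nn b) (φ : Qs b) :
    T.The hb χ k (cls x φ) = (Fintype.card V : ℚ)⁻¹ * ∑ v, k (T.ty x v) * χ (φ.1 v) := rfl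

theorem cardV_ne : (Fintype.card V : ℚ) ≠ 0 := by
  have : 0 < Fintype.card V := Fintype.card_pos
  positivity

theorem The_Psi (h : Chi χ) (hb : Symp b) (k : Ob b → ℚ) : T.The hb χ (T.Psi χ k) = k := by
  classical
  ext p
  obtain ⟨⟨x, φ⟩, rfl⟩ := Quotient.exists_rep p
  show T.The hb χ (T.Psi χ k) (cls x φ) = k (cls x φ)
  rw [The_cls]
  simp only [T.Psi_ty hb, Finset.sum_mul]
  rw [Finset.sum_comm]
  simp only [mul_assoc, ← Finset.mul_sum, orthQ h hb]
  simp only [mul_ite, mul_zero, Finset.sum_ite_eq', Finset.mem_univ, if_true]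
  rw [mul_comm, mul_assoc, mul_inv_cancel₀ cardV_ne, mul_one]

theorem Psi_The (h : Chi χ) (hb : Symp b) (φ : Qs b) (k : Bp n → ℚ) :
    T.Psi χ (T.The hb χ k) = k := by
  classical
  ext p
  rw [← T.hr p, T.Psi_ty hb]
  simp only [The_cls]
  simp only [mul_assoc, ← Finset.mul_sum, Finset.sum_mul]
  rw [Finset.sum_comm]
  simp only [← Finset.mul_sum, orthV h hb]
  simp only [mul_ite, mul_zero, Finset.sum_ite_eq', Finset.mem_univ, if_true]
  rw [card_Qs hb φ, mul_comm, mul_assoc, mul_inv_cancel₀ cardV_ne, mul_one]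

/-- the linear equivalence -/
noncomputable def equiv (h : Chi χ) (hb : Symp b) (φ : Qs b) : (Bp n → ℚ) ≃ₗ[ℚ] (Ob b → ℚ) where
  __ := T.The hb χ
  invFun := T.Psi χ
  left_inv k := T.Psi_The h hb φ k
  right_inv k := T.The_Psi h hb k

/-- sign of a class -/
noncomputable def sgn (χ : F → ℚ) : Ob b → ℚ :=
  Quotient.lift (fun p : Nn b × Qs b => gs χ p.2.1) (by
    rintro p p' ⟨g, hg, hgx, hgv⟩
    show ∑ v, _ = ∑ v, _
    rw [← Equiv.sum_comp g.toEquiv (fun v => χ (p'.2.1 v))]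
    refine Finset.sum_congr rfl fun v _ => ?_
    show _ = χ (p'.2.1 (g v))
    rw [hgv])

/-- the transform of sgn -/
noncomputable def Phi (χ : F → ℚ) : (Bp n → ℚ) →ₗ[ℚ] (Bp n → ℚ) where
  toFun k p := ∑ w, χ (b (T.rv p) w) * k (T.ty (T.rx p) w)
  map_add' k k' := by
    ext p
    simp [mul_add, Finset.sum_add_distrib]
  map_smul' a k := by
    ext p
    simp only [Pi.smul_apply, smul_eq_mul, RingHom.id_apply, Finset.mul_sum]
    exact Finset.sum_congr rfl fun _ _ => by ring

theorem Phi_ty (hb : Symp b) (k : Bp n → ℚ) (x : Nn b) (v : V) :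
    T.Phi χ k (T.ty x v) = ∑ w, χ (b v w) * k (T.ty x w) := by
  obtain ⟨g, hg, hgx, hgv⟩ := T.conj hb (T.hr (T.ty x v))
  rw [← Equiv.sum_comp g.toEquiv (fun w => χ (b v w) * k (T.ty x w))]
  show ∑ w, _ = _
  refine Finset.sum_congr rfl fun w _ => ?_
  show _ = χ (b v (g w)) * k (T.ty x (g w))
  rw [T.ty_map hb hg hgx, ← hg (T.rv _) w, hgv]

theorem The_Phi (h : Chi χ) (hb : Symp b) (k : Bp n → ℚ) (p : Ob b) :
    T.The hb χ (T.Phi χ k) p = sgn χ p * T.The hb χ k p := by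
  classical
  obtain ⟨⟨x, φ⟩, rfl⟩ := Quotient.exists_rep p
  show T.The hb χ (T.Phi χ k) (cls x φ) = gs χ φ.1 * T.The hb χ k (cls x φ)
  rw [The_cls, The_cls]
  simp only [T.Phi_ty hb, Finset.sum_mul]
  rw [Finset.sum_comm, mul_left_comm]
  congr 1
  rw [Finset.mul_sum]
  refine Finset.sum_congr rfl fun w _ => ?_
  have : ∑ v, χ (b v w) * k (T.ty x w) * χ (φ.1 v) =
      ∑ v, (k (T.ty x w) * χ (φ.1 w)) * χ (φ.1 (v + w)) := by
    refine Finset.sum_congr rfl fun v _ => ?_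
    rw [φ.2.add, h.add, h.add]
    linear_combination (-χ (b v w) * k (T.ty x w) * χ (φ.1 v)) * h.mul_self (φ.1 w)
  have h2 : ∑ v, χ (φ.1 (v + w)) = gs χ φ.1 :=
    Equiv.sum_comp (Equiv.addRight w) (fun v => χ (φ.1 v))
  rw [this, ← Finset.mul_sum, h2]
  ring

end TyData
end fourier
end NilOrb

namespace NilOrb
section trace
variable {F V : Type*} [Field F] [AddCommGroup V] [Module F V]
variable [CharP F 2] {b : V →ₗ[F] V →ₗ[F] F} {x : End F V} {χ : F → ℚ}

noncomputable instance (n : ℕ) : Fintype (Bp n) := Fintype.ofFinite _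

open Classical in
/-- triangular basis -/
noncomputable def cb {n : ℕ} (p : Bp n) : Bp n → ℚ := fun r =>
  if p.1.1 + p.1.2 = r.1.1 + r.1.2 ∧ p.1.1 ≤ r.1.1 then 1 else 0

theorem cb_span {n : ℕ} : ⊤ ≤ Submodule.span ℚ (Set.range (cb (n := n))) := by
  classical
  have key : ∀ (m : ℕ) (p : Bp n), n ≤ ∑ i, p.1.1 i + m →
      (Pi.single p 1 : Bp n → ℚ) ∈ Submodule.span ℚ (Set.range (cb (n := n))) := by
    intro m
    induction m using Nat.strong_induction_on with
    | _ m ih =>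
    intro p hp
    have hsum : cb p = ∑ r, cb p r • (Pi.single r 1 : Bp n → ℚ) := by
      ext t
      simp [Finset.sum_apply, Pi.single_apply]
    have hpp : cb p p = 1 := by simp [cb]
    rw [← Finset.add_sum_erase _ _ (Finset.mem_univ p), hpp, one_smul] at hsum
    rw [← sub_eq_iff_eq_add] at hsum
    rw [← hsum]
    refine Submodule.sub_mem _ (Submodule.subset_span ⟨p, rfl⟩) (Submodule.sum_mem _ ?_)
    intro r hr
    by_cases hc : p.1.1 + p.1.2 = r.1.1 + r.1.2 ∧ p.1.1 ≤ r.1.1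
    · refine Submodule.smul_mem _ _ ?_
      have hne : p.1.1 ≠ r.1.1 := by
        intro h
        have h2 : p.1.2 = r.1.2 := by
          have := hc.1
          rw [h] at this
          exact add_left_cancel this
        exact (Finset.ne_of_mem_erase hr) (Subtype.ext (Prod.ext h h2)).symm
      have hlt : ∑ i, p.1.1 i < ∑ i, r.1.1 i := by
        obtain ⟨i, hi⟩ : ∃ i, p.1.1 i ≠ r.1.1 i := by
          by_contra hcon
          push Not at hcon
          exact hne (funext hcon)
        exact Finset.sum_lt_sum (fun i _ => hc.2 i) ⟨i, Finset.mem_univ i,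
          lt_of_le_of_ne (hc.2 i) hi⟩
      have hle : ∑ i, r.1.1 i ≤ n := by
        have := r.2.2.2
        rw [Finset.sum_add_distrib] at this
        omega
      refine ih (n - ∑ i, r.1.1 i) (by omega) r (by omega)
    · simp [cb, hc]
  intro k _
  have : k = ∑ r, k r • (Pi.single r 1 : Bp n → ℚ) := by
    ext t
    simp [Finset.sum_apply, Pi.single_apply]
  rw [this]
  exact Submodule.sum_mem _ fun r _ => Submodule.smul_mem _ _ (key n r (by omega))

/-- the triangular basis -/
noncomputable def cbB (n : ℕ) : Basis (Bp n) ℚ (Bp n → ℚ) :=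
  basisOfTopLeSpanOfCardEqFinrank cb cb_span (by simp)

theorem cbB_apply {n : ℕ} (p : Bp n) : cbB n p = cb p := by
  simp [cbB]

theorem card_Msub_diag [Fintype F] [Fintype V] {n : ℕ} (hb : Symp b) (hn : finrank F V = 2 * n)
    (hx : IsNil b x) {α : Fin n → ℕ} (hα : Antitone α) {e f : Fin n → V}
    (hs : Sys b x (α + α) e f) (hc : Complete b x e f) :
    finrank F (Msub b x α α) = n := by
  have := Module.Finite.of_finite (R := F) (M := V)
  have h1 := finrank_perp hb (Msub b x α α)
  rw [Msub_perp hα hα hb hx hs hc] at h1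
  omega

variable [Fintype F] [Fintype V] {n : ℕ}

namespace TyData
variable (T : TyData b n)

theorem Phi_cb (h : Chi χ) (hb : Symp b) (hn : finrank F V = 2 * n) (p : Bp n) :
    ∃ κ : ℚ, T.Phi χ (cb p) = κ • cb p.sw ∧ (p.sw = p → κ = (Fintype.card F : ℚ) ^ n) := by
  classical
  have := Module.Finite.of_finite (R := F) (M := V)
  obtain ⟨hα, hβ, e, f, hs, hc, hv⟩ := T.hty (T.rx p) (T.rv p)
  rw [T.hr] at hα hβ hs hv
  refine ⟨Fintype.card (Msub b (T.rx p).1 p.1.1 p.1.2), ?_, ?_⟩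
  · ext r
    rw [← T.hr r, T.Phi_ty hb]
    generalize hx : T.rx r = x
    generalize hvv : T.rv r = v
    have hr : T.ty x v = r := by rw [← hx, ← hvv, T.hr]
    have htv := T.hty x v
    rw [hr] at htv
    by_cases hl : p.1.1 + p.1.2 = r.1.1 + r.1.2
    · have hM : ∀ w, cb p (T.ty x w) = if w ∈ Msub b x.1 p.1.1 p.1.2 then 1 else 0 := by
        intro w
        have htw := T.hty x w
        have hlw := htv.lam_eq hb x.2 htw
        rw [htw.mem_Msub_iff hb x.2 p.2.1 p.2.2.1 (hl.trans hlw)]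
        unfold cb
        simp only [hl.trans hlw, true_and]
      obtain ⟨-, -, e', f', hs', hc', -⟩ := id htv
      rw [← hl] at hs'
      have hcard : Fintype.card (Msub b x.1 p.1.1 p.1.2) =
          Fintype.card (Msub b (T.rx p).1 p.1.1 p.1.2) := by
        obtain ⟨g, hg, hgx, -, -⟩ := hs'.conj hb x.2 (T.rx p).2 hc' hs hc
        exact Fintype.card_congr (g.toEquiv.subtypeEquiv fun v => (Msub_map hg hgx).symm)
      simp only [hM, mul_ite, mul_one, mul_zero]
      have hsub := h.sum_sub hb (Msub b x.1 p.1.1 p.1.2) v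
      rw [Msub_perp p.2.1 p.2.2.1 hb x.2 hs' hc', hcard,
        htv.mem_Msub_iff hb x.2 p.2.2.1 p.2.1 ((add_comm _ _).trans hl)] at hsub
      rw [← Finset.sum_filter]
      have h3 : ∑ w : (Msub b x.1 p.1.1 p.1.2), χ (b v w) =
          ∑ w with w ∈ Msub b x.1 p.1.1 p.1.2, χ (b v w) := by
        rw [← Finset.sum_subtype_eq_sum_filter, Finset.subtype_univ]
      rw [← h3, hsub, hr]
      have hl' : p.1.2 + p.1.1 = r.1.1 + r.1.2 := (add_comm _ _).trans hl
      simp [cb, Bp.sw, hl']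
    · have hM : ∀ w, cb p (T.ty x w) = 0 := by
        intro w
        have htw := T.hty x w
        have hlw := htv.lam_eq hb x.2 htw
        unfold cb
        rw [if_neg]
        rw [← hlw]
        exact fun h => hl h.1
      have hl' : ¬ p.1.2 + p.1.1 = r.1.1 + r.1.2 := fun h => hl ((add_comm _ _).trans h)
      simp only [hM, mul_zero, Finset.sum_const_zero, hr]
      simp [cb, Bp.sw, hl']
  · intro hsw
    have h12 : p.1.2 = p.1.1 := congrArg (fun r => r.1.1) hsw
    rw [h12] at hs ⊢
    rw [Module.card_eq_pow_finrank (K := F), card_Msub_diag hb hn (T.rx p).2 p.2.1 hs hc]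
    simp

instance finEnd : Finite (End F V) := DFunLike.finite _

noncomputable instance : Fintype (Ob b) := Fintype.ofFinite _

theorem card_eq (T : TyData b n) (h : Chi χ) (hb : Symp b) (φ : Qs b) : Fintype.card (Ob b) = Fintype.card (Bp n) := by
  have := (T.equiv h hb φ).finrank_eq
  simpa using this.symm

theorem sum_sgn (T : TyData b n) (h : Chi χ) (hb : Symp b) (hn : finrank F V = 2 * n) (φ : Qs b) :
    ∑ p : Ob b, sgn χ p = (Fintype.card F : ℚ) ^ n * Nat.card {p : Bp n // p.sw = p} := by
  classical
  let L : (Ob b → ℚ) →ₗ[ℚ] (Ob b → ℚ) := LinearMap.mulLeft ℚ (sgn χ)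
  have hL : (T.equiv h hb φ).conj (T.Phi χ) = L := by
    refine LinearMap.ext fun k => ?_
    rw [LinearEquiv.conj_apply_apply]
    show T.The hb χ (T.Phi χ (T.Psi χ k)) = sgn χ * k
    ext p
    rw [T.The_Phi h hb, T.The_Psi h hb]
    rfl
  have h1 : LinearMap.trace ℚ _ L = LinearMap.trace ℚ _ (T.Phi χ) := by
    rw [← hL, LinearMap.trace_conj']
  have h2 : LinearMap.trace ℚ _ L = ∑ p : Ob b, sgn χ p := by
    rw [LinearMap.trace_eq_matrix_trace ℚ (Pi.basisFun ℚ (Ob b))]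
    simp only [Matrix.trace, Matrix.diag_apply, LinearMap.toMatrix_apply]
    refine Finset.sum_congr rfl fun p _ => ?_
    simp [L]
  have h3 : LinearMap.trace ℚ _ (T.Phi χ) =
      ∑ p : Bp n, if p.sw = p then (Fintype.card F : ℚ) ^ n else 0 := by
    rw [LinearMap.trace_eq_matrix_trace ℚ (cbB n)]
    simp only [Matrix.trace, Matrix.diag_apply, LinearMap.toMatrix_apply]
    refine Finset.sum_congr rfl fun p _ => ?_
    obtain ⟨κ, h4, h5⟩ := T.Phi_cb h hb hn p
    rw [cbB_apply, h4, ← cbB_apply, map_smul, Basis.repr_self, Finsupp.smul_apply,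
      Finsupp.single_apply]
    split_ifs with hp
    · simp [h5 hp]
    · simp
  rw [← h2, h1, h3, ← Finset.sum_filter, Finset.sum_const, Nat.card_eq_fintype_card,
    Fintype.card_subtype, nsmul_eq_mul, mul_comm]

theorem card_plus (T : TyData b n) (h : Chi χ) (hb : Symp b) (hn : finrank F V = 2 * n) (φ : Qs b) :
    2 * Nat.card {p : Ob b // sgn χ p = (Fintype.card F : ℚ) ^ n} =
      Nat.card (Bp n) + Nat.card {p : Bp n // p.sw = p} := by
  classical
  have hs := T.sum_sgn h hb hn φ
  have hc := T.card_eq h hb φ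
  have hq : (Fintype.card F : ℚ) ^ n ≠ 0 := by
    have : 0 < Fintype.card F := Fintype.card_pos
    positivity
  have hpm : ∀ p : Ob b, sgn χ p + (Fintype.card F : ℚ) ^ n =
      if sgn χ p = (Fintype.card F : ℚ) ^ n then 2 * (Fintype.card F : ℚ) ^ n else 0 := by
    intro p
    have : sgn χ p = (Fintype.card F : ℚ) ^ n ∨ sgn χ p = -(Fintype.card F : ℚ) ^ n := by
      obtain ⟨⟨x, φ⟩, rfl⟩ := Quotient.exists_rep p
      exact gs_pm h hb φ.2 hn
    split_ifs with h1
    · rw [h1]; ring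
    · rcases this with h2 | h2
      · exact absurd h2 h1
      · rw [h2]; ring
  have h1 := Finset.sum_congr (rfl : (Finset.univ : Finset (Ob b)) = _) fun p _ => hpm p
  rw [Finset.sum_add_distrib, hs, ← Finset.sum_filter] at h1
  simp only [Finset.sum_const, nsmul_eq_mul, Finset.card_univ, hc] at h1
  have h2 : (2 : ℚ) * (Nat.card {p : Ob b // sgn χ p = (Fintype.card F : ℚ) ^ n} : ℕ) =
      (Nat.card (Bp n) : ℕ) + (Nat.card {p : Bp n // p.sw = p} : ℕ) := by
    rw [Nat.card_eq_fintype_card (α := {p : Ob b // sgn χ p = (Fintype.card F : ℚ) ^ n}),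
      Fintype.card_subtype, Nat.card_eq_fintype_card (α := Bp n)]
    apply mul_left_cancel₀ hq
    linear_combination -h1
  exact_mod_cast h2

end TyData
end trace
end NilOrb

namespace NilOrb
section dickson
variable {F V : Type*} [Field F] [AddCommGroup V] [Module F V]
variable [CharP F 2] {b : V →ₗ[F] V →ₗ[F] F}

theorem Symp.even [FiniteDimensional F V] (hb : Symp b) : Even (finrank F V) := by
  obtain ⟨l, a, e, f, hr, hc⟩ := raw_exists hb (isNil_zero (b := b)) (finrank F V) (by omega) 0
  rw [hr.sys.card_eq hb isNil_zero hc]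
  exact even_two_mul _

theorem alt_symm {B : V →ₗ[F] V →ₗ[F] F} (hB : ∀ v, B v v = 0) (v w : V) : B v w = B w v := by
  have h := hB (v + w)
  simp only [map_add, LinearMap.add_apply, hB, zero_add, add_zero] at h
  exact CharTwo.add_eq_zero.1 ((add_comm _ _).trans h)

theorem even_of_alt [FiniteDimensional F V] (B : V →ₗ[F] V →ₗ[F] F) (hB : ∀ v, B v v = 0) :
    Even (finrank F V + finrank F (LinearMap.ker B)) := by
  obtain ⟨C, hC⟩ := Submodule.exists_isCompl (LinearMap.ker B)
  have hS : Symp (B.compl₁₂ C.subtype C.subtype) := by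
    constructor
    · intro v; exact hB v
    · intro v hv
      have h1 : (v : V) ∈ LinearMap.ker B := by
        rw [LinearMap.mem_ker]
        ext w
        have : w ∈ LinearMap.ker B ⊔ C := by rw [hC.sup_eq_top]; trivial
        obtain ⟨k, hk, c, hc, rfl⟩ := Submodule.mem_sup.1 this
        rw [map_add, alt_symm hB (v : V) k, LinearMap.mem_ker.1 hk]
        have := hv ⟨c, hc⟩
        simpa using this
      have : (v : V) ∈ LinearMap.ker B ⊓ C := ⟨h1, v.2⟩
      rw [hC.inf_eq_bot, Submodule.mem_bot] at this
      exact Subtype.ext this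
  have h1 := hS.even
  have h2 := Submodule.finrank_add_eq_of_isCompl hC
  rw [← h2]
  have : finrank F (LinearMap.ker B) + finrank F C + finrank F (LinearMap.ker B) =
    finrank F C + 2 * finrank F (LinearMap.ker B) := by ring
  rw [this]
  exact h1.add (even_two_mul _)

theorem perp_perp [FiniteDimensional F V] (hb : Symp b) (W : Submodule F V) :
    perp b (perp b (W : Set V) : Set V) = W := by
  symm
  apply Submodule.eq_of_le_of_finrank_eq
  · intro w hw y hy
    rw [hb.symm]; exact hy w hw
  · have h1 := finrank_perp hb W
    have h2 := finrank_perp hb (perp b (W : Set V))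
    omega

theorem perp_sup (W X : Submodule F V) :
    perp b ((W ⊔ X : Submodule F V) : Set V) = perp b (W : Set V) ⊓ perp b (X : Set V) := by
  ext z
  rw [Submodule.mem_inf, mem_perp, mem_perp, mem_perp]
  constructor
  · intro h
    exact ⟨fun y hy => h y (Submodule.mem_sup_left hy), fun y hy => h y (Submodule.mem_sup_right hy)⟩
  · rintro ⟨h1, h2⟩ y hy
    obtain ⟨w, hw, x, hx, rfl⟩ := Submodule.mem_sup.1 hy
    rw [map_add, h1 w hw, h2 x hx, add_zero]

theorem three_lagr [FiniteDimensional F V] (hb : Symp b) {φ : V → F} (hφ : IsQ b φ) {N : ℕ}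
    (hN : finrank F V = 2 * N) (U W X : Submodule F V)
    (hU : ∀ u ∈ U, φ u = 0) (hW : ∀ u ∈ W, φ u = 0) (hX : ∀ u ∈ X, φ u = 0)
    (dU : finrank F U = N) (dW : finrank F W = N) (dX : finrank F X = N) :
    Even (N + finrank F (W ⊓ X : Submodule F V) + finrank F (U ⊓ W : Submodule F V) +
      finrank F (U ⊓ X : Submodule F V)) := by
  have pU := perp_eq hb (le_perp hφ hU) hN dU
  have pW := perp_eq hb (le_perp hφ hW) hN dW
  have pX := perp_eq hb (le_perp hφ hX) hN dX
  obtain ⟨p, hpW, hpX⟩ : ∃ p : (W ⊔ X : Submodule F V) →ₗ[F] V,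
      (∀ u, p u ∈ W) ∧ ∀ u : (W ⊔ X : Submodule F V), (u : V) - p u ∈ X := by
    let s : W × X →ₗ[F] (W ⊔ X : Submodule F V) :=
      LinearMap.coprod (Submodule.inclusion le_sup_left) (Submodule.inclusion le_sup_right)
    have hs : LinearMap.range s = ⊤ := by
      rw [LinearMap.range_eq_top]
      rintro ⟨u, hu⟩
      obtain ⟨w, hw, x, hx, rfl⟩ := Submodule.mem_sup.1 hu
      exact ⟨(⟨w, hw⟩, ⟨x, hx⟩), Subtype.ext (by simp [s])⟩
    obtain ⟨r, hr⟩ := LinearMap.exists_rightInverse_of_surjective s hs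
    refine ⟨W.subtype ∘ₗ LinearMap.fst F W X ∘ₗ r, fun u => (r u).1.2, fun u => ?_⟩
    have h1 : s (r u) = u := by
      have := LinearMap.congr_fun hr u
      simpa using this
    have h2 : (u : V) = (r u).1 + (r u).2 := by
      conv_lhs => rw [← h1]
      simp [s]
    have : (u : V) - (W.subtype ∘ₗ LinearMap.fst F W X ∘ₗ r) u = (r u).2 := by
      rw [h2]; simp
    rw [this]
    exact (r u).2.2
  set K : Submodule F V := U ⊓ (W ⊔ X) with hK
  set Y : Submodule F V := U ⊔ (W ⊓ X) with hY
  have pY : perp b (Y : Set V) = K := by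
    rw [hY, perp_sup, pU]
    have : W ⊓ X = perp b ((W ⊔ X : Submodule F V) : Set V) := by rw [perp_sup, pW, pX]
    rw [this, perp_perp hb]
  have pK : perp b (K : Set V) = Y := by rw [← pY, perp_perp hb]
  let ι : K →ₗ[F] (W ⊔ X : Submodule F V) := Submodule.inclusion inf_le_right
  let B : K →ₗ[F] K →ₗ[F] F := b.compl₁₂ (p ∘ₗ ι) K.subtype
  have hBa : ∀ u u' : K, B u u' = b (p (ι u)) u' := fun u u' => rfl
  have hιv : ∀ u : K, (ι u : V) = u := fun u => rfl
  have hdec : ∀ u : K, ∃ w ∈ W, ∃ x ∈ X, (u : V) = w + x ∧ p (ι u) = w := by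
    intro u
    refine ⟨p (ι u), hpW _, _, hpX (ι u), ?_, rfl⟩
    rw [hιv]; abel
  have hB : ∀ u, B u u = 0 := by
    intro u
    obtain ⟨w, hw, x, hx, h1, h2⟩ := hdec u
    rw [hBa, h2, h1, map_add, hφ.lin hW hw hw, zero_add]
    have := hφ.add w x
    rw [← h1, hU u u.2.1, hW w hw, hX x hx] at this
    simpa using this.symm
  have hev := even_of_alt B hB
  have hker : Submodule.map K.subtype (LinearMap.ker B) = (U ⊓ W) ⊔ (U ⊓ X) := by
    ext v
    rw [Submodule.mem_map, Submodule.mem_sup]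
    constructor
    · rintro ⟨u, hu, rfl⟩
      obtain ⟨w, hw, x, hx, h1, h2⟩ := hdec u
      have hwp : w ∈ perp b (K : Set V) := by
        intro y hy
        have := LinearMap.congr_fun (LinearMap.mem_ker.1 hu) ⟨y, hy⟩
        rw [hBa, h2] at this
        exact this
      rw [pK, hY] at hwp
      obtain ⟨u1, hu1, d, hd, rfl⟩ := Submodule.mem_sup.1 hwp
      refine ⟨u1, ⟨hu1, ?_⟩, u - u1, ⟨U.sub_mem u.2.1 hu1, ?_⟩, by simp⟩
      · have := W.sub_mem hw hd.1
        simpa using this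
      · rw [h1]
        have : u1 + d + x - u1 = d + x := by abel
        rw [this]
        exact X.add_mem hd.2 hx
    · rintro ⟨a, ha, c, hc, rfl⟩
      have hmem : a + c ∈ K := ⟨U.add_mem ha.1 hc.1,
        Submodule.add_mem _ (Submodule.mem_sup_left ha.2) (Submodule.mem_sup_right hc.2)⟩
      refine ⟨⟨a + c, hmem⟩, ?_, rfl⟩
      rw [LinearMap.mem_ker]
      ext u'
      obtain ⟨w, hw, x, hx, h1, h2⟩ := hdec ⟨a + c, hmem⟩
      obtain ⟨w', hw', x', hx', h1', -⟩ := hdec u'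
      rw [hBa, h2, LinearMap.zero_apply]
      have h3 : w - a = c - x := by
        have : a + c = w + x := h1
        rw [sub_eq_sub_iff_add_eq_add, ← this, add_comm]
      have hdW : w - a ∈ W := W.sub_mem hw ha.2
      have hdX : w - a ∈ X := by rw [h3]; exact X.sub_mem hc.2 hx
      have h4 : w = a + (w - a) := by abel
      rw [h4, map_add, LinearMap.add_apply, hφ.lin hU ha.1 u'.2.1, h1', map_add,
        hφ.lin hW hdW hw', hφ.lin hX hdX hx']
      simp
  have dker : finrank F (LinearMap.ker B) = finrank F ((U ⊓ W) ⊔ (U ⊓ X) : Submodule F V) := by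
    rw [← hker]
    exact (Submodule.equivMapOfInjective K.subtype Subtype.val_injective _).finrank_eq
  have d1 := finrank_perp hb Y
  rw [pY] at d1
  have d2 := Submodule.finrank_sup_add_finrank_inf_eq U (W ⊓ X)
  have d3 := Submodule.finrank_sup_add_finrank_inf_eq (U ⊓ W) (U ⊓ X)
  have h5 : (U ⊓ W) ⊓ (U ⊓ X) = U ⊓ (W ⊓ X) := (inf_inf_distrib_left U W X).symm
  rw [h5] at d3
  rw [dker] at hev
  rw [← hY] at d2
  rw [Nat.even_iff] at hev ⊢
  omega

/-- doubled form -/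
def b2 (b : V →ₗ[F] V →ₗ[F] F) : (V × V) →ₗ[F] (V × V) →ₗ[F] F :=
  b.compl₁₂ (LinearMap.fst F V V) (LinearMap.fst F V V) +
    b.compl₁₂ (LinearMap.snd F V V) (LinearMap.snd F V V)

theorem b2_apply (p r : V × V) : b2 b p r = b p.1 r.1 + b p.2 r.2 := rfl

theorem b2_symp (hb : Symp b) : Symp (b2 b) := by
  constructor
  · intro v; rw [b2_apply, hb.alt, hb.alt, add_zero]
  · intro v hv
    refine Prod.ext (hb.nd _ fun w => ?_) (hb.nd _ fun w => ?_)
    · have := hv (w, 0); simpa [b2_apply] using this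
    · have := hv (0, w); simpa [b2_apply] using this

theorem q2 {φ : V → F} (hφ : IsQ b φ) : IsQ (b2 b) (fun p : V × V => φ p.1 + φ p.2) := by
  constructor
  · intro v w
    simp only [Prod.fst_add, Prod.snd_add, hφ.add, b2_apply]; ring
  · intro a v
    simp only [Prod.smul_fst, Prod.smul_snd, hφ.smul]; ring

/-- graph -/
def gr (g : V →ₗ[F] V) : Submodule F (V × V) := LinearMap.range (LinearMap.id.prod g)

theorem mem_gr {g : V →ₗ[F] V} {p : V × V} : p ∈ gr g ↔ p.2 = g p.1 := by
  constructor
  · rintro ⟨v, rfl⟩; rfl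
  · intro h
    exact ⟨p.1, Prod.ext rfl h.symm⟩

theorem finrank_gr (g : V →ₗ[F] V) : finrank F (gr g) = finrank F V := by
  apply LinearMap.finrank_range_of_inj
  intro v w h
  exact congrArg Prod.fst h

theorem finrank_gr_inf (g h : V →ₗ[F] V) :
    finrank F (gr g ⊓ gr h : Submodule F (V × V)) = finrank F (LinearMap.ker (g + h)) := by
  have : gr g ⊓ gr h = Submodule.map (LinearMap.id.prod g) (LinearMap.ker (g + h)) := by
    ext p
    rw [Submodule.mem_inf, mem_gr, mem_gr, Submodule.mem_map]
    constructor
    · rintro ⟨h1, h2⟩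
      refine ⟨p.1, ?_, Prod.ext rfl h1.symm⟩
      rw [LinearMap.mem_ker, LinearMap.add_apply, ← h1, ← h2]
      exact (two_smul F p.2).symm.trans (by rw [CharTwo.two_eq_zero, zero_smul])
    · rintro ⟨v, hv, rfl⟩
      refine ⟨rfl, ?_⟩
      rw [LinearMap.mem_ker, LinearMap.add_apply] at hv
      show g v = h v
      have h2 : h v + h v = 0 :=
        (two_smul F (h v)).symm.trans (by rw [CharTwo.two_eq_zero, zero_smul])
      exact add_right_cancel (hv.trans h2.symm)
  rw [this]
  exact (Submodule.equivMapOfInjective (LinearMap.id.prod g)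
    (fun v w h => congrArg Prod.fst h) _).finrank_eq.symm

theorem finrank_gr_inf_prod (g : V →ₗ[F] V) (W : Submodule F V) (hg : ∀ w ∈ W, g w ∈ W) :
    finrank F (gr g ⊓ W.prod W : Submodule F (V × V)) = finrank F W := by
  have : gr g ⊓ W.prod W = Submodule.map (LinearMap.id.prod g) W := by
    ext p
    rw [Submodule.mem_inf, mem_gr, Submodule.mem_map, Submodule.mem_prod]
    constructor
    · rintro ⟨h1, h2⟩
      exact ⟨p.1, h2.1, Prod.ext rfl h1.symm⟩
    · rintro ⟨v, hv, rfl⟩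
      exact ⟨rfl, hv, hg v hv⟩
  rw [this]
  exact (Submodule.equivMapOfInjective (LinearMap.id.prod g)
    (fun v w h => congrArg Prod.fst h) _).finrank_eq.symm

theorem gr_ts {φ : V → F} {g : V →ₗ[F] V} (hg : ∀ v, φ (g v) = φ v) :
    ∀ p ∈ gr g, φ p.1 + φ p.2 = 0 := by
  intro p hp
  rw [mem_gr.1 hp, hg, CharTwo.add_self_eq_zero]

/-- parity -/
def Ev (g : V ≃ₗ[F] V) : Prop :=
  Even (finrank F (LinearMap.range (g.toLinearMap + LinearMap.id)))

theorem ev_iff [FiniteDimensional F V] (hb : Symp b) (g : V ≃ₗ[F] V) :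
    Ev g ↔ Even (finrank F (LinearMap.ker (g.toLinearMap + LinearMap.id))) := by
  have h1 := hb.even
  have h2 := LinearMap.finrank_range_add_finrank_ker (g.toLinearMap + LinearMap.id)
  unfold Ev
  rw [← h2, Nat.even_add] at h1
  exact h1

theorem ev_trans [FiniteDimensional F V] (hb : Symp b) {φ : V → F} (hφ : IsQ b φ)
    {g h : V ≃ₗ[F] V} (hg : ∀ v, φ (g v) = φ v) (hh : ∀ v, φ (h v) = φ v) :
    Ev (g.trans h) ↔ (Ev g ↔ Ev h) := by
  have hd : finrank F (V × V) = 2 * finrank F V := by rw [Module.finrank_prod]; ring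
  have hh' : ∀ v, φ (h.symm v) = φ v := fun v => by rw [← hh, h.apply_symm_apply]
  have key := three_lagr (b2_symp hb) (q2 hφ) hd (gr LinearMap.id) (gr g.toLinearMap)
    (gr h.symm.toLinearMap) (gr_ts fun _ => rfl) (gr_ts hg) (gr_ts hh') (finrank_gr _)
    (finrank_gr _) (finrank_gr _)
  rw [finrank_gr_inf, finrank_gr_inf, finrank_gr_inf] at key
  have k1 : LinearMap.ker (g.toLinearMap + h.symm.toLinearMap) =
      LinearMap.ker ((g.trans h).toLinearMap + LinearMap.id) := by
    ext v
    rw [LinearMap.mem_ker, LinearMap.mem_ker]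
    have : ((g.trans h).toLinearMap + (LinearMap.id : V →ₗ[F] V)) v =
        h ((g.toLinearMap + h.symm.toLinearMap) v) := by simp
    rw [this]
    simp only [map_eq_zero_iff h h.injective]
  have k2 : LinearMap.ker (LinearMap.id + h.symm.toLinearMap) =
      LinearMap.ker (h.toLinearMap + LinearMap.id) := by
    ext v
    rw [LinearMap.mem_ker, LinearMap.mem_ker]
    have : (h.toLinearMap + (LinearMap.id : V →ₗ[F] V)) v =
        h (((LinearMap.id : V →ₗ[F] V) + h.symm.toLinearMap) v) := by simp [add_comm]
    rw [this]
    simp only [map_eq_zero_iff h h.injective]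
  rw [k1, k2, add_comm LinearMap.id] at key
  have h1 := hb.even
  rw [ev_iff hb, ev_iff hb, ev_iff hb]
  rw [Nat.even_iff] at *
  rw [Nat.even_iff, Nat.even_iff]
  omega

theorem ev_of_stable [FiniteDimensional F V] (hb : Symp b) {φ : V → F} (hφ : IsQ b φ) {n : ℕ}
    (hn : finrank F V = 2 * n)
    {g : V ≃ₗ[F] V} (hg : ∀ v, φ (g v) = φ v) (W : Submodule F V) (hW : ∀ w ∈ W, φ w = 0)
    (dW : finrank F W = n) (hgW : ∀ w ∈ W, g w ∈ W) : Ev g := by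
  have hd : finrank F (V × V) = 2 * finrank F V := by rw [Module.finrank_prod]; ring
  have key := three_lagr (b2_symp hb) (q2 hφ) hd (W.prod W) (gr g.toLinearMap) (gr LinearMap.id)
    (by
      intro p hp
      rw [hW _ hp.1, hW _ hp.2, add_zero])
    (gr_ts hg) (gr_ts fun _ => rfl) (by
      have h1 : W.prod W = LinearMap.range (W.subtype.prodMap W.subtype) := by
        rw [LinearMap.range_prodMap, Submodule.range_subtype]
      rw [h1, LinearMap.finrank_range_of_inj, Module.finrank_prod, dW, hn]
      · ring
      · exact Function.Injective.prodMap Subtype.val_injective Subtype.val_injective) (finrank_gr _) (finrank_gr _)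
  rw [finrank_gr_inf, inf_comm, finrank_gr_inf_prod _ _ hgW, inf_comm,
    finrank_gr_inf_prod _ _ (fun w hw => hw)] at key
  rw [ev_iff hb]
  have h1 := hb.even
  rw [Nat.even_iff] at *
  omega

theorem ev_refl : Ev (LinearEquiv.refl F V) := by
  unfold Ev
  have : (LinearEquiv.refl F V).toLinearMap + LinearMap.id = 0 := by
    ext v
    show v + v = 0
    exact (two_smul F v).symm.trans (by rw [CharTwo.two_eq_zero, zero_smul])
  rw [this, LinearMap.range_zero, finrank_bot]
  exact Even.zero

theorem ev_symm [FiniteDimensional F V] (hb : Symp b) {φ : V → F} (hφ : IsQ b φ)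
    {g : V ≃ₗ[F] V} (hg : ∀ v, φ (g v) = φ v) : Ev g.symm ↔ Ev g := by
  have hg' : ∀ v, φ (g.symm v) = φ v := fun v => by rw [← hg, g.apply_symm_apply]
  have := ev_trans hb hφ hg hg'
  rw [LinearEquiv.self_trans_symm] at this
  exact (this.1 ev_refl).symm

end dickson
end NilOrb

namespace NilOrb
section aop
variable {F V : Type*} [Field F] [AddCommGroup V] [Module F V]
variable [CharP F 2] {b : V →ₗ[F] V →ₗ[F] F} {x : End F V}

/-- The operator `v ↦ ∑ b (x^s u) v • x^(k-s) u`. -/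
def Aop (b : V →ₗ[F] V →ₗ[F] F) (x : End F V) (u : V) (k : ℕ) : V →ₗ[F] V :=
  ∑ s ∈ range (k + 1), (b ((x ^ s) u)).smulRight ((x ^ (k - s)) u)

theorem Aop_apply (u : V) (k : ℕ) (v : V) :
    Aop b x u k v = ∑ s ∈ range (k + 1), b ((x ^ s) u) v • (x ^ (k - s)) u := by
  simp [Aop, LinearMap.sum_apply]

theorem sum_refl (t : ℕ) (f : ℕ → F) (hf : ∀ s ≤ 2 * t, f (2 * t - s) = f s) :
    ∑ s ∈ range (2 * t + 1), f s = f t := by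
  induction t generalizing f with
  | zero => simp
  | succ t ih =>
    have e : 2 * (t + 1) + 1 = (2 * t + 1) + 1 + 1 := by ring
    rw [e, sum_range_succ, sum_range_succ', ih (fun s => f (s + 1))]
    · have h := hf 0 (by omega)
      have e2 : 2 * t + 1 + 1 = 2 * (t + 1) - 0 := by omega
      rw [e2, h, add_assoc, CharTwo.add_self_eq_zero, add_zero]
    · intro s hs
      have h := hf (s + 1) (by omega)
      rw [← h]; congr 1; omega

theorem b_self (hb : Symp b) (hx : IsNil b x) (u : V) (i j : ℕ) :
    b ((x ^ i) u) ((x ^ j) u) = 0 := by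
  rw [hx.swap_pow hb, pow_app, hb.symm, hx.alt_pow hb]

theorem IsQ.sum {φ : V → F} (hφ : IsQ b φ) {ι : Type*} (S : Finset ι) (c : ι → F) (w : ι → V)
    (h : ∀ i j, b (w i) (w j) = 0) :
    φ (∑ i ∈ S, c i • w i) = ∑ i ∈ S, c i ^ 2 * φ (w i) := by
  classical
  induction S using Finset.induction_on with
  | empty => simp [hφ.zero]
  | insert a S ha ih =>
    rw [sum_insert ha, sum_insert ha, hφ.add, hφ.smul, ih, map_sum]
    simp [h]

theorem IsQ.spg {φ : V → F} (hφ : IsQ b φ) {g : V ≃ₗ[F] V} (h : IsQ b (fun v => φ (g v))) :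
    Spg b g := by
  intro v w
  have h1 := h.add v w
  have h2 := hφ.add (g v) (g w)
  simp only [map_add] at h1
  rw [h1] at h2
  exact (add_left_cancel h2).symm

theorem IsQ.spg' {φ : V → F} (hφ : IsQ b φ) {g : V ≃ₗ[F] V} (h : ∀ v, φ (g v) = φ v) :
    Spg b g := by
  apply hφ.spg
  simpa only [h] using hφ

theorem Aop_sq (hb : Symp b) (hx : IsNil b x) (u : V) (k : ℕ) (v : V) :
    Aop b x u k (Aop b x u k v) = 0 := by
  rw [Aop_apply]
  apply sum_eq_zero
  intro s _
  rw [Aop_apply, map_sum, sum_eq_zero, zero_smul]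
  intro r _
  rw [map_smul, b_self hb hx, smul_zero]

theorem Aop_comm (hb : Symp b) (hx : IsNil b x) {u : V} {k : ℕ} (hu : (x ^ (k + 1)) u = 0) (v : V) :
    Aop b x u k (x v) = x (Aop b x u k v) := by
  rw [Aop_apply, Aop_apply, map_sum, sum_range_succ, sum_range_succ' (n := k)]
  have e1 : b ((x ^ k) u) (x v) = 0 := by
    rw [← hx.swap hb]
    have := hu
    rw [pow_succ', Module.End.mul_apply] at this
    rw [this]; simp
  have e2 : x ((x ^ (k - 0)) u) = 0 := by
    rw [pow_succ', Module.End.mul_apply] at hu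
    simpa using hu
  rw [e1, map_smul, e2, smul_zero, zero_smul, add_zero, add_zero]
  apply sum_congr rfl
  intro s hs
  rw [mem_range] at hs
  rw [map_smul, ← hx.swap hb, ← Module.End.mul_apply, ← Module.End.mul_apply, ← pow_succ', ← pow_succ']
  congr 3; omega

theorem Aop_form (hb : Symp b) (hx : IsNil b x) (u : V) (t : ℕ) (v : V) :
    b v (Aop b x u (2 * t) v) = (b ((x ^ t) u) v) ^ 2 := by
  rw [Aop_apply, map_sum]
  have : ∀ s ∈ range (2 * t + 1), b v (b ((x ^ s) u) v • (x ^ (2 * t - s)) u) =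
      (fun s => b ((x ^ s) u) v * b ((x ^ (2 * t - s)) u) v) s := by
    intro s _
    simp only [map_smul, smul_eq_mul]
    rw [hb.symm v]
  rw [sum_congr rfl this, sum_refl]
  · have : 2 * t - t = t := by omega
    simp only [this]; ring
  · intro s hs
    have : 2 * t - (2 * t - s) = s := by omega
    simp only [this]; ring

theorem gA (hb : Symp b) (hx : IsNil b x) {u : V} {t : ℕ} (hu : (x ^ (2 * t + 1)) u = 0) (c : F) :
    ∃ g : V ≃ₗ[F] V, (∀ v, g v = v + c • Aop b x u (2 * t) v) ∧ (∀ v, g (x v) = x (g v)) ∧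
      ∀ φ, IsQ b φ → ∀ v, φ (g v) = φ v + c * (b ((x ^ t) u) v) ^ 2 +
        c ^ 2 * ∑ s ∈ range (2 * t + 1), (b ((x ^ s) u) v) ^ 2 * φ ((x ^ (2 * t - s)) u) := by
  have hV : ∀ v : V, v + v = 0 := fun v => by
    rw [← two_smul F v, CharTwo.two_eq_zero, zero_smul]
  let f : V →ₗ[F] V := LinearMap.id + c • Aop b x u (2 * t)
  have hf : ∀ v, f v = v + c • Aop b x u (2 * t) v := fun v => rfl
  have hi : Function.Involutive f := by
    intro v
    rw [hf, hf, map_add, map_smul, Aop_sq hb hx, smul_zero, add_zero, add_assoc, hV, add_zero]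
  refine ⟨LinearEquiv.ofInvolutive f hi, fun v => hf v, ?_, ?_⟩
  · intro v
    change f (x v) = x (f v)
    rw [hf, hf, map_add, map_smul, Aop_comm hb hx hu]
  · intro φ hφ v
    change φ (f v) = _
    rw [hf, hφ.add, hφ.smul, map_smul, Aop_form hb hx, Aop_apply, hφ.sum _ _ _ (fun i j => b_self hb hx u _ _),
      smul_eq_mul]
    ring

theorem Aop_odd [FiniteDimensional F V] (hb : Symp b) (hx : IsNil b x) {u : V} {t : ℕ}
    (hu : (x ^ (2 * t + 1)) u = 0) (h1 : (x ^ t) u ≠ 0) :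
    ¬ Even (finrank F (LinearMap.ker (Aop b x u (2 * t)))) := by
  classical
  have hex : ∃ m, (x ^ m) u = 0 := ⟨_, hu⟩
  set m := Nat.find hex with hm
  have hm0 : (x ^ m) u = 0 := Nat.find_spec hex
  have htm : t < m := by
    by_contra h
    exact h1 (pow_zero_of_le hm0 (by omega))
  obtain ⟨w, -, hw⟩ := dualvec hb hx ⊤ (fun y _ h => hb.nd y (fun w => h w trivial))
    (fun _ _ _ => trivial) (u := u) trivial (m := m) (by omega) hm0
    (Nat.find_min hex (by omega))
  set w' := (x ^ (m - 1 - t)) w with hw'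
  have hd : ∀ s, b ((x ^ s) u) w' = if s = t then 1 else 0 := by
    intro s
    rw [hw', ← hx.swap_pow hb, pow_app, hw]
    apply if_congr _ rfl rfl
    omega
  set L := b ((x ^ t) u) with hL
  set A := Aop b x u (2 * t) with hA
  set B : V →ₗ[F] V →ₗ[F] F := b ∘ₗ A + L.smulRight L with hB
  have hBa : ∀ v w, B v w = b (A v) w + L v * L w := by
    intro v w; simp [hB]
  have halt : ∀ v, B v v = 0 := by
    intro v
    rw [hBa, hb.symm, hA, Aop_form hb hx, sq, CharTwo.add_self_eq_zero]
  have hBw : B w' = 0 := by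
    refine LinearMap.ext fun v => ?_
    rw [hBa, hA, Aop_apply, map_sum, LinearMap.sum_apply, sum_eq_single t]
    · have : 2 * t - t = t := by omega
      rw [hL, hd, this]
      simp [CharTwo.add_self_eq_zero]
    · intro s _ hs
      rw [hd, if_neg hs]; simp
    · intro h; exact absurd (mem_range.2 (by omega)) h
  have hker : LinearMap.ker A = (LinearMap.ker (L.domRestrict (LinearMap.ker B))).map
      (LinearMap.ker B).subtype := by
    ext v
    simp only [Submodule.mem_map, LinearMap.mem_ker, Submodule.subtype_apply, Subtype.exists,
      LinearMap.domRestrict_apply, exists_and_left, exists_prop, exists_eq_right_right]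
    constructor
    · intro h
      have h2 := Aop_form hb hx u t v
      rw [← hA, h, map_zero] at h2
      have h3 : L v = 0 := by
        have := h2.symm; simpa using this
      refine ⟨h3, LinearMap.ext fun w => ?_⟩
      rw [hBa, h, h3]; simp
    · rintro ⟨h3, h⟩
      apply hb.nd
      intro w
      have := hBa v w
      rw [h, h3] at this
      simpa using this.symm
  have h2 : L.domRestrict (LinearMap.ker B) ≠ 0 := by
    intro h
    have := LinearMap.congr_fun h ⟨w', hBw⟩
    rw [LinearMap.domRestrict_apply, hL, hd] at this
    simp at this
  have h3 := Module.Dual.finrank_ker_add_one_of_ne_zero h2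
  have h4 := even_of_alt B halt
  have h5 := hb.even
  have h6 : finrank F (LinearMap.ker A) = finrank F (LinearMap.ker (L.domRestrict (LinearMap.ker B))) := by
    rw [hker]
    exact ((Submodule.equivMapOfInjective _ (Submodule.subtype_injective _) _).finrank_eq).symm
  rw [h6]
  intro h7
  have h8 : Even (finrank F (LinearMap.ker B)) := (Nat.even_add.1 h4).1 h5
  rw [← h3] at h8
  exact (Nat.even_add_one.1 h8) h7

theorem exists_sqrt [Finite F] (a : F) : ∃ c : F, c ^ 2 = a := by
  obtain ⟨c, hc⟩ := FiniteField.isSquare_of_char_two (ringChar.eq F 2) a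
  exact ⟨c, by rw [hc]; ring⟩

/-- Normalization of a vector. -/
theorem normalize [Finite F] (hb : Symp b) (hx : IsNil b x) {φ : V → F} (hφ : IsQ b φ) {i : ℕ}
    {u : V} (hu : (x ^ (2 * i + 1)) u = 0) (h1 : φ ((x ^ i) u) ≠ 0)
    (h2 : ∀ j > i, φ ((x ^ j) u) = 0) (d : ℕ) (hd : d ≤ i) :
    ∃ u, (x ^ (2 * i + 1)) u = 0 ∧ φ ((x ^ i) u) ≠ 0 ∧ ∀ j, j ≠ i → i ≤ j + d → φ ((x ^ j) u) = 0 := by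
  induction d with
  | zero => exact ⟨u, hu, h1, fun j hj h => h2 j (by omega)⟩
  | succ d ih =>
    obtain ⟨u, hu, h1, h2⟩ := ih (by omega)
    set j := i - d - 1 with hj
    obtain ⟨c, hc⟩ := exists_sqrt (φ ((x ^ j) u) / φ ((x ^ i) u))
    have key : ∀ k, φ ((x ^ k) (u + c • (x ^ (i - j)) u)) =
        φ ((x ^ k) u) + c ^ 2 * φ ((x ^ (k + (i - j))) u) := by
      intro k
      rw [map_add, map_smul, pow_app, hφ.add, hφ.smul, map_smul, b_self hb hx, smul_zero, add_zero]
    refine ⟨u + c • (x ^ (i - j)) u, ?_, ?_, ?_⟩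
    · rw [map_add, map_smul, pow_app, hu, pow_zero_of_le hu (by omega)]; simp
    · rw [key, h2 (i + (i - j)) (by omega) (by omega)]
      simpa using h1
    · intro k hk hkd
      rw [key]
      by_cases hkj : k = j
      · have : k + (i - j) = i := by omega
        rw [this, hc, div_mul_cancel₀ _ h1, hkj, CharTwo.add_self_eq_zero]
      · rw [h2 k hk (by omega), h2 (k + (i - j)) (by omega) (by omega)]; simp

theorem nonsplit [Finite F] [FiniteDimensional F V] (hb : Symp b) (hx : IsNil b x) {φ : V → F}
    (hφ : IsQ b φ) {i : ℕ} {u : V} (hu : (x ^ (2 * i + 1)) u = 0) (h1 : φ ((x ^ i) u) ≠ 0) :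
    ∃ g : V ≃ₗ[F] V, (∀ v, φ (g v) = φ v) ∧ (∀ v, g (x v) = x (g v)) ∧ ¬ Ev g := by
  classical
  obtain ⟨N, hN⟩ := hx.nil
  let P : ℕ → Prop := fun i => ∃ u, (x ^ (2 * i + 1)) u = 0 ∧ φ ((x ^ i) u) ≠ 0
  have hP : ∀ j, P j → j ≤ N := by
    rintro j ⟨u, -, h⟩
    by_contra hj
    apply h
    have : (x ^ N) u = 0 := by rw [hN]; rfl
    rw [pow_zero_of_le this (by omega), hφ.zero]
  have hPi : P i := ⟨u, hu, h1⟩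
  have hs : P (Nat.findGreatest P N) := Nat.findGreatest_spec (hP i hPi) hPi
  have hg : ∀ j, Nat.findGreatest P N < j → ¬ P j := by
    intro j hj h
    exact Nat.findGreatest_is_greatest hj (hP j h) h
  generalize Nat.findGreatest P N = i at hs hg
  clear hu h1 hPi
  obtain ⟨u, hu, h1⟩ := hs
  obtain ⟨u, hu, h1, h2⟩ := normalize hb hx hφ hu h1 (fun j hj => by
    by_contra h
    exact hg j hj ⟨u, pow_zero_of_le hu (by omega), h⟩) i le_rfl
  obtain ⟨g, hg1, hg2, hg3⟩ := gA hb hx hu (φ ((x ^ i) u))⁻¹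
  refine ⟨g, ?_, hg2, ?_⟩
  · intro v
    rw [hg3 φ hφ, sum_eq_single i]
    · have : 2 * i - i = i := by omega
      rw [this]
      have : (φ ((x ^ i) u))⁻¹ ^ 2 * ((b ((x ^ i) u) v) ^ 2 * φ ((x ^ i) u)) =
        (φ ((x ^ i) u))⁻¹ * (b ((x ^ i) u) v) ^ 2 := by field_simp
      rw [this, add_assoc, CharTwo.add_self_eq_zero, add_zero]
    · intro s hs hsi
      rw [mem_range] at hs
      rw [h2 _ (by omega) (by omega), mul_zero]
    · intro h; exact absurd (mem_range.2 (by omega)) h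
  · rw [ev_iff hb]
    have : g.toLinearMap + LinearMap.id = (φ ((x ^ i) u))⁻¹ • Aop b x u (2 * i) := by
      refine LinearMap.ext fun v => ?_
      have hV : v + v = 0 := by rw [← two_smul F v, CharTwo.two_eq_zero, zero_smul]
      change g v + v = (φ ((x ^ i) u))⁻¹ • Aop b x u (2 * i) v
      rw [hg1, add_comm, ← add_assoc, hV, zero_add]
    rw [this, LinearMap.ker_smul _ _ (inv_ne_zero h1)]
    apply Aop_odd hb hx hu
    intro h
    rw [h, hφ.zero] at h1
    exact h1 rfl

end aop
end NilOrb

namespace NilOrb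
section split
variable {F V : Type*} [Field F] [AddCommGroup V] [Module F V]
variable [CharP F 2] {b : V →ₗ[F] V →ₗ[F] F} {x : End F V}

/-- Split data. -/
def SplitT (b : V →ₗ[F] V →ₗ[F] F) (φ : V → F) (x : End F V) {n : ℕ} (α : Fin n → ℕ) : Prop :=
  Antitone α ∧ (∃ e f, Sys b x (α + α) e f ∧ Complete b x e f) ∧ ∀ v ∈ Msub b x α α, φ v = 0

theorem Msub_iso {n : ℕ} {α : Fin n → ℕ} {e f : Fin n → V} (hb : Symp b) (hx : IsNil b x)
    (hα : Antitone α) (hs : Sys b x (α + α) e f) (hc : Complete b x e f) {v w : V}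
    (hv : v ∈ Msub b x α α) (hw : w ∈ Msub b x α α) : b v w = 0 := by
  rw [← Msub_perp hα hα hb hx hs hc] at hv
  exact hv w hw

theorem phi_Msub {n : ℕ} {α : Fin n → ℕ} {e f : Fin n → V} (hb : Symp b) (hx : IsNil b x)
    (hα : Antitone α) (hs : Sys b x (α + α) e f) (hc : Complete b x e f) {φ : V → F} (hφ : IsQ b φ)
    (he : ∀ i s, α i ≤ s → φ ((x ^ s) (e i)) = 0) (hf : ∀ i s, α i ≤ s → φ ((x ^ s) (f i)) = 0) :
    ∀ v ∈ Msub b x α α, φ v = 0 := by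
  let M : Submodule F V :=
    { carrier := {v | v ∈ Msub b x α α ∧ φ v = 0}
      add_mem' := by
        rintro v w ⟨hv, hv'⟩ ⟨hw, hw'⟩
        refine ⟨add_mem hv hw, ?_⟩
        rw [hφ.add, hv', hw', Msub_iso hb hx hα hs hc hv hw]; simp
      zero_mem' := ⟨zero_mem _, hφ.zero⟩
      smul_mem' := by
        rintro c v ⟨hv, hv'⟩
        refine ⟨Submodule.smul_mem _ _ hv, ?_⟩
        rw [hφ.smul, hv', mul_zero] }
  have h : Msub b x α α ≤ M := by
    apply Msub_le hb hx hs hc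
    · intro i s h
      exact ⟨Msub_gen hb hx hα hα (hs.he i) h, he i s h⟩
    · intro i s h
      exact ⟨Msub_gen hb hx hα hα (hs.hf i) h, hf i s h⟩
  exact fun v hv => (h hv).2

theorem splitT_of [FiniteDimensional F V] (hb : Symp b) (hx : IsNil b x) {φ : V → F} (hφ : IsQ b φ)
    {n : ℕ} (hn : finrank F V = 2 * n)
    (H : ∀ i u, (x ^ (2 * i + 1)) u = 0 → φ ((x ^ i) u) = 0) :
    ∃ α : Fin n → ℕ, SplitT b φ x α := by
  obtain ⟨α, β, hα, hβ, e, f, hs, hc, -⟩ := type_exists hb hx hn 0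
  have hev : ∀ i, Even ((α + β) i) := by
    intro i
    by_contra h
    rw [Nat.not_even_iff_odd] at h
    obtain ⟨s, hi⟩ := h
    have h1 := H s (e i) (by rw [← hi]; exact hs.he i)
    have h2 := H s (f i) (by rw [← hi]; exact hs.hf i)
    have h3 := H s (e i + f i) (by rw [← hi, map_add, hs.he i, hs.hf i, add_zero])
    rw [map_add, hφ.add, h1, h2, hs.pair hb hx, if_pos ⟨rfl, by omega⟩] at h3
    simp at h3
  let γ : Fin n → ℕ := fun i => (α + β) i / 2
  have hγ : α + β = γ + γ := by
    funext i
    obtain ⟨k, hk⟩ := hev i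
    simp only [Pi.add_apply, γ] at hk ⊢
    omega
  have hγa : Antitone γ := fun i j h => Nat.div_le_div_right (add_le_add (hα h) (hβ h))
  rw [hγ] at hs
  refine ⟨γ, hγa, ⟨e, f, hs, hc⟩, phi_Msub hb hx hγa hs hc hφ ?_ ?_⟩
  · intro i s h
    exact H s _ (pow_zero_of_le (hs.he i) (by simp only [Pi.add_apply]; omega))
  · intro i s h
    exact H s _ (pow_zero_of_le (hs.hf i) (by simp only [Pi.add_apply]; omega))

theorem SplitT.ev [Fintype F] [Fintype V] [FiniteDimensional F V] (hb : Symp b) (hx : IsNil b x)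
    {φ : V → F} (hφ : IsQ b φ)
    {n : ℕ} (hn : finrank F V = 2 * n) {α : Fin n → ℕ} (h : SplitT b φ x α) {g : V ≃ₗ[F] V}
    (hg : ∀ v, φ (g v) = φ v) (hgx : ∀ v, g (x v) = x (g v)) : Ev g := by
  obtain ⟨hα, ⟨e, f, hs, hc⟩, h0⟩ := h
  exact ev_of_stable hb hφ hn hg _ h0 (card_Msub_diag hb hn hx hα hs hc)
    (fun w hw => (Msub_map (hφ.spg' hg) hgx).2 hw)

/-- Equivalence of forms under the centralizer of `x`. -/
def Tw (b : V →ₗ[F] V →ₗ[F] F) (x : End F V) (φ φ' : V → F) : Prop :=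
  ∃ g : V ≃ₗ[F] V, Spg b g ∧ (∀ v, g (x v) = x (g v)) ∧ ∀ v, φ' (g v) = φ v

theorem Tw.symm {φ φ' : V → F} (h : Tw b x φ φ') : Tw b x φ' φ := by
  obtain ⟨g, h1, h2, h3⟩ := h
  refine ⟨g.symm, h1.inv, ?_, ?_⟩
  · intro v
    rw [LinearEquiv.symm_apply_eq, h2]; simp
  · intro v
    rw [← h3]; simp

theorem Tw.trans {φ φ' φ'' : V → F} (h : Tw b x φ φ') (h' : Tw b x φ' φ'') : Tw b x φ φ'' := by
  obtain ⟨g, h1, h2, h3⟩ := h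
  obtain ⟨g', h1', h2', h3'⟩ := h'
  refine ⟨g.trans g', h1.trans h1', ?_, ?_⟩
  · intro v; simp [h2, h2']
  · intro v; simp [h3, h3']

theorem Tw.refl (φ : V → F) : Tw b x φ φ := ⟨LinearEquiv.refl F V, fun _ _ => rfl, fun _ => rfl, fun _ => rfl⟩

/-- Directions along which forms vanishing on `M` may be twisted. -/
def Sdir (b : V →ₗ[F] V →ₗ[F] F) (x : End F V) (M : Submodule F V)
    (hM : ∀ v ∈ M, ∀ w ∈ M, b v w = 0) : Submodule F V where
  carrier := {u | u ∈ M ∧ ∀ (c : F) (φ : V → F), IsQ b φ → (∀ v ∈ M, φ v = 0) →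
    Tw b x φ (fun v => φ v + (b (c • u) v) ^ 2)}
  zero_mem' := by
    refine ⟨zero_mem _, fun c φ _ _ => ?_⟩
    simpa using Tw.refl (b := b) (x := x) φ
  add_mem' := by
    rintro u w ⟨hu, hu'⟩ ⟨hw, hw'⟩
    refine ⟨add_mem hu hw, fun c φ h1 h2 => ?_⟩
    have e1 := hu' c φ h1 h2
    have e2 := hw' c _ (h1.twist (c • u)) (by
      intro v hv
      rw [h2 v hv, hM _ (M.smul_mem c hu) v hv]; simp)
    have e3 := e1.trans e2
    have : (fun v => φ v + (b (c • (u + w)) v) ^ 2) =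
        fun v => φ v + (b (c • u) v) ^ 2 + (b (c • w) v) ^ 2 := by
      funext v
      rw [smul_add, map_add, LinearMap.add_apply, CharTwo.add_sq, add_assoc]
    rw [this]; exact e3
  smul_mem' := by
    rintro a u ⟨hu, hu'⟩
    refine ⟨M.smul_mem a hu, fun c φ h1 h2 => ?_⟩
    rw [smul_smul]; exact hu' _ φ h1 h2

theorem mem_Sdir [Finite F] (hb : Symp b) (hx : IsNil b x) (M : Submodule F V)
    (hM : ∀ v ∈ M, ∀ w ∈ M, b v w = 0) {e : V} {a : ℕ} (he : (x ^ (a + a)) e = 0)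
    (heM : ∀ t, a ≤ t → (x ^ t) e ∈ M) (d : ℕ) :
    ∀ t, a ≤ t → a + a ≤ t + d → (x ^ t) e ∈ Sdir b x M hM := by
  induction d with
  | zero =>
    intro t _ h
    rw [pow_zero_of_le he (by omega)]; exact zero_mem _
  | succ d ih =>
    intro t hat h
    refine ⟨heM t hat, fun c φ hφ h0 => ?_⟩
    choose r hr using fun a : F => exists_sqrt a
    have hr0 : r 0 = 0 := by
      have := hr 0
      simpa using this
    obtain ⟨g, -, hg2, hg3⟩ := gA hb hx (pow_zero_of_le he (show a + a ≤ 2 * t + 1 by omega)) (c ^ 2)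
    set ψ : V → F := fun v => φ v + (b (c • (x ^ t) e) v) ^ 2 with hψ
    have hψq : IsQ b ψ := hφ.twist _
    have hψ0 : ∀ v ∈ M, ψ v = 0 := by
      intro v hv
      rw [hψ]; simp only
      rw [h0 v hv, hM _ (M.smul_mem c (heM t hat)) v hv]; simp
    set w : V := ∑ s ∈ range (2 * t + 1), (c ^ 2 * r (φ ((x ^ (2 * t - s)) e))) • (x ^ s) e with hw
    have hwS : w ∈ Sdir b x M hM := by
      refine Submodule.sum_mem _ fun s hs => ?_
      by_cases hst : s ≤ t
      · rw [h0 _ (heM _ (by omega)), hr0]; simp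
      · exact Submodule.smul_mem _ _ (ih s (by omega) (by omega))
    have h1 := hwS.2 1 ψ hψq hψ0
    have h2 : ∀ v, φ (g v) = ψ v + (b ((1 : F) • w) v) ^ 2 := by
      intro v
      rw [hg3 φ hφ, one_smul, hw, hψ, map_sum, LinearMap.sum_apply, CharTwo.sum_sq, mul_sum]
      simp only [map_smul, LinearMap.smul_apply, smul_eq_mul]
      rw [mul_pow]
      congr 1
      apply sum_congr rfl
      intro s _
      rw [mul_pow, mul_pow, hr]
      ring
    have hgS : Spg b g := by
      apply hφ.spg
      simp only [h2]
      exact hψq.twist _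
    have h3 : Tw b x (fun v => ψ v + (b ((1 : F) • w) v) ^ 2) φ := ⟨g, hgS, hg2, h2⟩
    exact (h1.trans h3).symm

theorem SplitT.tw [Finite F] [FiniteDimensional F V] (hb : Symp b) (hx : IsNil b x) {φ φ' : V → F}
    (hφ : IsQ b φ) (hφ' : IsQ b φ') {n : ℕ} {α : Fin n → ℕ} (h : SplitT b φ x α)
    (h' : SplitT b φ' x α) : Tw b x φ φ' := by
  obtain ⟨hα, ⟨e, f, hs, hc⟩, h0⟩ := h
  have h0' := h'.2.2
  have hM : ∀ v ∈ Msub b x α α, ∀ w ∈ Msub b x α α, b v w = 0 :=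
    fun v hv w hw => Msub_iso hb hx hα hs hc hv hw
  obtain ⟨u, hu⟩ := hφ.torsor hb hφ'
  have huM : u ∈ Msub b x α α := by
    rw [← Msub_perp hα hα hb hx hs hc]
    intro v hv
    have := hu v
    rw [h0 v hv, h0' v hv] at this
    simpa using this.symm
  have hle : Msub b x α α ≤ Sdir b x _ hM := by
    apply Msub_le hb hx hs hc
    · intro i s h
      exact mem_Sdir hb hx _ hM (hs.he i) (fun t ht => Msub_gen hb hx hα hα (hs.he i) ht)
        (α i + α i) s h (by omega)
    · intro i s h
      exact mem_Sdir hb hx _ hM (hs.hf i) (fun t ht => Msub_gen hb hx hα hα (hs.hf i) ht)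
        (α i + α i) s h (by omega)
  have := (hle huM).2 1 φ hφ h0
  rw [one_smul] at this
  rwa [show φ' = fun v => φ v + (b u v) ^ 2 from funext hu]

theorem SplitT.conj [Finite F] [FiniteDimensional F V] (hb : Symp b) {x' : End F V} (hx : IsNil b x)
    (hx' : IsNil b x') {φ : V → F}
    (hφ : IsQ b φ) {n : ℕ} {α : Fin n → ℕ} (h : SplitT b φ x α)
    (h' : SplitT b φ x' α) : ∃ g : V ≃ₗ[F] V, (∀ v, φ (g v) = φ v) ∧ ∀ v, g (x v) = x' (g v) := by
  obtain ⟨hα, ⟨e, f, hs, hc⟩, h0⟩ := id h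
  obtain ⟨-, ⟨e', f', hs', hc'⟩, h0'⟩ := h'
  obtain ⟨g, hg, hgx, -, -⟩ := hs.conj hb hx hx' hc hs' hc'
  have h2 : SplitT b (fun v => φ (g v)) x α :=
    ⟨hα, ⟨e, f, hs, hc⟩, fun v hv => h0' _ ((Msub_map hg hgx).2 hv)⟩
  obtain ⟨k, hk, hkx, hkφ⟩ := h.tw hb hx hφ (hφ.map hg) h2
  refine ⟨k.trans g, fun v => hkφ v, fun v => ?_⟩
  simp [hkx, hgx]

theorem SplitT.unique [Finite F] [FiniteDimensional F V] (hb : Symp b) {x' : End F V} (hx : IsNil b x)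
    (hx' : IsNil b x') {φ φ' : V → F} {n : ℕ} {α α' : Fin n → ℕ} (h : SplitT b φ x α)
    (h' : SplitT b φ' x' α') {g : V ≃ₗ[F] V} (hg : Spg b g) (hgx : ∀ v, g (x v) = x' (g v)) :
    α = α' := by
  obtain ⟨hα, ⟨e, f, hs, hc⟩, h0⟩ := id h
  obtain ⟨hα', ⟨e', f', hs', hc'⟩, h0'⟩ := h'
  have h1 : HasType b x _ α α := ⟨hα, hα, e, f, hs, hc, rfl⟩
  obtain ⟨-, -, e1, f1, hs1, hc1, -⟩ := h1.map hg hgx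
  have h2 := lam_unique hb hx' hs1 hc1 hs' hc' (hα.add hα) (hα'.add hα')
  funext i
  have := congrFun h2 i
  simp only [Pi.add_apply] at this
  omega

theorem SplitT.exists [Fintype F] [Fintype V] [FiniteDimensional F V] (hb : Symp b) {φ : V → F}
    (hφ : IsQ b φ) {n : ℕ} (hn : finrank F V = 2 * n) (U : Submodule F V)
    (hU : ∀ v ∈ U, φ v = 0) (hd : finrank F U = n) {α : Fin n → ℕ} (hα : Antitone α)
    (hs : ∑ i, (α i + α i) = n) : ∃ x, IsNil b x ∧ SplitT b φ x α := by
  obtain ⟨e, f, h1, h2, h3⟩ := hyper_exists hb hφ hn U hU hd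
  obtain ⟨x, e', f', hx, hs', hc, he, hf⟩ := build hb hφ.zero hn h1 h2 h3 (α + α) hs
  exact ⟨x, hx, hα, ⟨e', f', hs', hc⟩, phi_Msub hb hx hα hs' hc hφ (fun i s _ => he i s)
    (fun i s _ => hf i s)⟩

end split
end NilOrb

namespace NilOrb
section fiber

theorem two_fiber {X : Type*} [Finite X] (O S : Setoid X) (r : X → X) (P : Quotient O → Prop)
    (hOS : ∀ x y, O x y ↔ S x y ∨ S (r x) y)
    (hP : ∀ x, P (Quotient.mk O x) ↔ ¬ S (r x) x) :
    Nat.card (Quotient S) = Nat.card (Quotient O) + Nat.card {o // P o} := by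
  classical
  have := Fintype.ofFinite X
  have := Fintype.ofFinite (Quotient S)
  have := Fintype.ofFinite (Quotient O)
  let π : Quotient S → Quotient O := Quotient.lift (fun x => Quotient.mk O x) (by
    intro x y h
    exact Quotient.sound ((hOS x y).2 (Or.inl h)))
  have h1 : Fintype.card (Quotient S) = ∑ o : Quotient O, #{s | π s = o} := by
    rw [← Finset.card_univ]
    exact Finset.card_eq_sum_card_fiberwise (fun _ _ => by simp)
  have h2 : ∀ o : Quotient O, #{s | π s = o} = 1 + if P o then 1 else 0 := by
    intro o
    obtain ⟨x, rfl⟩ := Quotient.exists_rep o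
    have h3 : ({s | π s = Quotient.mk O x} : Finset (Quotient S)) =
        {Quotient.mk S (r x), Quotient.mk S x} := by
      ext s
      obtain ⟨y, rfl⟩ := Quotient.exists_rep s
      simp only [Finset.mem_filter, Finset.mem_univ, true_and, Finset.mem_insert,
        Finset.mem_singleton, Quotient.eq]
      change Quotient.mk O y = Quotient.mk O x ↔ _
      rw [Quotient.eq]
      constructor
      · intro h
        rcases (hOS x y).1 (O.symm h) with h | h
        · exact Or.inr (S.symm h)
        · exact Or.inl (S.symm h)
      · rintro (h | h)
        · exact O.symm ((hOS x y).2 (Or.inr (S.symm h)))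
        · exact O.symm ((hOS x y).2 (Or.inl (S.symm h)))
    rw [h3]
    by_cases hp : P (Quotient.mk O x)
    · rw [if_pos hp, Finset.card_pair]
      intro h
      exact (hP x).1 hp (Quotient.eq.1 h)
    · have h4 : S (r x) x := by
        by_contra h
        exact hp ((hP x).2 h)
      rw [if_neg hp, Quotient.eq.2 h4]; simp
  rw [Nat.card_eq_fintype_card, Nat.card_eq_fintype_card, Nat.card_eq_fintype_card, h1]
  simp only [h2]
  rw [Finset.sum_add_distrib, Fintype.card_subtype]
  simp
end fiber

section socount
variable {F V : Type*} [Field F] [AddCommGroup V] [Module F V]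
variable [CharP F 2] {b : V →ₗ[F] V →ₗ[F] F} {x : End F V} {χ : F → ℚ}

/-- Isometry group conjugacy. -/
def oset (b : V →ₗ[F] V →ₗ[F] F) (φ : V → F) : Setoid (Nn b) where
  r x y := ∃ g : V ≃ₗ[F] V, (∀ v, φ (g v) = φ v) ∧ ∀ v, g (x.1 v) = y.1 (g v)
  iseqv := by
    refine ⟨fun p => ⟨LinearEquiv.refl F V, fun _ => rfl, fun _ => rfl⟩, ?_, ?_⟩
    · rintro p p' ⟨g, h2, h1⟩
      refine ⟨g.symm, fun v => ?_, fun v => ?_⟩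
      · rw [← h2, LinearEquiv.apply_symm_apply]
      · rw [LinearEquiv.symm_apply_eq, h1, LinearEquiv.apply_symm_apply]
    · rintro p p' p'' ⟨g, h2, h1⟩ ⟨g', h2', h1'⟩
      refine ⟨g.trans g', fun v => ?_, fun v => ?_⟩
      · simp [h2, h2']
      · simp [h1, h1']

/-- Special isometry group conjugacy. -/
def sset [FiniteDimensional F V] (hb : Symp b) {φ : V → F} (hφ : IsQ b φ) : Setoid (Nn b) where
  r x y := ∃ g : V ≃ₗ[F] V, (∀ v, φ (g v) = φ v) ∧ Ev g ∧ ∀ v, g (x.1 v) = y.1 (g v)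
  iseqv := by
    refine ⟨fun p => ⟨LinearEquiv.refl F V, fun _ => rfl, ev_refl, fun _ => rfl⟩, ?_, ?_⟩
    · rintro p p' ⟨g, h2, h3, h1⟩
      refine ⟨g.symm, fun v => ?_, (ev_symm hb hφ h2).2 h3, fun v => ?_⟩
      · rw [← h2, LinearEquiv.apply_symm_apply]
      · rw [LinearEquiv.symm_apply_eq, h1, LinearEquiv.apply_symm_apply]
    · rintro p p' p'' ⟨g, h2, h3, h1⟩ ⟨g', h2', h3', h1'⟩
      refine ⟨g.trans g', fun v => ?_, (ev_trans hb hφ h2 h2').2 (iff_of_true h3 h3'), fun v => ?_⟩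
      · simp [h2, h2']
      · simp [h1, h1']

/-- Conjugate. -/
def cj (x : Nn b) {g : V ≃ₗ[F] V} (hg : Spg b g) : Nn b :=
  ⟨g.toLinearMap ∘ₗ x.1 ∘ₗ g.symm.toLinearMap, x.2.conj hg (fun v => by simp)⟩

theorem cj_apply (x : Nn b) {g : V ≃ₗ[F] V} (hg : Spg b g) (v : V) :
    g (x.1 v) = (cj x hg).1 (g v) := by simp [cj]

theorem odd_exists [Finite F] [FiniteDimensional F V] (hb : Symp b) {φ : V → F} (hφ : IsQ b φ)
    [Nontrivial V] : ∃ g : V ≃ₗ[F] V, (∀ v, φ (g v) = φ v) ∧ ¬ Ev g := by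
  have : ∃ u, φ u ≠ 0 := by
    by_contra h
    push Not at h
    obtain ⟨v, hv⟩ := exists_ne (0 : V)
    apply hv
    apply hb.nd
    intro w
    have := hφ.add v w
    simpa [h] using this.symm
  obtain ⟨u, hu⟩ := this
  obtain ⟨g, h1, -, h2⟩ := nonsplit (i := 0) (u := u) hb isNil_zero hφ (by simp) (by simpa using hu)
  exact ⟨g, h1, h2⟩

theorem splitT_map {x' : End F V} {g : V ≃ₗ[F] V} {φ : V → F} (hφ : IsQ b φ) {n : ℕ} {α : Fin n → ℕ}
    (hg : ∀ v, φ (g v) = φ v) (hgx : ∀ v, g (x v) = x' (g v)) (h : SplitT b φ x α) :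
    SplitT b φ x' α := by
  obtain ⟨hα, ⟨e, f, hs, hc⟩, h0⟩ := h
  have h1 : HasType b x _ α α := ⟨hα, hα, e, f, hs, hc, rfl⟩
  have hS := hφ.spg' hg
  obtain ⟨-, -, e1, f1, hs1, hc1, -⟩ := h1.map hS hgx
  refine ⟨hα, ⟨e1, f1, hs1, hc1⟩, fun v hv => ?_⟩
  obtain ⟨w, rfl⟩ := g.surjective v
  rw [hg]
  exact h0 w ((Msub_map hS hgx).1 hv)

/-- Split orbits. -/
def SpO (n : ℕ) {φ : V → F} (hφ : IsQ b φ) : Quotient (oset b φ) → Prop :=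
  Quotient.lift (fun x : Nn b => ∃ α : Fin n → ℕ, SplitT b φ x.1 α) (by
    intro x y h
    apply propext
    constructor
    · rintro ⟨α, hα⟩
      obtain ⟨g, h1, h2⟩ := h
      exact ⟨α, splitT_map hφ h1 h2 hα⟩
    · rintro ⟨α, hα⟩
      obtain ⟨g, h1, h2⟩ := (oset b φ).symm h
      exact ⟨α, splitT_map hφ h1 h2 hα⟩)

theorem so_count [Fintype F] [Fintype V] [FiniteDimensional F V] (hb : Symp b) {φ : V → F}
    (hφ : IsQ b φ) {n : ℕ} (hn : finrank F V = 2 * n) [Nontrivial V] :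
    Nat.card (Quotient (sset hb hφ)) = Nat.card (Quotient (oset b φ)) +
      Nat.card {o // SpO n hφ o} := by
  obtain ⟨r, hr, hro⟩ := odd_exists hb hφ
  have hrS := hφ.spg' hr
  have hr' : ∀ v, φ (r.symm v) = φ v := fun v => by rw [← hr, r.apply_symm_apply]
  have hro' : ¬ Ev r.symm := by rwa [ev_symm hb hφ hr]
  have key : ∀ x : Nn b, ∀ v, r.symm ((cj x hrS).1 v) = x.1 (r.symm v) := by
    intro x v
    simp [cj]
  apply two_fiber _ _ (fun x => cj x hrS)
  · intro x y
    constructor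
    · rintro ⟨g, h1, h2⟩
      by_cases hg : Ev g
      · exact Or.inl ⟨g, h1, hg, h2⟩
      · refine Or.inr ⟨r.symm.trans g, fun v => ?_, (ev_trans hb hφ hr' h1).2 (iff_of_false hro' hg),
          fun v => ?_⟩
        · simp [h1, hr']
        · simp [key, h2]
    · rintro (⟨g, h1, hg, h2⟩ | ⟨g, h1, hg, h2⟩)
      · exact ⟨g, h1, h2⟩
      · refine ⟨r.trans g, fun v => ?_, fun v => ?_⟩
        · simp [h1, hr]
        · simp only [LinearEquiv.trans_apply]
          rw [cj_apply x hrS, h2]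
  · intro x
    change (∃ α : Fin n → ℕ, SplitT b φ x.1 α) ↔ _
    constructor
    · rintro ⟨α, hα⟩ ⟨g, h1, hg, h2⟩
      have h3 : Ev (r.trans g) := hα.ev hb x.2 hφ hn (fun v => by simp [h1, hr]) (fun v => by
        simp only [LinearEquiv.trans_apply]
        rw [cj_apply x hrS, h2])
      rw [ev_trans hb hφ hr h1] at h3
      exact hro (h3.2 hg)
    · intro h
      apply splitT_of hb x.2 hφ hn
      intro i u hu
      by_contra hne
      obtain ⟨g, h1, h2, h3⟩ := nonsplit hb x.2 hφ hu hne
      apply h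
      refine ⟨r.symm.trans g, fun v => ?_, (ev_trans hb hφ hr' h1).2 (iff_of_false hro' h3),
          fun v => ?_⟩
      · simp [h1, hr']
      · simp [key, h2]

theorem split_count [Fintype F] [Fintype V] [FiniteDimensional F V] (hb : Symp b) {φ : V → F}
    (hφ : IsQ b φ) {n : ℕ} (hn : finrank F V = 2 * n) (U : Submodule F V)
    (hU : ∀ v ∈ U, φ v = 0) (hd : finrank F U = n) :
    Nat.card {o // SpO n hφ o} = Nat.card {p : Bp n // p.sw = p} := by
  have hpp : ∀ p : {p : Bp n // p.sw = p}, p.1.1.2 = p.1.1.1 := by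
    intro p
    exact congrArg (fun q : Bp n => q.1.1) p.2
  have hex : ∀ p : {p : Bp n // p.sw = p}, ∃ x : Nn b, SplitT b φ x.1 p.1.1.1 := by
    intro p
    have h1 := p.1.2.2.2
    rw [hpp p] at h1
    obtain ⟨x, hx, h⟩ := SplitT.exists hb hφ hn U hU hd p.1.2.1 h1
    exact ⟨⟨x, hx⟩, h⟩
  choose X hX using hex
  symm
  apply Nat.card_congr
  refine Equiv.ofBijective (fun p => ⟨Quotient.mk _ (X p), ⟨_, hX p⟩⟩) ⟨?_, ?_⟩
  · intro p p' h
    have h1 := Quotient.exact (congrArg Subtype.val h)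
    obtain ⟨g, h2, h3⟩ := h1
    have h4 := (hX p).unique hb (X p).2 (X p').2 (hX p') (hφ.spg' h2) h3
    apply Subtype.ext
    apply Subtype.ext
    apply Prod.ext h4
    rw [hpp p, hpp p', h4]
  · rintro ⟨o, ho⟩
    obtain ⟨y, rfl⟩ := Quotient.exists_rep o
    obtain ⟨α, hα⟩ := ho
    obtain ⟨h1, ⟨e, f, hs, hc⟩, -⟩ := id hα
    have h2 := hs.card_eq hb y.2 hc
    have h3 : ∑ i, (α i + α i) = n := by
      rw [hn] at h2
      exact (Nat.eq_of_mul_eq_mul_left (by omega) h2).symm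
    let p : {p : Bp n // p.sw = p} := ⟨⟨(α, α), h1, h1, h3⟩, rfl⟩
    refine ⟨p, Subtype.ext (Quotient.sound ?_)⟩
    exact (hX p).conj hb (X p).2 y.2 hφ hα

theorem o_count [Fintype F] [Fintype V] [FiniteDimensional F V] (h : Chi χ) (hb : Symp b) {φ : V → F}
    (hφ : IsQ b φ) {n : ℕ} (hn : finrank F V = 2 * n) (hg : gs χ φ = (Fintype.card F : ℚ) ^ n) :
    Nat.card (Quotient (oset b φ)) =
      Nat.card {p : Ob b // TyData.sgn χ p = (Fintype.card F : ℚ) ^ n} := by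
  apply Nat.card_congr
  let m : Quotient (oset b φ) → {p : Ob b // TyData.sgn χ p = (Fintype.card F : ℚ) ^ n} :=
    Quotient.lift (fun x => ⟨cls x ⟨φ, hφ⟩, hg⟩) (by
      rintro x y ⟨g, h1, h2⟩
      apply Subtype.ext
      apply Quotient.sound
      exact ⟨g, hφ.spg' h1, h2, h1⟩)
  refine Equiv.ofBijective m ⟨?_, ?_⟩
  · intro p p' hpp
    obtain ⟨x, rfl⟩ := Quotient.exists_rep p
    obtain ⟨y, rfl⟩ := Quotient.exists_rep p'
    have h1 : cls x ⟨φ, hφ⟩ = cls y ⟨φ, hφ⟩ := congrArg Subtype.val hpp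
    obtain ⟨g, h2, h3, h4⟩ := Quotient.exact h1
    exact Quotient.sound ⟨g, h4, h3⟩
  · rintro ⟨p, hp⟩
    obtain ⟨⟨x, ψ⟩, rfl⟩ := Quotient.exists_rep p
    obtain ⟨g, h1, h2⟩ := plus_conj h hb ψ.2 hφ hn hp hg
    refine ⟨Quotient.mk _ (cj x h1), Subtype.ext ?_⟩
    symm
    apply Quotient.sound
    exact ⟨g, h1, fun v => cj_apply x h1 v, h2⟩

theorem main_count [Fintype F] [Fintype V] [FiniteDimensional F V] (hb : Symp b) {φ : V → F}
    (hφ : IsQ b φ) {n : ℕ} (hn : finrank F V = 2 * n) (hn1 : 1 ≤ n) (U : Submodule F V)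
    (hU : ∀ v ∈ U, φ v = 0) (hd : finrank F U = n) :
    2 * Nat.card (Quotient (sset hb hφ)) = Nat.card (Bp n) + 3 * Nat.card {p : Bp n // p.sw = p} := by
  have : Nontrivial V := Module.nontrivial_of_finrank_pos (R := F) (by omega)
  obtain ⟨χ, h⟩ := chi_exists F
  have hg := gs_of_ts h hb hφ hn U hU hd
  obtain ⟨T⟩ := tyData_exists h hb hn hφ hg
  have h1 := T.card_plus h hb hn ⟨φ, hφ⟩
  rw [so_count hb hφ hn, split_count hb hφ hn U hU hd, o_count h hb hφ hn hg]
  omega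

end socount
end NilOrb

namespace NilOrb
section comb

/-- Partitions as antitone functions. -/
abbrev Ap (n k : ℕ) := {α : Fin n → ℕ // Antitone α ∧ ∑ i, α i = k}

theorem filter_map_sum (M : Multiset ℕ) (j : ℕ) :
    ((M.filter (· ≠ 0)).map (· - j)).sum = (M.map (· - j)).sum := by
  induction M using Multiset.induction_on with
  | empty => simp
  | cons a M ih =>
    by_cases ha : a = 0
    · rw [Multiset.filter_cons_of_neg _ (by simpa using ha), ih]
      simp [ha]
    · rw [Multiset.filter_cons_of_pos (p := fun a : ℕ => a ≠ 0) _ ha]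
      simp [ih]

theorem card_Ap {n k : ℕ} (hk : k ≤ n) : Nat.card (Ap n k) = Fintype.card (Nat.Partition k) := by
  classical
  rw [← Nat.card_eq_fintype_card]
  apply Nat.card_congr
  refine Equiv.ofBijective (fun α => Nat.Partition.ofSums k (univ.val.map α.1) α.2.2) ⟨?_, ?_⟩
  · intro α α' h
    apply Subtype.ext
    apply antitone_unique α.2.1 α'.2.1
    intro j
    have h1 : (univ.val.map α.1).filter (· ≠ 0) = (univ.val.map α'.1).filter (· ≠ 0) :=
      congrArg Nat.Partition.parts h
    have h2 := congrArg (fun M : Multiset ℕ => (M.map (· - j)).sum) h1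
    simp only [filter_map_sum] at h2
    rw [Multiset.map_map, Multiset.map_map] at h2
    exact h2
  · intro p
    have hc : Multiset.card p.parts ≤ n := by
      have h1 : Multiset.card p.parts • 1 ≤ p.parts.sum :=
        Multiset.card_nsmul_le_sum (fun a ha => p.parts_pos ha)
      rw [p.parts_sum] at h1
      simp at h1
      omega
    set M : Multiset ℕ := p.parts + Multiset.replicate (n - Multiset.card p.parts) 0 with hM
    set L := M.sort (· ≥ ·) with hL
    have hlen : L.length = n := by
      rw [hL, Multiset.length_sort, hM]; simp; omega
    let α : Fin n → ℕ := fun i => L.get (i.cast hlen.symm)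
    have hmap : univ.val.map α = M := by
      have : univ.val.map α = (List.ofFn α : Multiset ℕ) := by
        rw [List.ofFn_eq_map]; rfl
      rw [this]
      have h2 : List.ofFn α = L := by
        apply List.ext_get
        · simp [hlen]
        · intro i h1 h2
          simp [α]
      rw [h2, hL, Multiset.sort_eq]
    have hant : Antitone α := by
      intro i j hij
      have hs : L.Pairwise (· ≥ ·) := M.pairwise_sort (· ≥ ·)
      rcases hij.eq_or_lt with rfl | hlt
      · exact le_rfl
      · exact List.pairwise_iff_get.1 hs (i.cast hlen.symm) (j.cast hlen.symm) hlt
    have hsum : ∑ i, α i = k := by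
      change (univ.val.map α).sum = k
      rw [hmap, hM]; simp [p.parts_sum]
    refine ⟨⟨α, hant, hsum⟩, ?_⟩
    apply Nat.Partition.ext
    change (univ.val.map α).filter (· ≠ 0) = p.parts
    rw [hmap, hM, Multiset.filter_add, Multiset.filter_eq_self.2 (fun a ha => (p.parts_pos ha).ne'),
      Multiset.filter_eq_nil.2]
    · simp
    · intro a ha
      simp [Multiset.eq_of_mem_replicate ha]

theorem card_Bp (n : ℕ) : Nat.card (Bp n) =
    ∑ k ∈ range (n + 1), Fintype.card (Nat.Partition k) * Fintype.card (Nat.Partition (n - k)) := by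
  have hs : ∀ p : Bp n, ∑ i, p.1.1 i + ∑ i, p.1.2 i = n := fun p => by
    rw [← Finset.sum_add_distrib]; exact p.2.2.2
  let E : Bp n ≃ Σ k : Fin (n + 1), Ap n k × Ap n (n - k) :=
    { toFun := fun p => ⟨⟨∑ i, p.1.1 i, by have := hs p; omega⟩, ⟨p.1.1, p.2.1, rfl⟩,
        ⟨p.1.2, p.2.2.1, by have := hs p; simp only; omega⟩⟩
      invFun := fun q => ⟨(q.2.1.1, q.2.2.1), q.2.1.2.1, q.2.2.2.1, by
        have := q.1.2
        rw [Finset.sum_add_distrib]; simp only [q.2.1.2.2, q.2.2.2.2]; omega⟩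
      left_inv := fun p => rfl
      right_inv := by
        rintro ⟨⟨k, hk⟩, ⟨α, h1, h2⟩, β, h3, h4⟩
        simp only at h2
        subst h2
        rfl }
  rw [Nat.card_congr E, ← Fin.sum_univ_eq_sum_range
    (fun k => Fintype.card (Nat.Partition k) * Fintype.card (Nat.Partition (n - k)))]
  have hf : ∀ k : Fin (n + 1), Nat.card (Ap n k × Ap n (n - k)) =
      Fintype.card (Nat.Partition k) * Fintype.card (Nat.Partition (n - k)) := by
    intro k
    rw [Nat.card_prod, card_Ap (by omega), card_Ap (by omega)]
  have hfin : ∀ k : Fin (n + 1), Finite (Ap n k × Ap n (n - k)) := by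
    intro k
    refine (Nat.finite_of_card_ne_zero ?_)
    rw [hf]
    exact Nat.mul_ne_zero Fintype.card_ne_zero Fintype.card_ne_zero
  rw [Nat.card_sigma]
  exact Finset.sum_congr rfl fun k _ => hf k

theorem sw_iff {n : ℕ} (p : Bp n) : p.sw = p ↔ p.1.2 = p.1.1 := by
  constructor
  · intro h; exact congrArg (fun q : Bp n => q.1.1) h
  · intro h
    apply Subtype.ext
    exact Prod.ext h h.symm

theorem card_sw_odd {n : ℕ} (hn : Odd n) : Nat.card {p : Bp n // p.sw = p} = 0 := by
  rw [Nat.card_eq_zero]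
  left
  constructor
  rintro ⟨p, hp⟩
  rw [sw_iff] at hp
  have h := p.2.2.2
  rw [hp, Finset.sum_add_distrib] at h
  obtain ⟨k, hk⟩ := hn
  omega

theorem card_sw_even {n : ℕ} (hn : Even n) :
    Nat.card {p : Bp n // p.sw = p} = Fintype.card (Nat.Partition (n / 2)) := by
  rw [← card_Ap (Nat.div_le_self n 2)]
  obtain ⟨m, hm⟩ := hn
  have h2 : n / 2 = m := by omega
  rw [h2]
  apply Nat.card_congr
  exact
    { toFun := fun p => ⟨p.1.1.1, p.1.2.1, by
        have h := p.1.2.2.2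
        rw [(sw_iff p.1).1 p.2, Finset.sum_add_distrib] at h
        omega⟩
      invFun := fun α => ⟨⟨(α.1, α.1), α.2.1, α.2.1, by
        rw [Finset.sum_add_distrib]; simp only [α.2.2]; omega⟩, rfl⟩
      left_inv := fun p => by
        apply Subtype.ext
        apply Subtype.ext
        exact Prod.ext rfl ((sw_iff p.1).1 p.2).symm
      right_inv := fun α => rfl }

end comb
end NilOrb

/-- Over a finite field `F` of characteristic 2, the number of nilpotent
`SO^+_{2n}(F)`-orbits in `𝔬^+_{2n}(F)` is `(1/2)p₂(n)` if `n` is odd, and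
`(1/2)p₂(n) + (3/2)p(n/2)` if `n` is even. -/
theorem nilpotent_orbits_even_special_orthogonal_plus
    (F : Type*) [Field F] [Fintype F] [CharP F 2]
    (n : ℕ) (hn : 1 ≤ n)
    (V : Type*) [AddCommGroup V] [Module F V] [FiniteDimensional F V]
    (Q : QuadraticForm F V)
    (hdim : Module.finrank F V = 2 * n)
    (hQ : Q.IsNondegenerateFormSpace)
    (hWitt : Q.HasTotallySingularSubspace n) :
    (Odd n → 2 * Q.numNilpotentSOOrbits = numPartitionPairs n) ∧
    (Even n → 2 * Q.numNilpotentSOOrbits = numPartitionPairs n + 3 * numPartitions (n / 2)) := by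
  classical
  have hVf : Finite V := Module.finite_of_finite F
  have hVft : Fintype V := Fintype.ofFinite V
  obtain ⟨-, hr1, -⟩ := hQ
  obtain ⟨U, hd, hU⟩ := hWitt
  have hb0 : ∀ v w, QuadraticMap.polarBilin Q v w = Q (v + w) - Q v - Q w := fun v w => rfl
  have halt : ∀ v, QuadraticMap.polarBilin Q v v = 0 := by
    intro v
    rw [hb0, ← two_smul F v, QuadraticMap.map_smul, CharTwo.two_eq_zero]
    simp [CharTwo.neg_eq, CharTwo.sub_eq_add, CharTwo.add_self_eq_zero]
  have hker : LinearMap.ker (QuadraticMap.polarBilin Q) = ⊥ := by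
    have h1 := NilOrb.even_of_alt (QuadraticMap.polarBilin Q) halt
    have h2 : finrank F (LinearMap.ker (QuadraticMap.polarBilin Q)) ≤ 1 := hr1
    rw [hdim] at h1
    have h3 : Even (finrank F (LinearMap.ker (QuadraticMap.polarBilin Q))) :=
      (Nat.even_add.1 h1).1 (even_two_mul n)
    obtain ⟨k, hk⟩ := h3
    exact Submodule.finrank_eq_zero.1 (by omega)
  have hb : NilOrb.Symp (QuadraticMap.polarBilin Q) := by
    refine ⟨halt, fun v hv => ?_⟩
    have : v ∈ LinearMap.ker (QuadraticMap.polarBilin Q) := LinearMap.ext hv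
    rw [hker] at this
    exact this
  have hφ : NilOrb.IsQ (QuadraticMap.polarBilin Q) (fun v => Q v) := by
    refine ⟨fun v w => ?_, fun a v => ?_⟩
    · rw [hb0]; ring
    · rw [QuadraticMap.map_smul, smul_eq_mul]; ring
  have key : Q.numNilpotentSOOrbits = Nat.card (Quotient (NilOrb.sset hb hφ)) := by
    apply Nat.card_congr
    let E : {x : Module.End F V // Q.mem_oLie x ∧ IsNilpotent x} ≃
        NilOrb.Nn (QuadraticMap.polarBilin Q) :=
      { toFun := fun x => ⟨x.1, x.2.1.1, x.2.2⟩
        invFun := fun x => ⟨x.1, ⟨x.2.alt,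
          (LinearMap.isNilpotent_trace_of_isNilpotent x.2.nil).eq_zero⟩, x.2.nil⟩
        left_inv := fun _ => rfl
        right_inv := fun _ => rfl }
    refine Quot.congr E ?_
    intro x y
    constructor
    · rintro ⟨g, h1, h2, h3⟩
      refine ⟨g, h1, h2, fun v => ?_⟩
      change g (x.1 v) = y.1 (g v)
      rw [h3]; simp
    · rintro ⟨g, h1, h2, h3⟩
      refine ⟨g, h1, h2, LinearMap.ext fun v => ?_⟩
      have h4 : g (x.1 (g.symm v)) = y.1 (g (g.symm v)) := h3 (g.symm v)
      rw [g.apply_symm_apply] at h4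
      exact h4.symm
  have main := NilOrb.main_count hb hφ hdim hn U hU hd
  rw [← key, NilOrb.card_Bp] at main
  constructor
  · intro ho
    rw [NilOrb.card_sw_odd ho] at main
    exact main
  · intro he
    rw [NilOrb.card_sw_even he] at main
    exact main
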